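/- arXiv:2412.16738 — 4 statements merged into one kernel-verified Lean document; each statement's English description precedes it below -/
import Mathlib

section
/- (Kolmogorov, 1957.) For every integer d ≥ 2 there exist continuous real functions ψ_{p,q} : [0,1] → ℝ, for 1 ≤ p ≤ d and 0 ≤ q ≤ 2d, such that every continuous real function f on the d-dimensional unit cube [0,1]^d is representable as f(x₁,…,x_d) = Σ_{q=0}^{2d} g_q(Σ_{p=1}^{d} ψ_{p,q}(x_p)), where the g_q are continuous real functions on ℝ (depending on f). -/
open Filter Topology

abbrev KI := Set.Icc (0:ℝ) 1

set_option synthInstance.maxHeartbeats 400000 in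
lemma ka_baire (d m : ℕ) : BaireSpace (Fin d → Fin m → C(KI, ℝ)) :=
  inferInstance

lemma ka_stair_cont (m : ℝ) (hm : 1 ≤ m) :
    Continuous (fun v : ℝ => v + (max 0 (1 - m * (1 - Int.fract v)) - Int.fract v)) := by
  have h : Continuous ((fun w : ℝ => max 0 (1 - m * (1 - w)) - w) ∘ Int.fract) := by
    apply ContinuousOn.comp_fract''
    · fun_prop
    · simp; linarith
  exact continuous_id.add h

lemma ka_theta (m N : ℕ) (hm : 0 < m) (hN : 0 < N) :
    ∃ (θ : Fin m → C(KI, KI)) (T : Fin m → Finset KI),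
      (∀ q t, dist (θ q t) t ≤ 1 / N) ∧
      ∀ t q qq, θ q t ∉ T q → θ qq t ∉ T qq → q = qq := by
  have hm1 : (1:ℝ) ≤ m := by exact_mod_cast hm
  have hN1 : (1:ℝ) ≤ N := by exact_mod_cast hN
  have hN0 : (0:ℝ) < N := by linarith
  have hm0 : (0:ℝ) < m := by linarith
  let s : ℝ → ℝ := fun v => v + (max 0 (1 - m * (1 - Int.fract v)) - Int.fract v)
  have hs : Continuous s := ka_stair_cont m hm1
  have hsd : ∀ v, |s v - v| ≤ 1 := by
    intro v
    have h0 := Int.fract_nonneg v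
    have h1 := (Int.fract_lt_one v).le
    simp only [s, add_sub_cancel_left]
    rw [abs_le]
    constructor
    · have := le_max_left 0 (1 - m * (1 - Int.fract v)); linarith
    · have : max 0 (1 - m * (1 - Int.fract v)) ≤ 1 := by
        apply max_le (by norm_num)
        nlinarith
      linarith
  have hsf : ∀ v : ℝ, Int.fract v ≤ 1 - 1 / m → s v = ⌊v⌋ := by
    intro v hv
    have : max 0 (1 - m * (1 - Int.fract v)) = 0 := by
      apply max_eq_left
      have : (m:ℝ) * (1 / m) = 1 := by field_simp
      nlinarith
    simp only [s, this]
    have := Int.floor_add_fract v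
    linarith
  let P : ℝ → KI := Set.projIcc 0 1 zero_le_one
  have hP : Continuous P := continuous_projIcc
  refine ⟨fun q => ⟨fun t => P ((s (N * (t:ℝ) + q / m) - q / m) / N), by fun_prop⟩,
    fun q => (Finset.Icc (0:ℤ) (N+1)).image (fun j : ℤ => P (((j:ℝ) - q / m) / N)), ?_, ?_⟩
  · intro q t
    have ht : P (t:ℝ) = t := Set.projIcc_val zero_le_one t
    have h1 : ∀ a b : ℝ, dist (P a) (P b) ≤ dist a b := by
      intro a b
      have := (LipschitzWith.projIcc (zero_le_one (α := ℝ))).dist_le_mul a b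
      simpa using this
    calc dist (P ((s (N * (t:ℝ) + q / m) - q / m) / N)) t
        = dist (P ((s (N * (t:ℝ) + q / m) - q / m) / N)) (P (t:ℝ)) := by rw [ht]
      _ ≤ _ := h1 _ _
      _ = |s (N * (t:ℝ) + q / m) - (N * (t:ℝ) + q / m)| / N := by
        rw [Real.dist_eq, ← abs_of_pos hN0, ← abs_div, abs_of_pos hN0]
        congr 1
        field_simp
        ring
      _ ≤ 1 / N := by gcongr; exact hsd _
  · intro t q qq h hh
    have key : ∀ q : Fin m, P ((s (N * (t:ℝ) + q / m) - q / m) / N) ∉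
        (Finset.Icc (0:ℤ) (N+1)).image (fun j : ℤ => P (((j:ℝ) - q / m) / N)) →
        1 - 1 / (m:ℝ) < Int.fract (N * (t:ℝ) + q / m) := by
      intro q hq
      by_contra hc
      push Not at hc
      apply hq
      rw [Finset.mem_image]
      have hq1 : (q:ℝ) / m ≤ 1 := by
        rw [div_le_one hm0]; exact_mod_cast q.2.le
      have hq0 : 0 ≤ (q:ℝ) / m := by positivity
      refine ⟨⌊N * (t:ℝ) + q / m⌋, ?_, by rw [hsf _ hc]⟩
      rw [Finset.mem_Icc]
      have t0 := t.2.1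
      have t1 := t.2.2
      constructor
      · apply Int.floor_nonneg.2; positivity
      · have : ((⌊N * (t:ℝ) + q / m⌋ : ℤ) : ℝ) ≤ ((N + 1 : ℤ) : ℝ) := by
          refine (Int.floor_le _).trans ?_
          push_cast
          nlinarith
        exact_mod_cast this
    have k1 := key q h
    have k2 := key qq hh
    have l1 := Int.fract_lt_one (N * (t:ℝ) + q / m)
    have l2 := Int.fract_lt_one (N * (t:ℝ) + qq / m)
    have e1 := Int.floor_add_fract (N * (t:ℝ) + q / m)
    have e2 := Int.floor_add_fract (N * (t:ℝ) + qq / m)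
    set a := ⌊N * (t:ℝ) + q / m⌋
    set b := ⌊N * (t:ℝ) + qq / m⌋
    have hd : |((q:ℝ) - qq) / m - (a - b)| < 1 / m := by
      rw [abs_lt, sub_div]; constructor <;> linarith
    have hd2 : |((q:ℝ) - qq) - m * (a - b)| < 1 := by
      have : ((q:ℝ) - qq) - m * (a - b) = m * (((q:ℝ) - qq) / m - (a - b)) := by
        field_simp
      rw [this, abs_mul, abs_of_pos hm0]
      calc _ < (m:ℝ) * (1 / m) := by gcongr
        _ = 1 := by field_simp
    have hd3 : |((q:ℤ) - qq) - m * (a - b)| < 1 := by exact_mod_cast hd2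
    rw [Int.abs_lt_one_iff] at hd3
    have hq := q.2
    have hqq := qq.2
    have hab : a - b = 0 := by
      by_contra hne
      have : 1 ≤ |a - b| := Int.one_le_abs hne
      have h5 : |((q:ℤ) - qq)| < m := by rw [abs_lt]; omega
      have h6 : ((q:ℤ) - qq) = m * (a - b) := by linarith
      rw [h6, abs_mul] at h5
      have : |(m:ℤ)| = m := abs_of_nonneg (by positivity)
      rw [this] at h5
      nlinarith
    rw [hab] at hd3
    apply Fin.ext
    omega

lemma ka_sep (d m : ℕ) (T : Fin m → Finset KI) :
    Dense {ψ : Fin d → Fin m → C(KI, ℝ) | ∀ q, ∀ x y : Fin d → T q, x ≠ y →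
      ∑ p, ψ p q (x p) ≠ ∑ p, ψ p q (y p)} := by
  let s : (Σ q : Fin m, (Fin d → T q) × (Fin d → T q)) → Set (Fin d → Fin m → C(KI, ℝ)) :=
    fun i => {ψ | i.2.1 ≠ i.2.2 → ∑ p, ψ p i.1 (i.2.1 p) ≠ ∑ p, ψ p i.1 (i.2.2 p)}
  have h : Dense (⋂ i, s i) := by
    have := ka_baire d m
    apply dense_iInter_of_isOpen
    · rintro ⟨q, x, y⟩
      by_cases hxy : x = y
      · simp [s, hxy]
      · simp only [s, ne_eq, hxy, not_false_eq_true, true_imp_iff]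
        apply isOpen_ne_fun <;> fun_prop
    · rintro ⟨q, x, y⟩ ψ
      by_cases hxy : x = y
      · simp [s, hxy]
      · simp only [s, ne_eq, hxy, not_false_eq_true, true_imp_iff]
        by_cases hψ : ∑ p, ψ p q (x p) = ∑ p, ψ p q (y p)
        · obtain ⟨p₀, hp₀⟩ := Function.ne_iff.1 hxy
          let ι : C(KI, ℝ) := ⟨fun t => (t:ℝ), by fun_prop⟩
          let φ : Fin d → Fin m → C(KI, ℝ) := Pi.single p₀ (fun _ => ι)
          have ht : Tendsto (fun n : ℕ => ψ + (1 / ((n:ℝ) + 1)) • φ) atTop (𝓝 (ψ + (0:ℝ) • φ)) :=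
            tendsto_const_nhds.add (tendsto_one_div_add_atTop_nhds_zero_nat.smul_const φ)
          rw [zero_smul, add_zero] at ht
          refine mem_closure_of_tendsto ht (Eventually.of_forall fun n => ?_)
          have hφ : ∀ z : Fin d → T q, ∑ p, φ p q (z p) = ((z p₀ : KI) : ℝ) := by
            intro z
            rw [Finset.sum_eq_single p₀]
            · simp [φ, ι]
            · intro b _ hb
              simp [φ, hb]
            · simp
          simp only [Set.mem_ofPred_eq, Pi.add_apply, Pi.smul_apply, ContinuousMap.add_apply,
            ContinuousMap.smul_apply, Finset.sum_add_distrib, ← Finset.smul_sum, hφ, hψ]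
          intro hc
          have hc2 := add_left_cancel hc
          have hpos : (1 / ((n:ℝ) + 1)) ≠ 0 := by positivity
          have := smul_right_injective ℝ hpos hc2
          exact hp₀ (Subtype.ext (Subtype.ext this))
        · exact subset_closure hψ
  refine h.mono ?_
  intro ψ hψ q x y hxy
  rw [Set.mem_iInter] at hψ
  exact hψ ⟨q, x, y⟩ hxy

lemma ka_interp {ι : Type*} [Finite ι] (S : ι → ℝ) (hS : Function.Injective S) (v : ι → ℝ) (M : ℝ)
    (hM : 0 ≤ M) (hv : ∀ i, |v i| ≤ M) :
    ∃ g : BoundedContinuousFunction ℝ ℝ, ‖g‖ ≤ M ∧ ∀ i, g (S i) = v i := by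
  classical
  cases nonempty_fintype ι
  let p := Lagrange.interpolate Finset.univ S v
  refine ⟨BoundedContinuousFunction.ofNormedAddCommGroup
    (fun t => max (-M) (min M (p.eval t))) (by fun_prop) M ?_, ?_, ?_⟩
  · intro t
    rw [Real.norm_eq_abs, abs_le]
    exact ⟨le_max_left _ _, max_le (by linarith) (min_le_left _ _)⟩
  · apply BoundedContinuousFunction.norm_ofNormedAddCommGroup_le _ hM
  · intro i
    have : p.eval (S i) = v i :=
      Lagrange.eval_interpolate_at_node _ (hS.injOn) (Finset.mem_univ i)
    have h := abs_le.1 (hv i)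
    simp [this, h.1, h.2]

/-- `ψ` admits a one-step approximation of `f`. -/
def KAGood (d m : ℕ) (f : C(Fin d → KI, ℝ)) : Set (Fin d → Fin m → C(KI, ℝ)) :=
  {ψ | ∃ g : Fin m → BoundedContinuousFunction ℝ ℝ, (∀ q, ‖g q‖ ≤ ‖f‖) ∧
    ∀ x, |f x - ∑ q, g q (∑ p, ψ p q (x p))| < (1 - 1 / (2 * m)) * ‖f‖}

lemma ka_good_open (d m : ℕ) (f : C(Fin d → KI, ℝ)) : IsOpen (KAGood d m f) := by
  rw [isOpen_iff_mem_nhds]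
  rintro ψ ⟨g, hg, hx⟩
  have hc : Continuous (fun z : (Fin d → Fin m → C(KI, ℝ)) × (Fin d → KI) =>
      |f z.2 - ∑ q, g q (∑ p, z.1 p q (z.2 p))|) := by
    fun_prop
  have h := isCompact_univ.eventually_forall_of_forall_eventually
    (x₀ := ψ) (K := (Set.univ : Set (Fin d → KI)))
    (P := fun ψ x => |f x - ∑ q, g q (∑ p, ψ p q (x p))| < (1 - 1 / (2 * m)) * ‖f‖) (by
      intro x _
      exact (hc.tendsto (ψ, x)).eventually (gt_mem_nhds (hx x)))
  filter_upwards [h] with ψn hh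
  exact ⟨g, hg, fun x => hh x (Set.mem_univ _)⟩

lemma ka_good_dense (d : ℕ) (f : C(Fin d → KI, ℝ)) (hf : f ≠ 0) :
    Dense (KAGood d (2 * d + 1) f) := by
  set m := 2 * d + 1 with hm
  have hm0 : (0:ℝ) < m := by rw [hm]; positivity
  have hf0 : 0 < ‖f‖ := norm_pos_iff.2 hf
  rw [Metric.dense_iff]
  intro ψ₀ r hr
  -- modulus of continuity for f
  have hfu : UniformContinuous f := CompactSpace.uniformContinuous_of_continuous f.continuous
  obtain ⟨δ₁, hδ₁, hfδ⟩ := Metric.uniformContinuous_iff.1 hfu (‖f‖ / (4 * m)) (by positivity)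
  -- modulus of continuity for ψ₀
  have hψu : ∀ p q, ∃ δ > 0, ∀ a b : KI, dist a b < δ → dist (ψ₀ p q a) (ψ₀ p q b) < r / 8 := by
    intro p q
    have hu : UniformContinuous (ψ₀ p q) :=
      CompactSpace.uniformContinuous_of_continuous (ψ₀ p q).continuous
    obtain ⟨δ, h1, h2⟩ := Metric.uniformContinuous_iff.1 hu (r / 8) (by positivity)
    exact ⟨δ, h1, fun a b h => h2 h⟩
  choose δ₂ hδ₂ hψδ using hψu
  have hδ : ∃ N : ℕ, 0 < N ∧ (1 / N : ℝ) < δ₁ ∧ ∀ p q, (1 / N : ℝ) < δ₂ p q := by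
    have ht := tendsto_one_div_atTop_nhds_zero_nat (𝕜 := ℝ)
    have e1 := ht.eventually (gt_mem_nhds hδ₁)
    have e2 : ∀ᶠ n : ℕ in atTop, ∀ p q, (1 / n : ℝ) < δ₂ p q :=
      eventually_all.2 fun p => eventually_all.2 fun q => ht.eventually (gt_mem_nhds (hδ₂ p q))
    obtain ⟨N, h1, h2, h3⟩ := ((eventually_gt_atTop 0).and (e1.and e2)).exists
    exact ⟨N, h1, h2, h3⟩
  obtain ⟨N, hN, hN1, hN2⟩ := hδ
  obtain ⟨θ, T, hθ, hT⟩ := ka_theta m N (by omega) hN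
  obtain ⟨ψ₁, hψ₁, hsep⟩ := Metric.dense_iff.1 (ka_sep d m T) ψ₀ (r / 8) (by positivity)
  have hclose : ∀ p q (t : KI), dist (ψ₁ p q t) (ψ₀ p q t) ≤ r / 8 := by
    intro p q t
    have h1 := ContinuousMap.dist_apply_le_dist (f := ψ₁ p q) (g := ψ₀ p q) t
    have h2 := dist_le_pi_dist (ψ₁ p) (ψ₀ p) q
    have h3 := dist_le_pi_dist ψ₁ ψ₀ p
    have h4 := Metric.mem_ball.1 hψ₁
    linarith
  refine ⟨fun p q => (ψ₁ p q).comp (θ q), ?_, ?_⟩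
  · rw [Metric.mem_ball]
    refine lt_of_le_of_lt (b := r / 2) ?_ (by linarith)
    refine (dist_pi_le_iff (by positivity)).2 fun p => (dist_pi_le_iff (by positivity)).2 fun q => ?_
    refine (ContinuousMap.dist_le (by positivity)).2 fun t => ?_
    have h1 := hclose p q (θ q t)
    have h2 := hψδ p q (θ q t) t ((hθ q t).trans_lt (hN2 p q))
    have h3 := dist_triangle (ψ₁ p q (θ q t)) (ψ₀ p q (θ q t)) (ψ₀ p q t)
    simp only [ContinuousMap.comp_apply]
    linarith
  · have hg : ∀ q, ∃ g : BoundedContinuousFunction ℝ ℝ, ‖g‖ ≤ ‖f‖ / m ∧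
        ∀ i : Fin d → T q, g (∑ p, ψ₁ p q (i p)) = f (fun p => i p) / m := by
      intro q
      apply ka_interp (fun i : Fin d → T q => ∑ p, ψ₁ p q (i p))
      · intro x y hxy
        by_contra hne
        exact hsep q x y hne hxy
      · positivity
      · intro i
        rw [abs_div, abs_of_pos hm0]
        gcongr
        exact f.norm_coe_le_norm _
    choose g hgn hg using hg
    refine ⟨g, fun q => (hgn q).trans ?_, ?_⟩
    · apply div_le_self hf0.le
      rw [hm]; push_cast; linarith [(Nat.cast_nonneg d : (0:ℝ) ≤ d)]
    intro x
    simp only [ContinuousMap.comp_apply]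
    let B : Finset (Fin m) := Finset.univ.filter (fun q => ∃ p, θ q (x p) ∉ T q)
    have hB : B.card ≤ d := by
      have hch : ∀ q : B, ∃ p, θ q (x p) ∉ T q := fun q => (Finset.mem_filter.1 q.2).2
      choose c hc using hch
      have hinj : Function.Injective c := by
        intro q qq h
        apply Subtype.ext
        refine hT (x (c q)) q qq (hc q) ?_
        rw [h]; exact hc qq
      have := Fintype.card_le_of_injective c hinj
      simpa using this
    have hterm : ∀ q, |f x / m - g q (∑ p, ψ₁ p q (θ q (x p)))| ≤
        ‖f‖ / (4 * m) / m + (if q ∈ B then 2 * (‖f‖ / m) else 0) := by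
      intro q
      have hfx : |f x| / m ≤ ‖f‖ / m := by gcongr; exact f.norm_coe_le_norm _
      by_cases hq : q ∈ B
      · rw [if_pos hq]
        have h1 := abs_sub (f x / m) (g q (∑ p, ψ₁ p q (θ q (x p))))
        have h2 : |g q (∑ p, ψ₁ p q (θ q (x p)))| ≤ ‖f‖ / m :=
          ((g q).norm_coe_le_norm _).trans (hgn q)
        rw [abs_div, abs_of_pos hm0] at h1
        have : 0 ≤ ‖f‖ / (4 * m) / m := by positivity
        linarith
      · rw [if_neg hq, add_zero]
        have hqq : ∀ p, θ q (x p) ∈ T q := by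
          intro p
          by_contra h
          exact hq (Finset.mem_filter.2 ⟨Finset.mem_univ _, p, h⟩)
        have h1 := hg q (fun p => ⟨θ q (x p), hqq p⟩)
        simp only at h1
        rw [h1, ← sub_div, abs_div, abs_of_pos hm0]
        gcongr
        refine (hfδ ?_).le
        refine lt_of_le_of_lt ((dist_pi_le_iff (by positivity)).2 fun p => ?_) hN1
        rw [dist_comm]
        exact hθ q (x p)
    have hsum : f x - ∑ q, g q (∑ p, ψ₁ p q (θ q (x p))) =
        ∑ q, (f x / m - g q (∑ p, ψ₁ p q (θ q (x p)))) := by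
      rw [Finset.sum_sub_distrib]
      simp only [Finset.sum_const, Finset.card_univ, Fintype.card_fin, nsmul_eq_mul]
      congr 1
      field_simp
    rw [hsum]
    have hBr : (B.card : ℝ) ≤ d := by exact_mod_cast hB
    have hmd : (m:ℝ) = 2 * d + 1 := by rw [hm]; push_cast; ring
    calc _ ≤ ∑ q, |f x / m - g q (∑ p, ψ₁ p q (θ q (x p)))| := Finset.abs_sum_le_sum_abs _ _
      _ ≤ ∑ q, (‖f‖ / (4 * m) / m + (if q ∈ B then 2 * (‖f‖ / m) else 0)) :=
        Finset.sum_le_sum fun q _ => hterm q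
      _ = ‖f‖ / (4 * m) + B.card * (2 * (‖f‖ / m)) := by
        rw [Finset.sum_add_distrib, Finset.sum_ite_mem]
        simp only [Finset.sum_const, Finset.card_univ, Fintype.card_fin, nsmul_eq_mul,
          Finset.univ_inter]
        congr 1
        field_simp
      _ ≤ ‖f‖ / (4 * m) + d * (2 * (‖f‖ / m)) := by gcongr
      _ < (1 - 1 / (2 * m)) * ‖f‖ := by
        have hd : (d:ℝ) = (m - 1) / 2 := by rw [hmd]; ring
        rw [hd]
        have : (1 - 1 / (2 * m)) * ‖f‖ - (‖f‖ / (4 * m) + (m - 1) / 2 * (2 * (‖f‖ / m)))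
            = ‖f‖ / (4 * m) := by
          field_simp
          ring
        have : 0 < ‖f‖ / (4 * m) := by positivity
        linarith

lemma ka_exists (d : ℕ) : ∃ ψ : Fin d → Fin (2 * d + 1) → C(KI, ℝ),
    ∃ c : ℝ, 0 ≤ c ∧ c < 1 ∧ ∀ f : C(Fin d → KI, ℝ),
      ∃ g : Fin (2 * d + 1) → BoundedContinuousFunction ℝ ℝ, (∀ q, ‖g q‖ ≤ 2 * ‖f‖) ∧
        ∀ x, |f x - ∑ q, g q (∑ p, ψ p q (x p))| ≤ c * ‖f‖ := by
  have hdense : Dense (⋂ n : ℕ, {ψ : Fin d → Fin (2 * d + 1) → C(KI, ℝ) |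
      TopologicalSpace.denseSeq C(Fin d → KI, ℝ) n ≠ 0 →
      ψ ∈ KAGood d (2 * d + 1) (TopologicalSpace.denseSeq C(Fin d → KI, ℝ) n)}) := by
    have := ka_baire d (2 * d + 1)
    apply dense_iInter_of_isOpen
    · intro n
      by_cases h : TopologicalSpace.denseSeq C(Fin d → KI, ℝ) n = 0
      · simp [h]
      · simpa [h] using ka_good_open d (2 * d + 1) _
    · intro n
      by_cases h : TopologicalSpace.denseSeq C(Fin d → KI, ℝ) n = 0
      · simp [h]
      · simpa [h] using ka_good_dense d _ h
  set m := 2 * d + 1 with hm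
  obtain ⟨ψ, hψ⟩ := hdense.nonempty
  rw [Set.mem_iInter] at hψ
  have hm0 : (1:ℝ) ≤ m := by rw [hm]; push_cast; linarith [(Nat.cast_nonneg d : (0:ℝ) ≤ d)]
  have hinv : (1:ℝ) / m ≤ 1 := by rw [div_le_one (by linarith)]; exact hm0
  have hinv0 : 0 < (1:ℝ) / m := by positivity
  have hinv2 : (1:ℝ) / (2 * m) = 1 / m / 2 := by field_simp
  refine ⟨ψ, 1 - 1 / m / 4, by linarith, by linarith, fun f => ?_⟩
  by_cases hf : f = 0
  · refine ⟨0, ?_, ?_⟩ <;> simp [hf]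
  have hf0 : 0 < ‖f‖ := norm_pos_iff.2 hf
  obtain ⟨n, hn⟩ := (TopologicalSpace.denseRange_denseSeq C(Fin d → KI, ℝ)).exists_dist_lt f
    (ε := 1 / m / 8 * ‖f‖) (by positivity)
  set fapx := TopologicalSpace.denseSeq C(Fin d → KI, ℝ) n
  have hfa : ‖fapx‖ ≤ (1 + 1 / m / 8) * ‖f‖ := by
    have h1 : ‖fapx‖ ≤ ‖f‖ + ‖fapx - f‖ := norm_le_norm_add_norm_sub' _ _
    rw [← dist_eq_norm, dist_comm] at h1
    linarith
  have hfb : fapx ≠ 0 := by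
    intro h
    rw [h, dist_zero_right] at hn
    nlinarith
  obtain ⟨g, hg, hx⟩ := hψ n hfb
  refine ⟨g, fun q => (hg q).trans (hfa.trans (by nlinarith)), fun x => ?_⟩
  have h1 := hx x
  have h2 : |f x - fapx x| ≤ 1 / m / 8 * ‖f‖ := by
    rw [← Real.dist_eq]
    exact (ContinuousMap.dist_apply_le_dist x).trans hn.le
  have h3 := abs_sub_le (f x) (fapx x) (∑ q, g q (∑ p, ψ p q (x p)))
  rw [hinv2] at h1
  have h4 : (1 - 1 / (m:ℝ) / 2) * ‖fapx‖ ≤ (1 - 1 / m / 2) * ((1 + 1 / m / 8) * ‖f‖) := by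
    apply mul_le_mul_of_nonneg_left hfa; linarith
  have h5 : 0 ≤ 1 / (m:ℝ) * (1 / m) * ‖f‖ := by positivity
  nlinarith

theorem kolmogorov_arnold_representation (d : ℕ) (hd : 2 ≤ d) :
    ∃ ψ : Fin d → Fin (2 * d + 1) → C(Set.Icc (0:ℝ) 1, ℝ),
      ∀ f : (Fin d → Set.Icc (0:ℝ) 1) → ℝ, Continuous f →
        ∃ g : Fin (2 * d + 1) → C(ℝ, ℝ),
          ∀ x, f x = ∑ q, g q (∑ p, ψ p q (x p)) := by
  obtain ⟨ψ, c, hc0, hc1, h⟩ := ka_exists d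
  refine ⟨ψ, fun f hf => ?_⟩
  choose G hG hGx using h
  let L : (Fin (2 * d + 1) → BoundedContinuousFunction ℝ ℝ) → C(Fin d → KI, ℝ) :=
    fun g => ⟨fun x => ∑ q, g q (∑ p, ψ p q (x p)), by fun_prop⟩
  let F : ℕ → C(Fin d → KI, ℝ) := fun n => (fun u => u - L (G u))^[n] ⟨f, hf⟩
  have hF0 : F 0 = ⟨f, hf⟩ := rfl
  have hFs : ∀ n, F (n + 1) = F n - L (G (F n)) := by
    intro n
    simp only [F, Function.iterate_succ_apply']
  have hFn : ∀ n, ‖F n‖ ≤ c ^ n * ‖F 0‖ := by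
    intro n
    induction n with
    | zero => simp
    | succ n ih =>
      rw [hFs, pow_succ']
      calc ‖F n - L (G (F n))‖ ≤ c * ‖F n‖ :=
            (ContinuousMap.norm_le _ (by positivity)).2 fun x => hGx (F n) x
        _ ≤ c * (c ^ n * ‖F 0‖) := by gcongr
        _ = _ := by ring
  have hgeo : Summable (fun n : ℕ => 2 * (c ^ n * ‖F 0‖)) :=
    ((summable_geometric_of_lt_one hc0 hc1).mul_right _).mul_left _
  have hsum : ∀ q, Summable (fun n => G (F n) q) := by
    intro q
    refine Summable.of_norm_bounded hgeo fun n => (hG (F n) q).trans ?_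
    have := hFn n
    linarith
  refine ⟨fun q => (∑' n, G (F n) q : BoundedContinuousFunction ℝ ℝ).toContinuousMap, fun x => ?_⟩
  have h1 : HasSum (fun n => ∑ q, G (F n) q (∑ p, ψ p q (x p)))
      (∑ q, (∑' n, G (F n) q : BoundedContinuousFunction ℝ ℝ) (∑ p, ψ p q (x p))) := by
    apply hasSum_sum
    intro q _
    exact (BoundedContinuousFunction.evalCLM ℝ (∑ p, ψ p q (x p))).hasSum (hsum q).hasSum
  have h2 : ∀ n, ∑ i ∈ Finset.range n, ∑ q, G (F i) q (∑ p, ψ p q (x p)) = f x - F n x := by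
    intro n
    induction n with
    | zero => simp [hF0]
    | succ n ih =>
      rw [Finset.sum_range_succ, ih, hFs]
      simp only [ContinuousMap.sub_apply, L, ContinuousMap.coe_mk]
      ring
  have h3 : Tendsto (fun n => F n x) atTop (𝓝 0) := by
    refine squeeze_zero_norm (a := fun n => c ^ n * ‖F 0‖)
      (fun n => ((F n).norm_coe_le_norm x).trans (hFn n)) ?_
    simpa using (tendsto_pow_atTop_nhds_zero_of_lt_one hc0 hc1).mul_const ‖F 0‖
  have h4 := h1.tendsto_sum_nat
  simp only [h2] at h4
  have h5 : Tendsto (fun n => f x - F n x) atTop (𝓝 (f x - 0)) := tendsto_const_nhds.sub h3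
  rw [sub_zero] at h5
  exact tendsto_nhds_unique h5 h4
end

section
/- (Lorentz, 1962.) For every integer d ≥ 2 there exist an exponent α ∈ (0,1), constants λ_p ∈ (0,1] for 1 ≤ p ≤ d, and strictly increasing functions ψ_q : [0,1] → [0,1] for 0 ≤ q ≤ 2d, each of which is α-Hölder continuous, such that every continuous real function f on [0,1]^d is representable as f(x₁,…,x_d) = Σ_{q=0}^{2d} g(Σ_{p=1}^{d} λ_p ψ_q(x_p)) for some continuous function g on [0,d] (depending on f). -/
namespace LorentzKA

open Set

/-- The unit interval, in the form used by the statement. -/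
abbrev I01 : Type := Set.Icc (0:ℝ) 1

theorem exists_lam (d : ℕ) : ∃ lam : Fin d → ℝ, (∀ p, lam p ∈ Set.Ioc (0:ℝ) 1) ∧
    ∀ m : Fin d → ℤ, ∑ p, lam p * (m p : ℝ) = 0 → ∀ p, m p = 0 := by
  have h1 : (d : Cardinal) ≤ Module.rank ℚ ℝ := by
    rw [Real.rank_rat_real]
    exact (Cardinal.nat_lt_continuum d).le
  obtain ⟨v, hv⟩ := exists_linearIndependent_of_le_rank h1
  have hne : ∀ p, v p ≠ 0 := fun p => hv.ne_zero p
  have hw : ∀ p, ∃ w : ℚ, w ≠ 0 ∧ (w : ℝ) * v p ∈ Set.Ioc (0:ℝ) 1 := by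
    intro p
    obtain ⟨N, hN⟩ := exists_nat_gt |v p|
    have hpos : 0 < |v p| := abs_pos.mpr (hne p)
    have hN0 : (0:ℝ) < N := hpos.trans hN
    have hN0' : (N : ℚ) ≠ 0 := by
      have : N ≠ 0 := by rintro rfl; simp at hN0
      exact_mod_cast this
    rcases lt_or_gt_of_ne (hne p) with h | h
    · refine ⟨-(1 / N), by simpa using hN0', ?_, ?_⟩
      · push_cast
        have : 0 < (1 / (N:ℝ)) * (- v p) := mul_pos (by positivity) (by linarith)
        linarith
      · push_cast
        rw [abs_of_neg h] at hN
        have : (1 / (N:ℝ)) * (- v p) ≤ 1 := by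
          rw [one_div_mul_eq_div, div_le_one hN0]; linarith
        linarith
    · refine ⟨(1 / N), by simpa using hN0', ?_, ?_⟩
      · push_cast
        exact mul_pos (by positivity) h
      · push_cast
        rw [abs_of_pos h] at hN
        rw [one_div_mul_eq_div, div_le_one hN0]; linarith
  choose w hw0 hw1 using hw
  refine ⟨fun p => (w p : ℝ) * v p, hw1, ?_⟩
  intro m hm p
  rw [linearIndependent_iff'] at hv
  have := hv Finset.univ (fun p => w p * (m p : ℚ)) (by
    rw [← hm]
    refine Finset.sum_congr rfl fun i _ => ?_
    rw [Rat.smul_def]; push_cast; ring) p (Finset.mem_univ p)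
  have h2 := (mul_eq_zero.mp this).resolve_left (hw0 p)
  exact_mod_cast h2

/-- The staircase function: constant on `[k, k + 1 - 1/n]`, with steep ramps in between. -/
noncomputable def stair (n : ℕ) (t : ℝ) : ℝ :=
  (⌊t⌋ : ℝ) + max 0 (n * Int.fract t - (n - 1))

theorem stair_good {n : ℕ} {t : ℝ} (h : n * Int.fract t ≤ n - 1) : stair n t = ⌊t⌋ := by
  unfold stair
  rw [max_eq_left (by linarith), add_zero]

theorem stair_bounds {n : ℕ} (t : ℝ) :
    (⌊t⌋ : ℝ) ≤ stair n t ∧ stair n t ≤ ⌊t⌋ + 1 := by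
  unfold stair
  have h1 := Int.fract_lt_one t
  have hn : (0:ℝ) ≤ n := Nat.cast_nonneg n
  refine ⟨by linarith [le_max_left 0 (n * Int.fract t - (n - 1) : ℝ)], ?_⟩
  have : max 0 (n * Int.fract t - (n - 1) : ℝ) ≤ 1 := by
    apply max_le (by norm_num)
    nlinarith
  linarith

theorem stair_near {n : ℕ} (t : ℝ) : |stair n t - t| ≤ 1 := by
  have h1 := stair_bounds (n := n) t
  have h2 := Int.floor_le t
  have h3 := Int.lt_floor_add_one t
  rw [abs_le]
  constructor <;> linarith

theorem stair_mono {n : ℕ} : Monotone (stair n) := by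
  intro s t hst
  rcases eq_or_lt_of_le (Int.floor_mono hst) with h | h
  · unfold stair
    have hf : Int.fract s ≤ Int.fract t := by
      unfold Int.fract; rw [h]; linarith
    rw [h]
    gcongr
  · have h1 : (⌊s⌋ : ℝ) + 1 ≤ ⌊t⌋ := by exact_mod_cast h
    linarith [(stair_bounds (n := n) s).2, (stair_bounds (n := n) t).1]

theorem stair_comono {n : ℕ} (hn : 1 ≤ n) {s t : ℝ} (hst : s ≤ t) :
    stair n t - stair n s ≤ n * (t - s) := by
  have hn' : (1:ℝ) ≤ n := by exact_mod_cast hn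
  have key : ∀ u : ℝ, n * u - stair n u = (n - 1) * ⌊u⌋ + min (n * Int.fract u) (n - 1) := by
    intro u
    unfold stair
    have hu : (⌊u⌋ : ℝ) + Int.fract u = u := Int.floor_add_fract u
    rcases le_total (n * Int.fract u) (n - 1 : ℝ) with h | h
    · rw [max_eq_left (by linarith), min_eq_left h]
      nth_rewrite 1 [← hu]; ring
    · rw [max_eq_right (by linarith), min_eq_right h]
      nth_rewrite 1 [← hu]; ring
  have h0 : n * s - stair n s ≤ n * t - stair n t := by
    rw [key, key]
    rcases eq_or_lt_of_le (Int.floor_mono hst) with h | h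
    · have hf : Int.fract s ≤ Int.fract t := by
        unfold Int.fract; rw [h]; linarith
      rw [h]
      gcongr
    · have h1 : (⌊s⌋ : ℝ) + 1 ≤ ⌊t⌋ := by exact_mod_cast h
      have h2 := min_le_right (n * Int.fract s) (n - 1 : ℝ)
      have h3 : 0 ≤ min (n * Int.fract t) (n - 1 : ℝ) :=
        le_min (mul_nonneg (by linarith) (Int.fract_nonneg t)) (by linarith)
      nlinarith
  linarith

theorem stair_lip {n : ℕ} (hn : 1 ≤ n) (s t : ℝ) :
    |stair n s - stair n t| ≤ n * |s - t| := by
  rcases le_total s t with h | h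
  · rw [abs_sub_comm, abs_sub_comm s t, abs_of_nonneg (sub_nonneg.2 (stair_mono h)),
      abs_of_nonneg (sub_nonneg.2 h)]
    exact stair_comono hn h
  · rw [abs_of_nonneg (sub_nonneg.2 (stair_mono h)), abs_of_nonneg (sub_nonneg.2 h)]
    exact stair_comono hn h

/-- The rescaled and shifted staircase of index `q` at scale `1/N`. -/
noncomputable def rho (n N q : ℕ) (x : ℝ) : ℝ :=
  (stair n (N * x - (q + 1) / n) + (q + 1) / n) / N

theorem rho_mono {n N q : ℕ} : Monotone (rho n N q) := by
  intro x y h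
  unfold rho
  have : stair n (N * x - (q + 1) / n) ≤ stair n (N * y - (q + 1) / n) :=
    stair_mono (by gcongr)
  gcongr

theorem rho_lip {n N q : ℕ} (hn : 1 ≤ n) (hN : 1 ≤ N) (x y : ℝ) :
    |rho n N q x - rho n N q y| ≤ n * |x - y| := by
  have hN' : (0:ℝ) < N := by exact_mod_cast hN
  have h := stair_lip hn (N * x - (q + 1) / n) (N * y - (q + 1) / n)
  have e : rho n N q x - rho n N q y
      = (stair n (N * x - (q + 1) / n) - stair n (N * y - (q + 1) / n)) / N := by
    unfold rho; ring
  rw [e, abs_div, abs_of_pos hN', div_le_iff₀ hN']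
  refine h.trans (le_of_eq ?_)
  rw [show (N * x - (q + 1) / n : ℝ) - (N * y - (q + 1) / n) = N * (x - y) by ring, abs_mul,
    abs_of_pos hN']
  ring

theorem rho_near {n N q : ℕ} (hN : 1 ≤ N) (x : ℝ) : |rho n N q x - x| ≤ 1 / N := by
  have hN' : (0:ℝ) < N := by exact_mod_cast hN
  have h := stair_near (n := n) (N * x - (q + 1) / n)
  have e : rho n N q x - x
      = (stair n (N * x - (q + 1) / n) - (N * x - (q + 1) / n)) / N := by
    unfold rho; field_simp; ring
  rw [e, abs_div, abs_of_pos hN']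
  gcongr

/-- `x` lies in a flat piece of the staircase of index `q`. -/
def Good (n N q : ℕ) (x : ℝ) : Prop := n * Int.fract (N * x - (q + 1) / n : ℝ) ≤ n - 1

theorem bad_floor {n N q : ℕ} (hn : 1 ≤ n) (hq : q < n) {x : ℝ} (h : ¬ Good n N q x) :
    ⌊(n * N * x : ℝ)⌋ % (n : ℤ) = q := by
  unfold Good at h
  push Not at h
  have hn' : (0:ℝ) < n := by exact_mod_cast hn
  set k := ⌊(N * x - (q + 1) / n : ℝ)⌋ with hk
  have h1 := Int.fract_lt_one (N * x - (q + 1) / n : ℝ)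
  have h2 : (N * x - (q + 1) / n : ℝ) = k + Int.fract (N * x - (q + 1) / n : ℝ) :=
    (Int.floor_add_fract _).symm
  have h3 : (n * N * x : ℝ) = n * k + n * Int.fract (N * x - (q + 1) / n : ℝ) + (q + 1) := by
    have : (n * N * x : ℝ) = n * (N * x - (q + 1) / n : ℝ) + (q + 1) := by
      field_simp; ring
    rw [this]; nth_rewrite 1 [h2]; ring
  have h4 : ⌊(n * N * x : ℝ)⌋ = n * (k + 1) + q := by
    rw [Int.floor_eq_iff]
    push_cast
    rw [h3]
    constructor
    · nlinarith
    · nlinarith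
  rw [h4, Int.mul_add_emod_self_left]
  exact Int.emod_eq_of_lt (by positivity) (by exact_mod_cast hq)

/-- Generic perturbation: a small positive `s` making `A + s B` injective. -/
theorem exists_generic {J : Type*} [Countable J] (A B : J → ℝ) (hB : Function.Injective B)
    {ε : ℝ} (hε : 0 < ε) : ∃ s, 0 < s ∧ s < ε ∧ Function.Injective (fun j => A j + s * B j) := by
  have hc : (Set.range fun j : J × J => (A j.1 - A j.2) / (B j.2 - B j.1)).Countable :=
    Set.countable_range _
  have hu : ¬ (Set.Ioo (0:ℝ) ε).Countable := by
    rw [← Cardinal.le_aleph0_iff_set_countable, Cardinal.mk_Ioo_real hε, not_le]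
    exact Cardinal.aleph0_lt_continuum
  have : ∃ s ∈ Set.Ioo (0:ℝ) ε,
      s ∉ (Set.range fun j : J × J => (A j.1 - A j.2) / (B j.2 - B j.1)) := by
    by_contra hcon
    push Not at hcon
    exact hu (hc.mono hcon)
  obtain ⟨s, hs, hs'⟩ := this
  refine ⟨s, hs.1, hs.2, ?_⟩
  intro i j hij
  by_contra hne
  apply hs'
  refine ⟨(i, j), ?_⟩
  have hb : B j - B i ≠ 0 := sub_ne_zero.2 fun h => hne (hB h).symm
  simp only at hij ⊢
  rw [div_eq_iff hb]
  linarith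

theorem exists_bcf (P : Set ℝ) (hP : P.Finite) (h : ℝ → ℝ) (C : ℝ) (hC : 0 ≤ C)
    (hh : ∀ z, |h z| ≤ C) :
    ∃ g : BoundedContinuousFunction ℝ ℝ, ‖g‖ ≤ C ∧ ∀ z ∈ P, g z = h z := by
  have : Finite P := hP
  have : DiscreteTopology P := inferInstance
  let f : BoundedContinuousFunction P ℝ :=
    BoundedContinuousFunction.ofNormedAddCommGroup (fun z => h z) continuous_of_discreteTopology C
      (fun z => hh z)
  obtain ⟨g, hg1, hg2⟩ :=
    BoundedContinuousFunction.exists_norm_eq_domRestrict_eq_of_closed f hP.isClosed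
  refine ⟨g, ?_, ?_⟩
  · rw [hg1]
    exact BoundedContinuousFunction.norm_ofNormedAddCommGroup_le _ hC _
  · intro z hz
    have := DFunLike.congr_fun hg2 (⟨z, hz⟩ : P)
    exact this

theorem surj_of_approx {E F : Type*} [NormedAddCommGroup E] [NormedSpace ℝ E] [CompleteSpace E]
    [NormedAddCommGroup F] [NormedSpace ℝ F] (T : E →L[ℝ] F) (C θ : ℝ) (hθ0 : 0 ≤ θ)
    (hθ : θ < 1) (hC : 0 ≤ C)
    (h : ∀ f, ∃ g, ‖g‖ ≤ C * ‖f‖ ∧ ‖f - T g‖ ≤ θ * ‖f‖) : Function.Surjective T := by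
  intro f
  choose G hG1 hG2 using h
  let r : ℕ → F := fun k => Nat.rec f (fun _ x => x - T (G x)) k
  have hr : ∀ k, r (k + 1) = r k - T (G (r k)) := fun k => rfl
  have hn : ∀ k, ‖r k‖ ≤ θ ^ k * ‖f‖ := by
    intro k
    induction k with
    | zero => simp [r]
    | succ k ih =>
      rw [hr]
      refine (hG2 _).trans ?_
      rw [pow_succ]
      nlinarith
  have hs : Summable fun k => G (r k) := by
    refine Summable.of_norm_bounded (g := fun k => C * (θ ^ k * ‖f‖)) ?_ ?_
    · exact ((summable_geometric_of_lt_one hθ0 hθ).mul_right _).mul_left _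
    · intro k
      exact (hG1 _).trans (mul_le_mul_of_nonneg_left (hn k) hC)
  refine ⟨∑' k, G (r k), ?_⟩
  have h1 : HasSum (fun k => T (G (r k))) (T (∑' k, G (r k))) := hs.hasSum.mapL T
  have h2 : ∀ K, ∑ k ∈ Finset.range K, T (G (r k)) = f - r K := by
    intro K
    induction K with
    | zero => simp [r]
    | succ K ih => rw [Finset.sum_range_succ, ih, hr]; abel
  have h3 : Filter.Tendsto r Filter.atTop (nhds 0) := by
    refine squeeze_zero_norm hn ?_
    simpa using (tendsto_pow_atTop_nhds_zero_of_lt_one hθ0 hθ).mul_const ‖f‖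
  have h4 := h1.tendsto_sum_nat
  simp only [h2] at h4
  have h5 : Filter.Tendsto (fun K => f - r K) Filter.atTop (nhds (f - 0)) :=
    tendsto_const_nhds.sub h3
  rw [sub_zero] at h5
  exact tendsto_nhds_unique h4 h5

/-- The class of inner functions from which approximations are taken. -/
def Nice (φ : C(I01, ℝ)) : Prop :=
  Monotone φ ∧ (∃ L : ℝ, 0 ≤ L ∧ ∀ x y, |φ x - φ y| ≤ L * |(x:ℝ) - y|) ∧
    ∃ c : ℝ, 0 ≤ c ∧ c < 1 ∧ ∀ x y, |φ x - φ y| ≤ c * √|(x:ℝ) - y|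

theorem nice_perturb {φ : C(I01, ℝ)} (h : Nice φ) {L : ℝ} (hL : 0 ≤ L) :
    ∃ ε > 0, ∀ φ' : C(I01, ℝ), Monotone φ' → (∀ x y, |φ' x - φ' y| ≤ L * |(x:ℝ) - y|) →
      (∀ x, |φ' x - φ x| ≤ ε) → Nice φ' := by
  obtain ⟨-, -, c, hc0, hc1, hc⟩ := h
  set c' := (1 + c) / 2 with hc'
  have hc'0 : 0 < c' := by rw [hc']; linarith
  set ρ := c' / (L + 1) with hρ
  have hρ0 : 0 < ρ := by positivity
  have hLρ : L * ρ ≤ c' := by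
    rw [hρ, mul_div_assoc', div_le_iff₀ (by linarith)]
    nlinarith
  refine ⟨(c' - c) * ρ / 2, by
    have : 0 < c' - c := by rw [hc']; linarith
    positivity, ?_⟩
  intro φ' hm hl hn
  refine ⟨hm, ⟨L, hL, hl⟩, c', hc'0.le, by rw [hc']; linarith, ?_⟩
  intro x y
  set t := |(x:ℝ) - y| with ht
  have ht0 : 0 ≤ t := abs_nonneg _
  have hs0 : 0 ≤ √t := Real.sqrt_nonneg t
  have hst : √t * √t = t := Real.mul_self_sqrt ht0
  rcases le_total (√t) ρ with h1 | h1
  · refine (hl x y).trans ?_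
    rw [← ht]
    have : L * √t ≤ c' := (mul_le_mul_of_nonneg_left h1 hL).trans hLρ
    calc L * t = (L * √t) * √t := by rw [mul_assoc, hst]
      _ ≤ c' * √t := mul_le_mul_of_nonneg_right this hs0
  · have a1 := hc x y
    rw [← ht] at a1
    have a2 := hn x
    have a3 := hn y
    have a4 : (c' - c) * ρ ≤ (c' - c) * √t :=
      mul_le_mul_of_nonneg_left h1 (by rw [hc']; linarith)
    rw [abs_le] at a1 a2 a3 ⊢
    constructor <;> linarith [a1.1, a1.2, a2.1, a2.2, a3.1, a3.2]

theorem finite_lb {ι : Type*} [Finite ι] (e : ι → ℝ) (he : ∀ i, 0 < e i) {ε : ℝ} (hε : 0 < ε) :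
    ∃ η, 0 < η ∧ η ≤ ε ∧ ∀ i, η ≤ e i := by
  have h1 : ∀ᶠ η in nhdsWithin (0:ℝ) (Set.Ioi 0), ∀ i, η ≤ e i := by
    rw [Filter.eventually_all]
    intro i
    exact Filter.Eventually.filter_mono nhdsWithin_le_nhds (Iic_mem_nhds (he i))
  have h2 : ∀ᶠ η in nhdsWithin (0:ℝ) (Set.Ioi 0), η ≤ ε :=
    Filter.Eventually.filter_mono nhdsWithin_le_nhds (Iic_mem_nhds hε)
  have h3 : ∀ᶠ η in nhdsWithin (0:ℝ) (Set.Ioi 0), 0 < η := self_mem_nhdsWithin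
  obtain ⟨η, a, b, c⟩ := (h1.and (h2.and h3)).exists
  exact ⟨η, c, b, a⟩

/-- The superposition operator. -/
def Top {d n : ℕ} (lam : Fin d → ℝ) (ψ : Fin n → C(I01, ℝ)) (g : BoundedContinuousFunction ℝ ℝ) :
    C(Fin d → I01, ℝ) :=
  ⟨fun x => ∑ q, g (∑ p, lam p * ψ q (x p)), by fun_prop⟩

theorem rho_continuous {n N q : ℕ} (hn : 1 ≤ n) (hN : 1 ≤ N) : Continuous (rho n N q) := by
  have : LipschitzWith (n : NNReal) (rho n N q) := by
    refine LipschitzWith.of_dist_le_mul fun x y => ?_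
    rw [Real.dist_eq, Real.dist_eq]
    exact rho_lip hn hN x y
  exact this.continuous

/-- Flattened inner function. -/
noncomputable def flat (n N : ℕ) (hn : 1 ≤ n) (hN : 1 ≤ N) (q : ℕ) (s : ℝ) (φ : C(I01, ℝ)) :
    C(I01, ℝ) :=
  ⟨fun x => φ (Set.projIcc (0:ℝ) 1 zero_le_one (rho n N q x)) + s * rho n N q x, by
    have h1 := rho_continuous (q := q) hn hN
    have h2 : Continuous (Set.projIcc (0:ℝ) 1 zero_le_one) := continuous_projIcc
    have h3 : Continuous fun x : I01 => rho n N q x := h1.comp continuous_subtype_val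
    exact (φ.continuous.comp (h2.comp h3)).add (continuous_const.mul h3)⟩

theorem flat_apply {n N : ℕ} (hn : 1 ≤ n) (hN : 1 ≤ N) (q : ℕ) (s : ℝ) (φ : C(I01, ℝ)) (x : I01) :
    flat n N hn hN q s φ x
      = φ (Set.projIcc (0:ℝ) 1 zero_le_one (rho n N q x)) + s * rho n N q x := rfl

theorem abs_projIcc_sub (a b : ℝ) :
    |((Set.projIcc (0:ℝ) 1 zero_le_one a : I01) : ℝ) - (Set.projIcc (0:ℝ) 1 zero_le_one b : I01)|
      ≤ |a - b| :=
  Set.abs_projIcc_sub_projIcc zero_le_one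

theorem flat_mono {n N : ℕ} (hn : 1 ≤ n) (hN : 1 ≤ N) (q : ℕ) {s : ℝ} (hs : 0 ≤ s) {φ : C(I01, ℝ)}
    (hφ : Monotone φ) : Monotone (flat n N hn hN q s φ) := by
  intro x y hxy
  rw [flat_apply, flat_apply]
  have h : rho n N q x ≤ rho n N q y := rho_mono hxy
  have h2 := hφ (Set.monotone_projIcc zero_le_one h)
  have h3 := mul_le_mul_of_nonneg_left h hs
  linarith

theorem flat_lip {n N : ℕ} (hn : 1 ≤ n) (hN : 1 ≤ N) (q : ℕ) {s : ℝ} (hs : 0 ≤ s) (hs1 : s ≤ 1)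
    {φ : C(I01, ℝ)} {L : ℝ} (hL : 0 ≤ L) (hφ : ∀ x y, |φ x - φ y| ≤ L * |(x:ℝ) - y|) (x y : I01) :
    |flat n N hn hN q s φ x - flat n N hn hN q s φ y| ≤ ((L + 1) * n) * |(x:ℝ) - y| := by
  rw [flat_apply, flat_apply]
  have h1 := rho_lip (q := q) hn hN x y
  have h2 := hφ (Set.projIcc (0:ℝ) 1 zero_le_one (rho n N q x))
    (Set.projIcc (0:ℝ) 1 zero_le_one (rho n N q y))
  have h3 := mul_le_mul_of_nonneg_left (abs_projIcc_sub (rho n N q x) (rho n N q y)) hL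
  have h4 : |s * rho n N q x - s * rho n N q y| ≤ |rho n N q x - rho n N q y| := by
    rw [← mul_sub, abs_mul, abs_of_nonneg hs]
    exact mul_le_of_le_one_left (abs_nonneg _) hs1
  have h5 : (L + 1) * |rho n N q x - rho n N q y| ≤ (L + 1) * (n * |(x:ℝ) - y|) :=
    mul_le_mul_of_nonneg_left h1 (by linarith)
  rw [add_sub_add_comm]
  refine (abs_add_le _ _).trans ?_
  linarith

theorem flat_near {n N : ℕ} (hn : 1 ≤ n) (hN : 1 ≤ N) (q : ℕ) {s : ℝ} (hs : 0 ≤ s)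
    {φ : C(I01, ℝ)} {L : ℝ} (hL : 0 ≤ L) (hφ : ∀ x y, |φ x - φ y| ≤ L * |(x:ℝ) - y|) (x : I01) :
    |flat n N hn hN q s φ x - φ x| ≤ L * (1 / N) + 2 * s := by
  rw [flat_apply]
  have h1 := rho_near (n := n) (q := q) hN x
  have h2 := hφ (Set.projIcc (0:ℝ) 1 zero_le_one (rho n N q x)) x
  have h3 := abs_projIcc_sub (rho n N q x) x
  rw [Set.projIcc_val] at h3
  have h4 := mul_le_mul_of_nonneg_left (h3.trans h1) hL
  have hN' : (1 / N : ℝ) ≤ 1 := by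
    rw [div_le_one (by exact_mod_cast hN)]; exact_mod_cast hN
  have h5 : |rho n N q x| ≤ 2 := by
    have := x.2.1
    have := x.2.2
    rw [abs_le] at h1 ⊢
    constructor <;> linarith [h1.1, h1.2]
  have h6 : |s * rho n N q x| ≤ 2 * s := by
    rw [abs_mul, abs_of_nonneg hs, mul_comm 2]
    exact mul_le_mul_of_nonneg_left h5 hs
  rw [add_sub_right_comm]
  refine (abs_add_le _ _).trans ?_
  linarith

theorem rho_good {n N q : ℕ} {x : ℝ} (h : Good n N q x) :
    rho n N q x = (⌊(N * x - (q + 1) / n : ℝ)⌋ + (q + 1) / n) / N := by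
  unfold rho
  rw [stair_good h]

theorem B_injective {d n N : ℕ} (hd : 1 ≤ d) (hn : 1 ≤ n) (hN : 1 ≤ N) (lam : Fin d → ℝ)
    (hlam : ∀ m : Fin d → ℤ, ∑ p, lam p * (m p : ℝ) = 0 → ∀ p, m p = 0) :
    Function.Injective (fun j : Fin n × (Fin d → ℤ) =>
      ∑ p, lam p * (((j.2 p : ℝ) + ((j.1 : ℕ) + 1) / n) / N)) := by
  rintro ⟨q, k⟩ ⟨q', k'⟩ h
  have hn' : (0:ℝ) < n := by exact_mod_cast hn
  have hN' : (0:ℝ) < N := by exact_mod_cast hN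
  simp only at h
  have key := hlam (fun p => (n * k p + (q : ℕ)) - (n * k' p + (q' : ℕ))) (by
    have : ∑ p, lam p * (((n * k p + (q : ℕ)) - (n * k' p + (q' : ℕ)) : ℤ) : ℝ)
        = n * N * (∑ p, lam p * (((k p : ℝ) + ((q : ℕ) + 1) / n) / N)
          - ∑ p, lam p * (((k' p : ℝ) + ((q' : ℕ) + 1) / n) / N)) := by
      rw [← Finset.sum_sub_distrib, Finset.mul_sum]
      refine Finset.sum_congr rfl fun p _ => ?_
      push_cast
      field_simp
      ring
    rw [this, h, sub_self, mul_zero])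
  have hq : (q : ℕ) = q' := by
    have h0 := key ⟨0, hd⟩
    have e1 : ((n * k ⟨0, hd⟩ + (q : ℕ) : ℤ)) % n = (q : ℕ) := by
      rw [Int.mul_add_emod_self_left]
      exact Int.emod_eq_of_lt (by positivity) (by exact_mod_cast q.2)
    have e2 : ((n * k' ⟨0, hd⟩ + (q' : ℕ) : ℤ)) % n = (q' : ℕ) := by
      rw [Int.mul_add_emod_self_left]
      exact Int.emod_eq_of_lt (by positivity) (by exact_mod_cast q'.2)
    rw [sub_eq_zero.1 h0, e2] at e1
    exact_mod_cast e1.symm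
  have hk : k = k' := by
    funext p
    have h0 := key p
    simp only [hq] at h0
    have h1 : (n : ℤ) * (k p - k' p) = 0 := by linarith
    have h2 := (mul_eq_zero.1 h1).resolve_left (by exact_mod_cast (by omega : n ≠ 0))
    linarith
  rw [Fin.ext hq, hk]

theorem approx {d n : ℕ} (hd : 1 ≤ d) (hnd : n = 2 * d + 1) (lam : Fin d → ℝ)
    (hlam : ∀ m : Fin d → ℤ, ∑ p, lam p * (m p : ℝ) = 0 → ∀ p, m p = 0)
    (φ : Fin n → C(I01, ℝ)) (hφ : ∀ q, Nice (φ q)) (f : C(Fin d → I01, ℝ)) (hf : f ≠ 0)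
    {ε : ℝ} (hε : 0 < ε) :
    ∃ ψ : Fin n → C(I01, ℝ), (∀ q, Nice (ψ q)) ∧ (∀ q x, |ψ q x - φ q x| ≤ ε) ∧
      ∃ g, ‖g‖ ≤ ‖f‖ ∧ ‖f - Top lam ψ g‖ < (1 - 1 / (2 * n)) * ‖f‖ := by
  have hf0 : 0 < ‖f‖ := norm_pos_iff.2 hf
  have hn : 1 ≤ n := by omega
  have hn' : (1:ℝ) ≤ n := by exact_mod_cast hn
  have hn0 : (0:ℝ) < n := by linarith
  -- constants
  choose L hL0 hL using fun q => (hφ q).2.1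
  have hLn : ∀ q, 0 ≤ (L q + 1) * n := fun q => mul_nonneg (by linarith [hL0 q]) hn0.le
  choose e he0 he using fun q => nice_perturb (hφ q) (hLn q)
  obtain ⟨η, hη0, hηε, hηe⟩ := finite_lb e he0 hε
  set M := ∑ q, L q with hM
  have hLM : ∀ q, L q ≤ M := fun q =>
    Finset.single_le_sum (fun i _ => hL0 i) (Finset.mem_univ q)
  have hM0 : 0 ≤ M := Finset.sum_nonneg fun i _ => hL0 i
  set ε' := ‖f‖ / (4 * n) with hε'
  have hε'0 : 0 < ε' := by positivity
  have huc : UniformContinuous f := CompactSpace.uniformContinuous_of_continuous f.continuous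
  obtain ⟨δ, hδ0, hδ⟩ := Metric.uniformContinuous_iff.1 huc ε' hε'0
  obtain ⟨N₀, hN₀⟩ := exists_nat_one_div_lt (lt_min (div_pos hη0 (by linarith : 0 < 2 * (M + 1))) hδ0)
  obtain ⟨N, hNN⟩ : ∃ N, N = N₀ + 1 := ⟨_, rfl⟩
  have hN : 1 ≤ N := by omega
  have hN' : (0:ℝ) < N := by exact_mod_cast hN
  have hN1 : (1 / N : ℝ) < min (η / (2 * (M + 1))) δ := by rw [hNN]; push_cast; exact hN₀
  have hN2 : (M + 1) * (1 / N : ℝ) ≤ η / 2 := by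
    have h1 := hN1.trans_le (min_le_left _ _)
    rw [lt_div_iff₀ (by linarith)] at h1
    linarith
  have hN3 : (1 / N : ℝ) < δ := hN1.trans_le (min_le_right _ _)
  -- generic shift
  let B : Fin n × (Fin d → ℤ) → ℝ := fun j =>
      ∑ p, lam p * (((j.2 p : ℝ) + ((j.1 : ℕ) + 1) / n) / N)
  let A : Fin n × (Fin d → ℤ) → ℝ := fun j =>
      ∑ p, lam p * φ j.1 (Set.projIcc (0:ℝ) 1 zero_le_one
        (((j.2 p : ℝ) + ((j.1 : ℕ) + 1) / n) / N))
  obtain ⟨s, hs0, hs1, hinj⟩ := exists_generic A B (B_injective hd hn hN lam hlam)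
    (lt_min one_pos (by positivity : 0 < η / 4))
  have hs1' : s ≤ 1 := hs1.le.trans (min_le_left _ _)
  have hs2 : s ≤ η / 4 := hs1.le.trans (min_le_right _ _)
  let z : Fin n × (Fin d → ℤ) → ℝ := fun j => A j + s * B j
  have hz : Function.Injective z := hinj
  let ψ : Fin n → C(I01, ℝ) := fun q => flat n N hn hN q s (φ q)
  have hnear : ∀ q x, |ψ q x - φ q x| ≤ η := by
    intro q x
    refine (flat_near hn hN q hs0.le (hL0 q) (hL q) x).trans ?_
    have h1 : L q * (1 / N : ℝ) ≤ (M + 1) * (1 / N : ℝ) :=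
      mul_le_mul_of_nonneg_right (by linarith [hLM q]) (by positivity)
    linarith
  -- the cells
  let cell : Fin n → (Fin d → I01) → Fin d → ℤ := fun q x p =>
    ⌊(N * (x p : ℝ) - ((q : ℕ) + 1) / n : ℝ)⌋
  have hcell : ∀ q x y, cell q x = cell q y → |f x - f y| < ε' := by
    intro q x y hxy
    have : dist x y < δ := by
      rw [dist_pi_lt_iff hδ0]
      intro p
      refine lt_trans ?_ hN3
      rw [Subtype.dist_eq, Real.dist_eq]
      have h1 := congrFun hxy p
      have h2 := Int.abs_sub_lt_one_of_floor_eq_floor h1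
      rw [sub_sub_sub_cancel_right, ← mul_sub, abs_mul, abs_of_pos hN'] at h2
      rw [lt_div_iff₀ hN']
      linarith
    have := hδ this
    rwa [Real.dist_eq] at this
  have hgood : ∀ (q : Fin n) (x : Fin d → I01), (∀ p, Good n N q (x p : ℝ)) →
      ∑ p, lam p * ψ q (x p) = z (q, cell q x) := by
    intro q x hx
    simp only [z, A, B, ψ, flat_apply]
    rw [Finset.mul_sum, ← Finset.sum_add_distrib]
    refine Finset.sum_congr rfl fun p _ => ?_
    rw [rho_good (hx p)]
    ring
  classical
  let H : Fin n × (Fin d → ℤ) → ℝ := fun j =>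
    if h : ∃ x, cell j.1 x = j.2 then f h.choose / n else 0
  have hfn : ∀ x, |f x / n| ≤ ‖f‖ / n := by
    intro x
    rw [abs_div, abs_of_pos hn0]
    have := f.norm_coe_le_norm x
    rw [Real.norm_eq_abs] at this
    gcongr
  have hHb : ∀ j, |H j| ≤ ‖f‖ / n := by
    intro j
    simp only [H]
    split_ifs with h
    · exact hfn _
    · rw [abs_zero]; positivity
  have hHc : ∀ q x, |f x / n - H (q, cell q x)| ≤ ε' / n := by
    intro q x
    have hex : ∃ y, cell q y = cell q x := ⟨x, rfl⟩
    simp only [H]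
    rw [dif_pos hex, ← sub_div, abs_div, abs_of_pos hn0]
    have := hcell q x _ hex.choose_spec.symm
    gcongr
  let h : ℝ → ℝ := Function.extend z H 0
  have hh : ∀ t, |h t| ≤ ‖f‖ / n := by
    intro t
    by_cases ht : ∃ j, z j = t
    · obtain ⟨j, rfl⟩ := ht
      simp only [h]
      rw [hz.extend_apply]
      exact hHb j
    · simp only [h]
      rw [Function.extend_apply' _ _ _ ht, Pi.zero_apply, abs_zero]
      positivity
  let P : Set ℝ := z '' (Set.univ ×ˢ Set.Icc (fun _ => (-2 : ℤ)) (fun _ => (N : ℤ)))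
  have hP : P.Finite := (Set.finite_univ.prod (Set.finite_Icc _ _)).image z
  have hcP : ∀ q x, z (q, cell q x) ∈ P := by
    intro q x
    refine ⟨_, ⟨Set.mem_univ _, ?_, ?_⟩, rfl⟩
    · intro p
      simp only [cell]
      rw [Int.le_floor]
      have h1 : (((q : ℕ) : ℝ) + 1) / n ≤ 1 := by
        rw [div_le_one hn0]; exact_mod_cast q.2
      have h2 : 0 ≤ N * (x p : ℝ) := mul_nonneg hN'.le (x p).2.1
      push_cast
      linarith
    · intro p
      simp only [cell]
      have h1 : (0:ℝ) ≤ (((q : ℕ) : ℝ) + 1) / n := by positivity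
      have h2 : N * (x p : ℝ) ≤ N := mul_le_of_le_one_right hN'.le (x p).2.2
      have h3 : (⌊(N * (x p : ℝ) - ((q : ℕ) + 1) / n : ℝ)⌋ : ℝ) ≤ N :=
        (Int.floor_le _).trans (by linarith)
      exact_mod_cast h3
  obtain ⟨g, hg1, hg2⟩ := exists_bcf P hP h (‖f‖ / n) (by positivity) hh
  have hgb : ∀ t, |g t| ≤ ‖f‖ / n := by
    intro t
    have := g.norm_coe_le_norm t
    rw [Real.norm_eq_abs] at this
    exact this.trans hg1
  have hgg : ∀ (q : Fin n) (x : Fin d → I01), (∀ p, Good n N q (x p : ℝ)) →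
      |f x / n - g (∑ p, lam p * ψ q (x p))| ≤ ε' / n := by
    intro q x hx
    rw [hgood q x hx, hg2 _ (hcP q x)]
    simp only [h]
    rw [hz.extend_apply]
    exact hHc q x
  refine ⟨ψ, ?_, fun q x => (hnear q x).trans hηε, g, ?_, ?_⟩
  · intro q
    exact he q (ψ q) (flat_mono hn hN q hs0.le (hφ q).1)
      (flat_lip hn hN q hs0.le hs1' (hL0 q) (hL q)) (fun x => (hnear q x).trans (hηe q))
  · exact hg1.trans (div_le_self hf0.le hn')
  · have hbound : ∀ x, ‖(f - Top lam ψ g) x‖ ≤ ε' + 2 * d * (‖f‖ / n) := by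
      intro x
      let bad : Finset (Fin n) := Finset.univ.filter fun q => ¬ ∀ p, Good n N q (x p : ℝ)
      have hbad : (bad.card : ℝ) ≤ d := by
        have h1 : bad.card ≤ (Finset.univ : Finset (Fin d)).card := by
          have hsub : bad.image (fun q : Fin n => ((q : ℕ) : ℤ)) ⊆
              (Finset.univ : Finset (Fin d)).image
                (fun p => ⌊(n * N * (x p : ℝ) : ℝ)⌋ % (n : ℤ)) := by
            intro m hm
            rw [Finset.mem_image] at hm ⊢
            obtain ⟨q, hq, rfl⟩ := hm
            have hq2 := (Finset.mem_filter.1 hq).2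
            push Not at hq2
            obtain ⟨p, hp⟩ := hq2
            exact ⟨p, Finset.mem_univ p, bad_floor hn q.2 hp⟩
          rw [← Finset.card_image_of_injective bad
            (f := fun q : Fin n => ((q : ℕ) : ℤ)) (fun a b hab => Fin.ext (by simpa using hab))]
          exact (Finset.card_le_card hsub).trans Finset.card_image_le
        rw [Finset.card_univ, Fintype.card_fin] at h1
        exact_mod_cast h1
      have e1 : (f - Top lam ψ g) x = ∑ q, (f x / n - g (∑ p, lam p * ψ q (x p))) := by
        rw [Finset.sum_sub_distrib, Finset.sum_const, Finset.card_univ, Fintype.card_fin,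
          nsmul_eq_mul, mul_div_cancel₀ _ hn0.ne']
        rfl
      rw [e1, Real.norm_eq_abs]
      refine (Finset.abs_sum_le_sum_abs _ _).trans ?_
      have e2 : ∀ q, |f x / n - g (∑ p, lam p * ψ q (x p))| ≤
          ε' / n + if q ∈ bad then 2 * (‖f‖ / n) else 0 := by
        intro q
        split_ifs with hq
        · have a1 := hfn x
          have a2 := hgb (∑ p, lam p * ψ q (x p))
          have a3 : 0 ≤ ε' / n := by positivity
          have a4 := abs_sub (f x / n) (g (∑ p, lam p * ψ q (x p)))
          linarith
        · have hq' : ∀ p, Good n N q (x p : ℝ) := by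
            by_contra hcon
            exact hq (Finset.mem_filter.2 ⟨Finset.mem_univ _, hcon⟩)
          rw [add_zero]
          exact hgg q x hq'
      refine (Finset.sum_le_sum fun q _ => e2 q).trans ?_
      rw [Finset.sum_add_distrib, Finset.sum_const, Finset.card_univ, Fintype.card_fin,
          nsmul_eq_mul, mul_div_cancel₀ _ hn0.ne', Finset.sum_ite_mem, Finset.univ_inter,
          Finset.sum_const, nsmul_eq_mul]
      have : (bad.card : ℝ) * (2 * (‖f‖ / n)) ≤ d * (2 * (‖f‖ / n)) :=
        mul_le_mul_of_nonneg_right hbad (by positivity)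
      linarith
    have hle := (ContinuousMap.norm_le (f - Top lam ψ g) (by positivity)).2 hbound
    refine lt_of_le_of_lt hle ?_
    have hd' : (2 * d : ℝ) = n - 1 := by rw [hnd]; push_cast; ring
    rw [hd', hε']
    have e3 : ‖f‖ / (4 * n) + (n - 1) * (‖f‖ / n) = (1 - 1 / (2 * n)) * ‖f‖ - ‖f‖ / (4 * n) := by
      field_simp
      ring
    rw [e3]
    have : 0 < ‖f‖ / (4 * n) := by positivity
    linarith

theorem dense_of_approx {n : ℕ} (O : Set (Fin n → C(I01, ℝ)))
    (h : ∀ φ : Fin n → C(I01, ℝ), (∀ q, Nice (φ q)) → ∀ ε > 0, ∃ ψ : Fin n → C(I01, ℝ),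
      (∀ q, Nice (ψ q)) ∧ (∀ q x, |ψ q x - φ q x| ≤ ε) ∧ ψ ∈ O) :
    Dense (Subtype.val ⁻¹' O : Set (closure {φ : Fin n → C(I01, ℝ) | ∀ q, Nice (φ q)})) := by
  rw [Metric.dense_iff]
  intro y r hr
  obtain ⟨φ, hφ, hd⟩ := Metric.mem_closure_iff.1 y.2 (r / 2) (by linarith)
  obtain ⟨ψ, h1, h2, h3⟩ := h φ hφ (r / 3) (by linarith)
  refine ⟨⟨ψ, subset_closure h1⟩, ?_, h3⟩
  rw [Metric.mem_ball, Subtype.dist_eq]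
  have h4 : dist ψ φ ≤ r / 3 := by
    rw [dist_pi_le_iff (by linarith)]
    intro q
    rw [ContinuousMap.dist_le (by linarith)]
    intro x
    rw [Real.dist_eq]
    exact h2 q x
  calc dist ψ (y : Fin n → C(I01, ℝ)) ≤ dist ψ φ + dist φ y := dist_triangle _ _ _
    _ < r := by rw [dist_comm φ]; linarith

theorem strict_approx {n : ℕ} (φ : Fin n → C(I01, ℝ)) (hφ : ∀ q, Nice (φ q)) {ε : ℝ} (hε : 0 < ε) :
    ∃ ψ : Fin n → C(I01, ℝ), (∀ q, Nice (ψ q)) ∧ (∀ q x, |ψ q x - φ q x| ≤ ε) ∧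
      ∀ q, StrictMono (ψ q) := by
  choose L hL0 hL using fun q => (hφ q).2.1
  have hLn : ∀ q, 0 ≤ L q + 1 := fun q => by linarith [hL0 q]
  choose e he0 he using fun q => nice_perturb (hφ q) (hLn q)
  obtain ⟨s, hs0, hsε, hse⟩ := finite_lb e he0 (lt_min hε one_pos)
  have hs1 : s ≤ 1 := hsε.trans (min_le_right _ _)
  have hs2 : s ≤ ε := hsε.trans (min_le_left _ _)
  let ψ : Fin n → C(I01, ℝ) := fun q => ⟨fun x => φ q x + s * x, by fun_prop⟩
  have hψ : ∀ q x, ψ q x = φ q x + s * x := fun q x => rfl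
  have hst : ∀ q, StrictMono (ψ q) := by
    intro q x y hxy
    rw [hψ, hψ]
    have h1 := (hφ q).1 hxy.le
    have h2 : s * (x : ℝ) < s * y := mul_lt_mul_of_pos_left hxy hs0
    linarith
  have hnear : ∀ q x, |ψ q x - φ q x| ≤ s := by
    intro q x
    rw [hψ, add_sub_cancel_left, abs_of_nonneg (mul_nonneg hs0.le x.2.1)]
    exact mul_le_of_le_one_right hs0.le x.2.2
  refine ⟨ψ, ?_, fun q x => (hnear q x).trans hs2, hst⟩
  intro q
  refine he q (ψ q) (hst q).monotone ?_ fun x => (hnear q x).trans (hse q)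
  intro x y
  rw [hψ, hψ, add_sub_add_comm, ← mul_sub]
  refine (abs_add_le _ _).trans ?_
  have h1 := hL q x y
  have h2 : |s * ((x:ℝ) - y)| ≤ |(x:ℝ) - y| := by
    rw [abs_mul, abs_of_pos hs0]
    exact mul_le_of_le_one_left (abs_nonneg _) hs1
  linarith

theorem nice_exists : ∃ φ : C(I01, ℝ), Nice φ := by
  refine ⟨0, fun x y _ => le_refl _, ⟨0, le_refl _, by simp⟩, 0, le_refl _, one_pos, by simp⟩

theorem closure_prop {n : ℕ} {ψ : Fin n → C(I01, ℝ)}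
    (h : ψ ∈ closure {φ : Fin n → C(I01, ℝ) | ∀ q, Nice (φ q)}) :
    (∀ q, Monotone (ψ q)) ∧ ∀ q x y, |ψ q x - ψ q y| ≤ √|(x:ℝ) - y| := by
  constructor
  · intro q x y hxy
    have hc : IsClosed {φ : Fin n → C(I01, ℝ) | φ q x ≤ φ q y} :=
      isClosed_le (by fun_prop) (by fun_prop)
    exact closure_minimal (fun φ hφ => (hφ q).1 hxy) hc h
  · intro q x y
    have hc : IsClosed {φ : Fin n → C(I01, ℝ) | |φ q x - φ q y| ≤ √|(x:ℝ) - y|} :=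
      isClosed_le (by fun_prop) (by fun_prop)
    refine closure_minimal (fun φ hφ => ?_) hc h
    obtain ⟨c, hc0, hc1, hc⟩ := (hφ q).2.2
    exact (hc x y).trans (mul_le_of_le_one_left (Real.sqrt_nonneg _) hc1.le)

theorem isOpen_rep {d n : ℕ} (lam : Fin d → ℝ) (f : C(Fin d → I01, ℝ)) (r C : ℝ) :
    IsOpen {ψ : Fin n → C(I01, ℝ) | ∃ g, ‖g‖ ≤ C ∧ ‖f - Top lam ψ g‖ < r} := by
  have : {ψ : Fin n → C(I01, ℝ) | ∃ g, ‖g‖ ≤ C ∧ ‖f - Top lam ψ g‖ < r}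
      = ⋃ g : BoundedContinuousFunction ℝ ℝ, ⋃ _ : ‖g‖ ≤ C,
        {ψ : Fin n → C(I01, ℝ) | ‖f - Top lam ψ g‖ < r} := by
    ext ψ; simp
  rw [this]
  refine isOpen_iUnion fun g => isOpen_iUnion fun _ => ?_
  refine isOpen_lt ?_ continuous_const
  have hc : Continuous fun ψ : Fin n → C(I01, ℝ) => Top lam ψ g := by
    refine ContinuousMap.continuous_of_continuous_uncurry _ ?_
    have : Continuous fun a : (Fin n → C(I01, ℝ)) × (Fin d → I01) =>
        ∑ q, g (∑ p, lam p * a.1 q (a.2 p)) := by fun_prop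
    exact this
  exact (continuous_const.sub hc).norm

theorem exists_inner {d n : ℕ} (hd : 1 ≤ d) (hnd : n = 2 * d + 1) (lam : Fin d → ℝ)
    (hlam : ∀ m : Fin d → ℤ, ∑ p, lam p * (m p : ℝ) = 0 → ∀ p, m p = 0) :
    ∃ ψ : Fin n → C(I01, ℝ), (∀ q, StrictMono (ψ q)) ∧
      (∀ q x y, |ψ q x - ψ q y| ≤ √|(x:ℝ) - y|) ∧
      ∀ f : C(Fin d → I01, ℝ), ∃ g, Top lam ψ g = f := by
  let S : Set (Fin n → C(I01, ℝ)) := {φ | ∀ q, Nice (φ q)}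
  have hcomp : CompleteSpace (closure S) := isClosed_closure.completeSpace_coe
  have hne : Nonempty (closure S) := by
    obtain ⟨φ, hφ⟩ := nice_exists
    exact ⟨⟨fun _ => φ, subset_closure fun _ => hφ⟩⟩
  let pr : ℚ → I01 := fun a => Set.projIcc (0:ℝ) 1 zero_le_one a
  let F : ℕ → C(Fin d → I01, ℝ) := TopologicalSpace.denseSeq _
  have hF : DenseRange F := TopologicalSpace.denseRange_denseSeq _
  have hn0 : (0:ℝ) < n := by rw [hnd]; positivity
  have hn1 : (1:ℝ) ≤ n := by rw [hnd]; push_cast; linarith [Nat.cast_nonneg (α := ℝ) d]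
  let θ : ℝ := 1 - 1 / (2 * n)
  let O : ℕ ⊕ (Fin n × ℚ × ℚ) → Set (Fin n → C(I01, ℝ)) := Sum.elim
    (fun k => {ψ | F k ≠ 0 → ∃ g, ‖g‖ ≤ ‖F k‖ ∧ ‖F k - Top lam ψ g‖ < θ * ‖F k‖})
    (fun a => {ψ | pr a.2.1 < pr a.2.2 → ψ a.1 (pr a.2.1) < ψ a.1 (pr a.2.2)})
  have hO : ∀ i, IsOpen (O i) := by
    rintro (k | a)
    · by_cases h : F k = 0
      · simp [O, h]
      · simp only [O, Sum.elim_inl, ne_eq, h, not_false_eq_true, forall_const]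
        exact isOpen_rep lam (F k) _ _
    · by_cases h : pr a.2.1 < pr a.2.2
      · simp only [O, Sum.elim_inr, h, forall_const]
        exact isOpen_lt (by fun_prop) (by fun_prop)
      · simp [O, h]
  have hD : ∀ i, Dense (Subtype.val ⁻¹' (O i) : Set (closure S)) := by
    rintro (k | a)
    · refine dense_of_approx _ fun φ hφ ε hε => ?_
      by_cases h : F k = 0
      · exact ⟨φ, hφ, fun q x => by simpa using hε.le, fun h' => absurd h h'⟩
      · obtain ⟨ψ, h1, h2, h3⟩ := approx hd hnd lam hlam φ hφ (F k) h hε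
        exact ⟨ψ, h1, h2, fun _ => h3⟩
    · refine dense_of_approx _ fun φ hφ ε hε => ?_
      obtain ⟨ψ, h1, h2, h3⟩ := strict_approx φ hφ hε
      exact ⟨ψ, h1, h2, fun h => h3 _ h⟩
  have hdense := dense_iInter_of_isOpen
    (fun i => (hO i).preimage (continuous_subtype_val : Continuous (Subtype.val : closure S → _))) hD
  obtain ⟨⟨ψ, hψS⟩, hψ⟩ := hdense.nonempty
  rw [Set.mem_iInter] at hψ
  obtain ⟨hmono, hhold⟩ := closure_prop hψS
  refine ⟨ψ, ?_, hhold, ?_⟩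
  · intro q x y hxy
    obtain ⟨a, ha1, ha2⟩ := exists_rat_btwn (show (x:ℝ) < y from hxy)
    obtain ⟨b, hb1, hb2⟩ := exists_rat_btwn ha2
    have ha : (a:ℝ) ∈ Set.Icc (0:ℝ) 1 := ⟨x.2.1.trans ha1.le, ha2.le.trans y.2.2⟩
    have hb : (b:ℝ) ∈ Set.Icc (0:ℝ) 1 := ⟨ha.1.trans hb1.le, hb2.le.trans y.2.2⟩
    have ea : pr a = ⟨a, ha⟩ := Set.projIcc_of_mem _ ha
    have eb : pr b = ⟨b, hb⟩ := Set.projIcc_of_mem _ hb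
    have h1 : pr a < pr b → ψ q (pr a) < ψ q (pr b) := hψ (Sum.inr (q, a, b))
    rw [ea, eb] at h1
    have h2 := h1 hb1
    have h3 : ψ q x ≤ ψ q ⟨a, ha⟩ := hmono q ha1.le
    have h4 : ψ q ⟨b, hb⟩ ≤ ψ q y := hmono q hb2.le
    linarith
  · let T₀ : BoundedContinuousFunction ℝ ℝ →ₗ[ℝ] C(Fin d → I01, ℝ) :=
      { toFun := Top lam ψ
        map_add' := by
          intro g g'
          ext x
          simp [Top, Finset.sum_add_distrib]
        map_smul' := by
          intro c g
          ext x
          simp [Top, Finset.mul_sum] }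
    let T : BoundedContinuousFunction ℝ ℝ →L[ℝ] C(Fin d → I01, ℝ) := T₀.mkContinuous n (by
      intro g
      rw [ContinuousMap.norm_le _ (by positivity)]
      intro x
      change ‖∑ q, g (∑ p, lam p * ψ q (x p))‖ ≤ n * ‖g‖
      refine (norm_sum_le _ _).trans ?_
      refine (Finset.sum_le_sum fun q _ => g.norm_coe_le_norm _).trans ?_
      simp)
    have hT : ∀ g, T g = Top lam ψ g := fun g => rfl
    have hθ0 : 0 ≤ θ := by
      have : 1 / (2 * n : ℝ) ≤ 1 := by rw [div_le_one (by linarith)]; linarith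
      simp only [θ]; linarith
    have hκ : 0 < 1 / (8 * n : ℝ) := by positivity
    have hκ1 : 1 / (8 * n : ℝ) < 1 := by rw [div_lt_one (by linarith)]; linarith
    have hθκ : θ = 1 - 4 * (1 / (8 * n : ℝ)) := by simp only [θ]; field_simp; ring
    set κ := 1 / (8 * n : ℝ) with hκd
    have hsurj : Function.Surjective T := by
      refine surj_of_approx T 2 (1 - κ) (by linarith) (by linarith) (by norm_num) ?_
      intro f
      by_cases hf : f = 0
      · exact ⟨0, by simp [hf], by simp [hf]⟩
      have hf0 : 0 < ‖f‖ := norm_pos_iff.2 hf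
      obtain ⟨k, hk⟩ := hF.exists_dist_lt f (mul_pos hκ hf0)
      rw [dist_eq_norm] at hk
      have hFk : ‖F k‖ ≤ (1 + κ) * ‖f‖ := by
        have := norm_sub_norm_le (F k) f
        rw [norm_sub_rev] at this
        linarith
      have hFk0 : F k ≠ 0 := by
        intro h0
        rw [h0, sub_zero] at hk
        nlinarith
      obtain ⟨g, hg1, hg2⟩ := (hψ (Sum.inl k) : F k ≠ 0 → _) hFk0
      refine ⟨g, ?_, ?_⟩
      · refine hg1.trans (hFk.trans ?_)
        gcongr
        linarith
      · rw [hT]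
        have h1 : ‖f - Top lam ψ g‖ ≤ ‖f - F k‖ + ‖F k - Top lam ψ g‖ := norm_sub_le_norm_sub_add_norm_sub _ _ _
        have h2 : θ * ‖F k‖ ≤ θ * ((1 + κ) * ‖f‖) := mul_le_mul_of_nonneg_left hFk hθ0
        have h3 : κ * ‖f‖ + θ * ((1 + κ) * ‖f‖) ≤ (1 - κ) * ‖f‖ := by
          rw [hθκ, ← mul_assoc, ← add_mul]
          refine mul_le_mul_of_nonneg_right ?_ hf0.le
          nlinarith
        linarith
    intro f
    exact hsurj f

end LorentzKA


/-- **Lorentz's variant of the Kolmogorov–Arnold Representation Theorem** (1962):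
for every `d ≥ 2` there exist an exponent `α ∈ (0,1)`, constants `λ_p ∈ (0,1]`, and
strictly increasing, `α`-Hölder continuous inner functions `ψ_q : [0,1] → [0,1]`
(`0 ≤ q ≤ 2d`), such that every continuous real function `f` on `[0,1]^d` is
representable as `f(x₁,…,x_d) = Σ_{q=0}^{2d} g (Σ_{p=1}^{d} λ_p ψ_q(x_p))` for some
continuous function `g` on `[0,d]` depending on `f`. -/
theorem lorentz_kolmogorov_representation (d : ℕ) (hd : 2 ≤ d) :
    ∃ (α : ℝ), α ∈ Set.Ioo (0:ℝ) 1 ∧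
    ∃ (lam : Fin d → ℝ), (∀ p, lam p ∈ Set.Ioc (0:ℝ) 1) ∧
    ∃ (ψ : Fin (2 * d + 1) → ℝ → ℝ),
      (∀ q, StrictMonoOn (ψ q) (Set.Icc (0:ℝ) 1)) ∧
      (∀ q, Set.MapsTo (ψ q) (Set.Icc (0:ℝ) 1) (Set.Icc (0:ℝ) 1)) ∧
      (∀ q, ∃ K : ℝ, 0 < K ∧ ∀ x ∈ Set.Icc (0:ℝ) 1, ∀ y ∈ Set.Icc (0:ℝ) 1,
        |ψ q x - ψ q y| ≤ K * |x - y| ^ α) ∧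
      ∀ f : (Fin d → Set.Icc (0:ℝ) 1) → ℝ, Continuous f →
        ∃ g : ℝ → ℝ, ContinuousOn g (Set.Icc (0:ℝ) d) ∧
          ∀ x, f x = ∑ q, g (∑ p, lam p * ψ q (x p)) := by
  obtain ⟨lam, hlam1, hlam⟩ := LorentzKA.exists_lam d
  obtain ⟨ψ, hmono, hhold, hrep⟩ :=
    LorentzKA.exists_inner (n := 2 * d + 1) (by omega) rfl lam hlam
  obtain ⟨M, hM0, hM⟩ : ∃ M : ℝ, 0 < M ∧ ∀ q x, |ψ q x| ≤ M := by
    refine ⟨‖ψ‖ + 1, by positivity, fun q x => ?_⟩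
    have h1 := (ψ q).norm_coe_le_norm x
    have h2 := norm_le_pi_norm ψ q
    rw [Real.norm_eq_abs] at h1
    linarith
  let pr : ℝ → Set.Icc (0:ℝ) 1 := Set.projIcc (0:ℝ) 1 zero_le_one
  refine ⟨1 / 2, ⟨by norm_num, by norm_num⟩, lam, hlam1,
    fun q x => (ψ q (pr x) + M) / (2 * M), ?_, ?_, ?_, ?_⟩
  · intro q x hx y hy hxy
    have h1 : pr x < pr y := by
      simp only [pr]
      rw [Set.projIcc_of_mem _ hx, Set.projIcc_of_mem _ hy]
      exact hxy
    have h2 := hmono q h1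
    simp only
    gcongr
  · intro q x _
    have h1 := abs_le.1 (hM q (pr x))
    constructor
    · exact div_nonneg (by linarith) (by linarith)
    · rw [div_le_one (by linarith)]
      linarith
  · intro q
    refine ⟨1 / (2 * M), by positivity, ?_⟩
    intro x hx y hy
    have h1 := hhold q (pr x) (pr y)
    have ex : pr x = ⟨x, hx⟩ := Set.projIcc_of_mem _ hx
    have ey : pr y = ⟨y, hy⟩ := Set.projIcc_of_mem _ hy
    have e : (ψ q (pr x) + M) / (2 * M) - (ψ q (pr y) + M) / (2 * M)
        = 1 / (2 * M) * (ψ q (pr x) - ψ q (pr y)) := by ring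
    rw [e, abs_mul, abs_of_pos (by positivity : 0 < 1 / (2 * M)), ← Real.sqrt_eq_rpow]
    refine mul_le_mul_of_nonneg_left ?_ (by positivity)
    rw [ex, ey] at h1 ⊢
    exact h1
  · intro f hf
    obtain ⟨g, hg⟩ := hrep ⟨f, hf⟩
    refine ⟨fun t => g (2 * M * t - M * ∑ p, lam p), ?_, ?_⟩
    · exact (g.continuous.comp (by fun_prop)).continuousOn
    · intro x
      have h1 : f x = ∑ q, g (∑ p, lam p * ψ q (x p)) :=
        (DFunLike.congr_fun hg x).symm
      rw [h1]
      refine Finset.sum_congr rfl fun q _ => ?_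
      congr 1
      rw [Finset.mul_sum, Finset.mul_sum, ← Finset.sum_sub_distrib]
      refine Finset.sum_congr rfl fun p _ => ?_
      have e : pr (x p) = x p := Set.projIcc_val _ _
      simp only [e]
      field_simp
      ring
end

section
/- (Kahane's refinement of Lorentz's version, 1975.) For every integer d ≥ 2 there exist constants λ_p > 0 for 1 ≤ p ≤ d with Σ_{p=1}^{d} λ_p ≤ 1, and increasing functions ψ_q : [0,1] → [0,1] for 0 ≤ q ≤ 2d, each 1-Lipschitz with Lipschitz constant 1 (i.e., |ψ_q(x) − ψ_q(y)| ≤ |x − y| for all x, y ∈ [0,1]), such that every continuous real function f on [0,1]^d is representable as f(x₁,…,x_d) = Σ_{q=0}^{2d} g(Σ_{p=1}^{d} λ_p ψ_q(x_p)) for some continuous real function g (depending on f). -/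
theorem lam_exists (d : ℕ) : ∃ lam : Fin d → ℝ, (∀ p, 0 < lam p) ∧ (∑ p, lam p) ≤ 1 ∧
    ∀ c : Fin d → ℤ, ∑ p, lam p * (c p : ℝ) = 0 → ∀ p, c p = 0 := by
  obtain ⟨t, ht0, ht⟩ : ∃ t : ℝ, 0 < t ∧ Transcendental ℤ t := by
    refine ⟨liouvilleNumber (2:ℕ), ?_, transcendental_liouvilleNumber le_rfl⟩
    unfold liouvilleNumber
    refine Summable.tsum_pos (LiouvilleNumber.summable (by norm_num)) (fun i => by positivity) 0 (by positivity)
  set Sg : ℝ := 1 + ∑ p : Fin d, t ^ (p : ℕ) with hS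
  have hS0 : 0 < Sg := by
    have : 0 ≤ ∑ p : Fin d, t ^ (p : ℕ) := Finset.sum_nonneg fun _ _ => by positivity
    linarith
  refine ⟨fun p => t ^ (p : ℕ) / Sg, fun p => by positivity, ?_, ?_⟩
  · rw [← Finset.sum_div, div_le_one hS0]; linarith
  · intro c hc
    have h1 : ∑ p : Fin d, t ^ (p : ℕ) * (c p : ℝ) = 0 := by
      have : ∑ p : Fin d, t ^ (p : ℕ) / Sg * (c p : ℝ) = (∑ p : Fin d, t ^ (p : ℕ) * (c p : ℝ)) / Sg := by
        rw [Finset.sum_div]; exact Finset.sum_congr rfl fun p _ => by ring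
      rw [this] at hc
      rcases div_eq_zero_iff.1 hc with h | h
      · exact h
      · exact absurd h hS0.ne'
    set P : Polynomial ℤ := ∑ p : Fin d, Polynomial.C (c p) * Polynomial.X ^ (p : ℕ) with hP
    have hP0 : P = 0 := by
      by_contra hne
      apply ht
      refine ⟨P, hne, ?_⟩
      rw [hP, map_sum, ← h1]
      refine Finset.sum_congr rfl fun p _ => ?_
      simp [mul_comm]
    intro p
    have := congrArg (fun Q => Polynomial.coeff Q (p : ℕ)) hP0
    simp only [hP, Polynomial.finsetSum_coeff, Polynomial.coeff_C_mul, Polynomial.coeff_X_pow, Polynomial.coeff_zero] at this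
    rw [Finset.sum_eq_single p] at this
    · simpa using this
    · intro b _ hb
      rw [if_neg, mul_zero]
      exact fun h => hb (Fin.ext h.symm)
    · simp


noncomputable def stair (N M q : ℕ) (v : ℕ → ℝ) (x : ℝ) : ℝ :=
  v 0 + ∑ j ∈ Finset.range (M + 1), (v (j + 1) - v j) * max 0 (min 1 ((N:ℝ) * M * x - N * j - q))

theorem stair_continuous (N M q : ℕ) (v : ℕ → ℝ) : Continuous (stair N M q v) := by
  unfold stair; fun_prop

theorem stair_monotone (N M q : ℕ) (v : ℕ → ℝ) (hv : Monotone v) : Monotone (stair N M q v) := by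
  intro x y hxy
  unfold stair
  gcongr with j hj
  exact sub_nonneg.2 (hv (Nat.le_succ j))

theorem stair_eq (N M q : ℕ) (hN : 0 < N) (hM : 0 < M) (hq : q < N) (v : ℕ → ℝ) (x : ℝ)
    (a : ℕ) (ha : a ≤ M)
    (h1 : (N:ℝ) * a ≤ N * M * x) (h2 : (N:ℝ) * M * x < N * (a + 1)) :
    stair N M q v x = v a + (v (a + 1) - v a) * max 0 (min 1 ((N:ℝ) * M * x - N * a - q)) := by
  have hq' : (q:ℝ) + 1 ≤ N := by exact_mod_cast hq
  have hN' : (0:ℝ) < N := by exact_mod_cast hN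
  unfold stair
  rw [← Finset.sum_subset (s₁ := Finset.range (a + 1)), Finset.sum_range_succ]
  · have : ∑ j ∈ Finset.range a, (v (j + 1) - v j) * max 0 (min 1 ((N:ℝ) * M * x - N * j - q))
        = ∑ j ∈ Finset.range a, (v (j + 1) - v j) := by
      refine Finset.sum_congr rfl fun j hj => ?_
      have hj' : (j:ℝ) + 1 ≤ a := by exact_mod_cast Finset.mem_range.1 hj
      have : 1 ≤ (N:ℝ) * M * x - N * j - q := by nlinarith
      rw [min_eq_left this, max_eq_right zero_le_one, mul_one]
    rw [this, Finset.sum_range_sub]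
    ring
  · intro j hj
    simp only [Finset.mem_range] at *
    omega
  · intro j _ hj
    have hj' : (a:ℝ) + 1 ≤ j := by
      simp only [Finset.mem_range, not_lt] at hj
      exact_mod_cast hj
    have hq0 : (0:ℝ) ≤ q := by positivity
    have : (N:ℝ) * M * x - N * j - q ≤ 0 := by nlinarith
    rw [min_eq_right (this.trans zero_le_one), max_eq_left this, mul_zero]

theorem stair_floor (N M : ℕ) (hN : 0 < N) (x : ℝ) (hx : x ∈ Set.Icc (0:ℝ) 1) :
    ⌊(N:ℝ) * M * x⌋₊ / N ≤ M ∧ (N:ℝ) * (⌊(N:ℝ) * M * x⌋₊ / N : ℕ) ≤ N * M * x ∧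
    (N:ℝ) * M * x < N * ((⌊(N:ℝ) * M * x⌋₊ / N : ℕ) + 1) := by
  have h0 : 0 ≤ (N:ℝ) * M * x := by have := hx.1; positivity
  have hlt := Nat.lt_floor_add_one ((N:ℝ) * M * x)
  have hle := Nat.floor_le h0
  set n := ⌊(N:ℝ) * M * x⌋₊
  have hn : n ≤ N * M := by
    have : (n:ℝ) ≤ ((N * M : ℕ) : ℝ) := by
      push_cast
      have : (0:ℝ) ≤ N * M := by positivity
      nlinarith [hx.2]
    exact_mod_cast this
  refine ⟨?_, ?_, ?_⟩
  · exact Nat.div_le_of_le_mul hn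
  · have : ((N * (n / N) : ℕ) : ℝ) ≤ n := by exact_mod_cast Nat.mul_div_le n N
    push_cast at this
    linarith
  · have : n + 1 ≤ N * (n / N + 1) := Nat.lt_mul_div_succ n hN
    have : ((n + 1 : ℕ) : ℝ) ≤ ((N * (n / N + 1) : ℕ) : ℝ) := by exact_mod_cast this
    push_cast at this
    push_cast
    linarith

theorem near_of (N M : ℕ) (hN : 0 < N) (hM : 0 < M) (x k : ℝ) (h : |(N:ℝ) * M * x - N * k| ≤ N) :
    |x - k / M| ≤ 1 / M := by
  have hN' : (0:ℝ) < N := by exact_mod_cast hN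
  have hM' : (0:ℝ) < M := by exact_mod_cast hM
  have : x - k / M = ((N:ℝ) * M * x - N * k) / (N * M) := by field_simp
  rw [this, abs_div, abs_of_pos (by positivity : (0:ℝ) < N * M), div_le_div_iff₀ (by positivity) hM']
  nlinarith

theorem stair_general (N M q : ℕ) (hN : 0 < N) (hM : 0 < M) (hq : q < N) (v : ℕ → ℝ) (x : ℝ)
    (hx : x ∈ Set.Icc (0:ℝ) 1) :
    ∃ k ≤ M, ∃ r : ℝ, 0 ≤ r ∧ r ≤ 1 ∧ stair N M q v x = v k + (v (k + 1) - v k) * r ∧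
      |x - (k : ℕ) / M| ≤ 1 / M ∧ |x - ((k + 1 : ℕ) : ℝ) / M| ≤ 1 / M := by
  obtain ⟨ha, h1, h2⟩ := stair_floor N M hN x hx
  have hN' : (0:ℝ) < N := by exact_mod_cast hN
  refine ⟨_, ha, _, le_max_left _ _, max_le zero_le_one (min_le_left _ _),
    stair_eq N M q hN hM hq v x _ ha h1 h2, ?_, ?_⟩
  · apply near_of N M hN hM
    rw [abs_le]; constructor <;> linarith
  · apply near_of N M hN hM
    push_cast
    push_cast at h2
    rw [abs_le]; constructor <;> linarith

theorem stair_good (N M q : ℕ) (hN : 0 < N) (hM : 0 < M) (hq : q < N) (v : ℕ → ℝ) (x : ℝ)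
    (hx : x ∈ Set.Icc (0:ℝ) 1) (hg : ⌊(N:ℝ) * M * x⌋₊ % N ≠ q) :
    ∃ k < M + 2, stair N M q v x = v k ∧ |x - (k : ℕ) / M| ≤ 1 / M := by
  obtain ⟨ha, h1, h2⟩ := stair_floor N M hN x hx
  have hN' : (0:ℝ) < N := by exact_mod_cast hN
  have he := stair_eq N M q hN hM hq v x _ ha h1 h2
  have h0 : 0 ≤ (N:ℝ) * M * x := by have := hx.1; positivity
  have hlt := Nat.lt_floor_add_one ((N:ℝ) * M * x)
  have hle := Nat.floor_le h0
  have hdm := Nat.div_add_mod ⌊(N:ℝ) * M * x⌋₊ N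
  set n := ⌊(N:ℝ) * M * x⌋₊
  have hdm' : (N:ℝ) * (n / N : ℕ) + (n % N : ℕ) = n := by exact_mod_cast hdm
  rcases lt_or_gt_of_ne hg with h | h
  · refine ⟨n / N, by omega, ?_, ?_⟩
    · have hb : ((n % N : ℕ) : ℝ) + 1 ≤ q := by exact_mod_cast h
      have : (N:ℝ) * M * x - N * (n / N : ℕ) - q ≤ 0 := by linarith
      rw [he, min_eq_right (this.trans zero_le_one), max_eq_left this]; ring
    · apply near_of N M hN hM
      rw [abs_le]; constructor <;> linarith
  · refine ⟨n / N + 1, by omega, ?_, ?_⟩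
    · have hb : (q : ℝ) + 1 ≤ ((n % N : ℕ) : ℝ) := by exact_mod_cast h
      have : 1 ≤ (N:ℝ) * M * x - N * (n / N : ℕ) - q := by linarith
      rw [he, min_eq_left this, max_eq_right zero_le_one]; ring
    · apply near_of N M hN hM
      push_cast
      push_cast at h2
      rw [abs_le]; constructor <;> linarith

/-- grid points -/
noncomputable def tpt (M k : ℕ) : Set.Icc (0:ℝ) 1 :=
  ⟨min ((k:ℝ) / M) 1, le_min (by positivity) zero_le_one, min_le_right _ _⟩

theorem tpt_mono (M : ℕ) : Monotone (tpt M) := by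
  intro a b h
  show min ((a:ℝ) / M) 1 ≤ min ((b:ℝ) / M) 1
  gcongr

theorem tpt_near (M k : ℕ) (x : Set.Icc (0:ℝ) 1) (h : |(x:ℝ) - (k:ℕ) / M| ≤ 1 / M) :
    dist x (tpt M k) ≤ 1 / M := by
  rw [Subtype.dist_eq, Real.dist_eq]
  refine le_trans ?_ h
  show |(x:ℝ) - min ((k:ℝ) / M) 1| ≤ _
  have := x.2.2
  rcases le_total ((k:ℝ) / M) 1 with h | h
  · rw [min_eq_left h]
  · rw [min_eq_right h, abs_sub_comm, abs_sub_comm (x:ℝ), abs_of_nonneg (by linarith), abs_of_nonneg (by linarith)]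
    linarith

theorem interp {ι : Type*} [Fintype ι] [DecidableEq ι] (y r : ι → ℝ) (hy : Function.Injective y) (B : ℝ)
    (hB : 0 ≤ B) (hr : ∀ i, |r i| ≤ B) :
    ∃ g : BoundedContinuousFunction ℝ ℝ, ‖g‖ ≤ B ∧ ∀ i, g (y i) = r i := by
  let P := Lagrange.interpolate Finset.univ y r
  have hb : ∀ x, |max (-B) (min B (P.eval x))| ≤ B := fun x => by
    rw [abs_le]
    exact ⟨le_max_left _ _, max_le (by linarith) (min_le_left _ _)⟩
  refine ⟨BoundedContinuousFunction.ofNormedAddCommGroup (fun x => max (-B) (min B (P.eval x)))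
    (by have := P.continuous; fun_prop) B hb, BoundedContinuousFunction.norm_ofNormedAddCommGroup_le _ hB _, ?_⟩
  intro i
  show max (-B) (min B (P.eval (y i))) = r i
  rw [Lagrange.eval_interpolate_at_node r (hy.injOn) (Finset.mem_univ i)]
  have := abs_le.1 (hr i)
  rw [min_eq_right this.2, max_eq_right this.1]

/-- integer node values -/
noncomputable def wval (N M L q : ℕ) (u : ℕ → ℝ) (k : ℕ) : ℤ :=
  ((M + 2 : ℕ) * N : ℕ) * ⌊L * u k⌋ + (k * N + q : ℕ)

theorem wval_inj (N M L q q' : ℕ) (u u' : ℕ → ℝ) (k k' : ℕ) (hq : q < N) (hq' : q' < N)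
    (hk : k < M + 2) (hk' : k' < M + 2) (h : wval N M L q u k = wval N M L q' u' k') :
    q = q' ∧ k = k' := by
  have b : ∀ k q, k < M + 2 → q < N → k * N + q < (M + 2) * N := by
    intro k q hk hq; nlinarith
  have h3 := congrArg (fun z : ℤ => z % (((M + 2 : ℕ) * N : ℕ) : ℤ)) h
  simp only [wval, Int.mul_add_emod_self_left] at h3
  have h4 : (k * N + q) % ((M + 2) * N) = (k' * N + q') % ((M + 2) * N) := by exact_mod_cast h3
  rw [Nat.mod_eq_of_lt (b k q hk hq), Nat.mod_eq_of_lt (b k' q' hk' hq')] at h4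
  have h5 := congrArg (· % N) h4
  simp only [Nat.mul_add_mod_self_right, Nat.mod_eq_of_lt hq, Nat.mod_eq_of_lt hq'] at h5
  subst h5
  refine ⟨rfl, ?_⟩
  have : k * N = k' * N := by omega
  exact Nat.eq_of_mul_eq_mul_right (by omega) this

noncomputable def vval (N M L q : ℕ) (u : ℕ → ℝ) (k : ℕ) : ℝ :=
  (wval N M L q u k : ℝ) / (((M + 2 : ℕ) * N : ℕ) * L)

theorem vval_mono (N M L q : ℕ) (u : ℕ → ℝ) (hu : Monotone u) : Monotone (vval N M L q u) := by
  intro a b h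
  unfold vval
  gcongr
  unfold wval
  have := hu h
  gcongr

theorem vval_near (N M L q : ℕ) (u : ℕ → ℝ) (hL : 0 < L) (hq : q < N) (k : ℕ) (hk : k < M + 2) :
    |vval N M L q u k - u k| ≤ 1 / L := by
  have b : k * N + q < (M + 2) * N := by nlinarith
  have b' : ((k * N + q : ℕ) : ℝ) < ((M + 2 : ℕ) * N : ℕ) := by exact_mod_cast b
  have hL' : (0:ℝ) < L := by exact_mod_cast hL
  have e0 : (0:ℝ) ≤ ((k * N + q : ℕ) : ℝ) := by positivity
  unfold vval wval
  rw [Int.cast_add, Int.cast_mul, Int.cast_natCast, Int.cast_natCast]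
  set R : ℝ := (((M + 2 : ℕ) * N : ℕ) : ℝ)
  set e : ℝ := ((k * N + q : ℕ) : ℝ)
  have hR : 0 < R := by linarith
  have h1 := Int.floor_le (L * u k)
  have h2 := Int.lt_floor_add_one (L * u k)
  have : (R * (⌊L * u k⌋:ℝ) + e) / (R * L) - u k = ((⌊L * u k⌋:ℝ) + e / R - L * u k) / L := by
    field_simp
  rw [this, abs_div, abs_of_pos hL']
  have f1 : e / R ≤ 1 := by rw [div_le_one hR]; exact b'.le
  have f0 : 0 ≤ e / R := by positivity
  gcongr
  rw [abs_le]; constructor <;> linarith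

open scoped BoundedContinuousFunction

theorem dense_core (d : ℕ) (lam : Fin d → ℝ)
    (hd0 : d ≠ 0) (hlam : ∀ c : Fin d → ℤ, ∑ p, lam p * (c p : ℝ) = 0 → ∀ p, c p = 0)
    (ψ : Fin (2 * d + 1) → C(Set.Icc (0:ℝ) 1, ℝ)) (hψ : ∀ q, Monotone (ψ q))
    (f : C(Fin d → Set.Icc (0:ℝ) 1, ℝ)) (hf : f ≠ 0) (ε : ℝ) (hε : 0 < ε) :
    ∃ ψ' : Fin (2 * d + 1) → C(Set.Icc (0:ℝ) 1, ℝ), (∀ q, Monotone (ψ' q)) ∧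
      (∀ q x, |ψ' q x - ψ q x| ≤ ε) ∧
      ∃ g : ℝ →ᵇ ℝ, ‖g‖ ≤ 1 / (2 * d + 1) * ‖f‖ ∧
        ∀ x, |f x - ∑ q, g (∑ p, lam p * ψ' q (x p))| ≤ (1 - 2 / 3 * (1 / (2 * d + 1))) * ‖f‖ := by
  obtain ⟨N, hNd⟩ : ∃ N, N = 2 * d + 1 := ⟨_, rfl⟩
  have hN : 0 < N := by omega
  have hNr : (N:ℝ) = 2 * d + 1 := by rw [hNd]; push_cast; ring
  have hN' : (0:ℝ) < N := by exact_mod_cast hN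
  rw [← hNr]
  have hF : 0 < ‖f‖ := norm_pos_iff.2 hf
  -- uniform continuity
  have huf : UniformContinuous f := CompactSpace.uniformContinuous_of_continuous f.continuous
  obtain ⟨δ₁, hδ₁, hδf⟩ := Metric.uniformContinuous_iff.1 huf (1 / 3 * (1 / N) * ‖f‖) (by positivity)
  have hup : ∀ q, ∃ δ > 0, ∀ x y, dist x y < δ → dist (ψ q x) (ψ q y) < ε / 2 := fun q =>
    Metric.uniformContinuous_iff.1
      (CompactSpace.uniformContinuous_of_continuous (ψ q).continuous) (ε / 2) (by positivity)
  choose δ₂ hδ₂ hδψ using hup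
  obtain ⟨δ, hδ, hδ1, hδ2⟩ : ∃ δ > 0, δ ≤ δ₁ ∧ ∀ q, δ ≤ δ₂ q := by
    obtain ⟨q0, hq0⟩ := Finite.exists_min δ₂
    exact ⟨min δ₁ (δ₂ q0), lt_min hδ₁ (hδ₂ q0), min_le_left _ _, fun q => (min_le_right _ _).trans (hq0 q)⟩
  obtain ⟨m, hm⟩ := exists_nat_one_div_lt hδ
  obtain ⟨l, hl⟩ := exists_nat_one_div_lt (half_pos hε)
  obtain ⟨M, hMm⟩ : ∃ M, M = m + 1 := ⟨_, rfl⟩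
  obtain ⟨L, hLl⟩ : ∃ L, L = l + 1 := ⟨_, rfl⟩
  have hM : 0 < M := by omega
  have hL : 0 < L := by omega
  have hMδ : 1 / (M:ℝ) < δ := by rw [hMm]; push_cast; exact hm
  have hLε : 1 / (L:ℝ) < ε / 2 := by rw [hLl]; push_cast; exact hl
  have hL' : (0:ℝ) < L := by exact_mod_cast hL
  -- node values
  let u : Fin (2 * d + 1) → ℕ → ℝ := fun q k => ψ q (tpt M k)
  have hu : ∀ q, Monotone (u q) := fun q => (hψ q).comp (tpt_mono M)
  let v : Fin (2 * d + 1) → ℕ → ℝ := fun q => vval N M L q (u q)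
  have hqN : ∀ q : Fin (2 * d + 1), (q:ℕ) < N := fun q => by rw [hNd]; exact q.2
  have hv : ∀ q, Monotone (v q) := fun q => vval_mono _ _ _ _ _ (hu q)
  have hvn : ∀ q k, k < M + 2 → |v q k - u q k| ≤ 1 / L := fun q k hk =>
    vval_near _ _ _ _ _ hL (hqN q) _ hk
  let ψ' : Fin (2 * d + 1) → C(Set.Icc (0:ℝ) 1, ℝ) := fun q =>
    ⟨fun x => stair N M q (v q) x, (stair_continuous _ _ _ _).comp continuous_subtype_val⟩
  have hψ' : ∀ q x, ψ' q x = stair N M q (v q) x := fun _ _ => rfl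
  -- g
  let Y : Fin (2 * d + 1) × (Fin d → Fin (M + 2)) → ℝ := fun i => ∑ p, lam p * v i.1 (i.2 p)
  have hY : Function.Injective Y := by
    rintro ⟨q, k⟩ ⟨q', k'⟩ h
    have h1 : ∑ p, lam p * ((wval N M L q (u q) (k p) - wval N M L q' (u q') (k' p) : ℤ) : ℝ) = 0 := by
      have hR : (0:ℝ) < (((M + 2 : ℕ) * N : ℕ) * L) := by positivity
      have e : ∀ (q : Fin (2 * d + 1)) (k : ℕ), (wval N M L q (u q) k : ℝ) = (((M + 2 : ℕ) * N : ℕ) * L) * v q k := by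
        intro q k
        show _ = _ * ((wval N M L q (u q) k : ℝ) / (((M + 2 : ℕ) * N : ℕ) * L))
        rw [mul_div_cancel₀ _ hR.ne']
      have h' : ∑ p, lam p * v q (k p) = ∑ p, lam p * v q' (k' p) := h
      calc _ = ∑ p, (((M + 2 : ℕ) * N : ℕ) * (L:ℝ)) * (lam p * v q (k p) - lam p * v q' (k' p)) := by
            refine Finset.sum_congr rfl fun p _ => ?_
            rw [Int.cast_sub, e, e]; ring
        _ = 0 := by rw [← Finset.mul_sum, Finset.sum_sub_distrib, h', sub_self, mul_zero]
    have h2 := hlam _ h1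
    have h3 : ∀ p, (q:ℕ) = q' ∧ (k p : ℕ) = k' p := fun p =>
      wval_inj _ _ _ _ _ _ _ _ _ (hqN q) (hqN q') (k p).2 (k' p).2 (sub_eq_zero.1 (h2 p))
    have hq : q = q' := Fin.ext (h3 ⟨0, by omega⟩).1
    have hk : k = k' := funext fun p => Fin.ext (h3 p).2
    rw [hq, hk]
  obtain ⟨g, hg, hgv⟩ := interp Y (fun i => 1 / N * f (fun p => tpt M (i.2 p))) hY (1 / N * ‖f‖)
    (by positivity) (fun i => by
      rw [abs_mul, abs_of_pos (by positivity : (0:ℝ) < 1 / N)]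
      gcongr
      exact f.norm_coe_le_norm _)
  refine ⟨ψ', ?_, ?_, g, hg, ?_⟩
  · intro q x y hxy
    exact stair_monotone _ _ _ _ (hv q) hxy
  · intro q x
    obtain ⟨k, hk, r, hr0, hr1, he, hk1, hk2⟩ := stair_general N M q hN hM (hqN q) (v q) x x.2
    rw [hψ', he]
    have a1 := hδψ q _ _ ((tpt_near M k x hk1).trans_lt (hMδ.trans_le (hδ2 q)))
    have a2 := hδψ q _ _ ((tpt_near M (k + 1) x hk2).trans_lt (hMδ.trans_le (hδ2 q)))
    rw [Real.dist_eq, abs_lt] at a1 a2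
    have b1 := abs_le.1 (hvn q k (by omega))
    have b2 := abs_le.1 (hvn q (k + 1) (by omega))
    have c1 : |v q k - ψ q x| ≤ ε := by
      simp only [u] at b1
      rw [abs_le]; constructor <;> linarith
    have c2 : |v q (k + 1) - ψ q x| ≤ ε := by
      simp only [u] at b2
      rw [abs_le]; constructor <;> linarith
    rw [abs_le] at c1 c2 ⊢
    constructor <;> nlinarith
  · intro x
    let bad : Finset (Fin (2 * d + 1)) := Finset.univ.image
      (fun p : Fin d => (⟨⌊(N:ℝ) * M * (x p : ℝ)⌋₊ % N, by rw [← hNd]; exact Nat.mod_lt _ hN⟩ : Fin (2 * d + 1)))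
    have hbad : bad.card ≤ d := by
      simpa using (Finset.card_image_le (s := Finset.univ) (f :=
      (fun p : Fin d => (⟨⌊(N:ℝ) * M * (x p : ℝ)⌋₊ % N, by rw [← hNd]; exact Nat.mod_lt _ hN⟩ : Fin (2 * d + 1)))))
    have hfx : |f x| ≤ ‖f‖ := f.norm_coe_le_norm x
    have hgood : ∀ q ∉ bad, |1 / N * f x - g (∑ p, lam p * ψ' q (x p))| ≤ 1 / N * (1 / 3 * (1 / N) * ‖f‖) := by
      intro q hq
      have : ∀ p, ∃ k < M + 2, stair N M q (v q) (x p) = v q k ∧ |(x p : ℝ) - (k : ℕ) / M| ≤ 1 / M := by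
        intro p
        apply stair_good N M q hN hM (hqN q) (v q) (x p) (x p).2
        intro h
        apply hq
        exact Finset.mem_image.2 ⟨p, Finset.mem_univ _, Fin.ext h⟩
      choose k hk1 hk2 hk3 using this
      have e1 : ∑ p, lam p * ψ' q (x p) = Y (q, fun p => ⟨k p, hk1 p⟩) := by
        show _ = ∑ p, lam p * v q (k p)
        exact Finset.sum_congr rfl fun p _ => by rw [hψ', hk2]
      rw [e1, hgv, ← mul_sub, abs_mul, abs_of_pos (by positivity : (0:ℝ) < 1 / N)]
      gcongr
      have : dist x (fun p => tpt M (k p)) < δ₁ := by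
        rw [dist_pi_lt_iff hδ₁]
        intro p
        exact (tpt_near M _ _ (hk3 p)).trans_lt (hMδ.trans_le hδ1)
      exact (hδf this).le
    have hall : ∀ q, |1 / N * f x - g (∑ p, lam p * ψ' q (x p))| ≤
        1 / N * (1 / 3 * (1 / N) * ‖f‖) + if q ∈ bad then 2 * (1 / N * ‖f‖) else 0 := by
      intro q
      by_cases hq : q ∈ bad
      · rw [if_pos hq]
        have h1 : |g (∑ p, lam p * ψ' q (x p))| ≤ 1 / N * ‖f‖ := (g.norm_coe_le_norm _).trans hg
        have h2 : |1 / N * f x| ≤ 1 / N * ‖f‖ := by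
          rw [abs_mul, abs_of_pos (by positivity : (0:ℝ) < 1 / N)]
          gcongr
        have h3 : 0 ≤ 1 / N * (1 / 3 * (1 / N) * ‖f‖) := by positivity
        have := abs_sub (1 / N * f x) (g (∑ p, lam p * ψ' q (x p)))
        linarith
      · rw [if_neg hq, add_zero]
        exact hgood q hq
    have hsum : f x - ∑ q, g (∑ p, lam p * ψ' q (x p)) =
        ∑ q, (1 / N * f x - g (∑ p, lam p * ψ' q (x p))) := by
      rw [Finset.sum_sub_distrib, Finset.sum_const, Finset.card_univ, Fintype.card_fin, nsmul_eq_mul]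
      have hc : ((2 * d + 1 : ℕ) : ℝ) = N := by rw [hNd]
      rw [hc]
      congr 1
      field_simp
    rw [hsum]
    refine (Finset.abs_sum_le_sum_abs _ _).trans ((Finset.sum_le_sum fun q _ => hall q).trans ?_)
    rw [Finset.sum_add_distrib, Finset.sum_const, Finset.card_univ, Fintype.card_fin, nsmul_eq_mul,
      Finset.sum_ite_mem, Finset.univ_inter, Finset.sum_const, nsmul_eq_mul]
    have hb : (bad.card : ℝ) ≤ d := by exact_mod_cast hbad
    have h1 : (N:ℝ) * (1 / N * (1 / 3 * (1 / N) * ‖f‖)) = 1 / 3 * (1 / N) * ‖f‖ := by field_simp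
    have h2 : (bad.card : ℝ) * (2 * (1 / N * ‖f‖)) ≤ d * (2 * (1 / N * ‖f‖)) := by gcongr
    have h3 : d * (2 * (1 / N * ‖f‖)) = (1 - 1 / N) * ‖f‖ := by
      have : (d:ℝ) = (N - 1) / 2 := by linarith
      rw [this]; field_simp
    have hc : ((2 * d + 1 : ℕ) : ℝ) = N := by rw [hNd]
    rw [hc, h1]
    linarith

/-- The space of tuples of monotone continuous functions. -/
abbrev MonoTuple (N : ℕ) : Type :=
  {ψ : Fin N → C(Set.Icc (0:ℝ) 1, ℝ) // ∀ q, Monotone (ψ q)}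

theorem monoTuple_closed (N : ℕ) :
    IsClosed {ψ : Fin N → C(Set.Icc (0:ℝ) 1, ℝ) | ∀ q, Monotone (ψ q)} := by
  have : {ψ : Fin N → C(Set.Icc (0:ℝ) 1, ℝ) | ∀ q, Monotone (ψ q)} =
      ⋂ q, ⋂ x, ⋂ y, ⋂ (_ : x ≤ y), {ψ | ψ q x ≤ ψ q y} := by
    ext ψ
    simp only [Set.mem_ofPred_eq, Set.mem_iInter]
    rfl
  rw [this]
  refine isClosed_iInter fun q => isClosed_iInter fun x => isClosed_iInter fun y => isClosed_iInter fun _ => ?_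
  exact isClosed_le ((continuous_eval_const x).comp (continuous_apply q))
    ((continuous_eval_const y).comp (continuous_apply q))

noncomputable def argMap {d N : ℕ} (lam : Fin d → ℝ) (ψ : Fin N → C(Set.Icc (0:ℝ) 1, ℝ)) (q : Fin N) :
    C(Fin d → Set.Icc (0:ℝ) 1, ℝ) :=
  ∑ p, lam p • (ψ q).comp ⟨fun x => x p, continuous_apply p⟩

noncomputable def synth {d N : ℕ} (lam : Fin d → ℝ) (g : ℝ →ᵇ ℝ) (ψ : Fin N → C(Set.Icc (0:ℝ) 1, ℝ)) :
    C(Fin d → Set.Icc (0:ℝ) 1, ℝ) :=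
  ∑ q, g.toContinuousMap.comp (argMap lam ψ q)

theorem synth_apply {d N : ℕ} (lam : Fin d → ℝ) (g : ℝ →ᵇ ℝ) (ψ : Fin N → C(Set.Icc (0:ℝ) 1, ℝ))
    (x : Fin d → Set.Icc (0:ℝ) 1) :
    synth lam g ψ x = ∑ q, g (∑ p, lam p * ψ q (x p)) := by
  simp [synth, argMap]

theorem synth_continuous {d N : ℕ} (lam : Fin d → ℝ) (g : ℝ →ᵇ ℝ) :
    Continuous (synth (N := N) lam g) := by
  unfold synth argMap
  refine continuous_finsetSum _ fun q _ => ?_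
  refine (ContinuousMap.continuous_postcomp _).comp ?_
  refine continuous_finsetSum _ fun p _ => ?_
  exact ((ContinuousMap.continuous_precomp _).comp (continuous_apply q)).const_smul (lam p)

def goodSet {d : ℕ} (lam : Fin d → ℝ) (f : C(Fin d → Set.Icc (0:ℝ) 1, ℝ)) :
    Set (MonoTuple (2 * d + 1)) :=
  {ψ | ∃ g : ℝ →ᵇ ℝ, ‖g‖ ≤ 1 / (2 * d + 1) * ‖f‖ ∧
    ‖f - synth lam g ψ.1‖ < (1 - 1 / 2 * (1 / (2 * d + 1))) * ‖f‖}

theorem goodSet_open {d : ℕ} (lam : Fin d → ℝ) (f : C(Fin d → Set.Icc (0:ℝ) 1, ℝ)) :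
    IsOpen (goodSet lam f) := by
  have : goodSet lam f = ⋃ g : ℝ →ᵇ ℝ, ⋃ (_ : ‖g‖ ≤ 1 / (2 * d + 1) * ‖f‖),
      {ψ | ‖f - synth lam g ψ.1‖ < (1 - 1 / 2 * (1 / (2 * d + 1))) * ‖f‖} := by
    ext ψ
    simp only [goodSet, Set.mem_ofPred_eq, Set.mem_iUnion, exists_prop]
  rw [this]
  refine isOpen_iUnion fun g => isOpen_iUnion fun _ => ?_
  exact isOpen_lt ((continuous_const.sub ((synth_continuous lam g).comp continuous_subtype_val)).norm)
    continuous_const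

theorem goodSet_dense {d : ℕ} (hd0 : d ≠ 0) (lam : Fin d → ℝ)
    (hlam : ∀ c : Fin d → ℤ, ∑ p, lam p * (c p : ℝ) = 0 → ∀ p, c p = 0)
    (f : C(Fin d → Set.Icc (0:ℝ) 1, ℝ)) (hf : f ≠ 0) :
    Dense (goodSet lam f) := by
  rw [Metric.dense_iff]
  intro ψ ε hε
  obtain ⟨ψ', h1, h2, g, h3, h4⟩ := dense_core d lam hd0 hlam ψ.1 ψ.2 f hf (ε / 2) (by positivity)
  have hF : 0 < ‖f‖ := norm_pos_iff.2 hf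
  refine ⟨⟨ψ', h1⟩, ?_, g, h3, ?_⟩
  · rw [Metric.mem_ball, Subtype.dist_eq]
    refine lt_of_le_of_lt ?_ (half_lt_self hε)
    rw [dist_pi_le_iff (by positivity)]
    intro q
    rw [ContinuousMap.dist_le (by positivity)]
    exact fun x => h2 q x
  · have hθ : (0:ℝ) < 1 / (2 * d + 1) := by positivity
    have hθ1 : (1:ℝ) / (2 * d + 1) ≤ 1 := by
      rw [div_le_one (by positivity)]
      have : (0:ℝ) ≤ d := by positivity
      linarith
    refine lt_of_le_of_lt (b := (1 - 2 / 3 * (1 / (2 * d + 1))) * ‖f‖) ?_ ?_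
    · rw [ContinuousMap.norm_le _ (mul_nonneg (by linarith) hF.le)]
      intro x
      rw [ContinuousMap.sub_apply, synth_apply]
      exact h4 x
    · apply mul_lt_mul_of_pos_right _ hF
      linarith

theorem exists_generic {d : ℕ} (hd0 : d ≠ 0) (lam : Fin d → ℝ)
    (hlam : ∀ c : Fin d → ℤ, ∑ p, lam p * (c p : ℝ) = 0 → ∀ p, c p = 0) :
    ∃ ψ : MonoTuple (2 * d + 1), ∃ r : ℝ, 0 ≤ r ∧ r < 1 ∧
      ∀ f : C(Fin d → Set.Icc (0:ℝ) 1, ℝ), ∃ g : ℝ →ᵇ ℝ, ‖g‖ ≤ 2 * ‖f‖ ∧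
        ‖f - synth lam g ψ.1‖ ≤ r * ‖f‖ := by
  haveI : CompleteSpace (MonoTuple (2 * d + 1)) := (monoTuple_closed (2 * d + 1)).completeSpace_coe
  let D := TopologicalSpace.denseSeq C(Fin d → Set.Icc (0:ℝ) 1, ℝ)
  have hD : Dense (⋂ n : {n // D n ≠ 0}, goodSet lam (D n)) :=
    dense_iInter_of_isOpen (fun n => goodSet_open lam _) (fun n => goodSet_dense hd0 lam hlam _ n.2)
  haveI : Nonempty (MonoTuple (2 * d + 1)) := ⟨⟨fun _ => 0, fun _ _ _ _ => le_rfl⟩⟩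
  obtain ⟨ψ, hψ⟩ := hD.nonempty
  obtain ⟨θ, hθe⟩ : ∃ θ : ℝ, θ = 1 / (2 * d + 1) := ⟨_, rfl⟩
  have hθ : (0:ℝ) < θ := by rw [hθe]; positivity
  have hθ1 : θ ≤ 1 := by
    rw [hθe, div_le_one (by positivity)]
    have : (0:ℝ) ≤ d := by positivity
    linarith
  refine ⟨ψ, 1 - 1 / 4 * θ, by linarith, by linarith, fun f => ?_⟩
  by_cases hf : f = 0
  · refine ⟨0, by simp, ?_⟩
    have : f - synth lam 0 ψ.1 = 0 := by
      ext x
      rw [ContinuousMap.sub_apply, synth_apply, hf]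
      simp
    rw [this, hf]; simp
  have hF : 0 < ‖f‖ := norm_pos_iff.2 hf
  obtain ⟨n, hn⟩ := (TopologicalSpace.denseRange_denseSeq C(Fin d → Set.Icc (0:ℝ) 1, ℝ)).exists_dist_lt f
    (by positivity : 0 < 1 / 8 * θ * ‖f‖)
  change dist f (D n) < _ at hn
  rw [dist_eq_norm] at hn
  have hDn : D n ≠ 0 := by
    intro h
    rw [h, sub_zero] at hn
    nlinarith
  obtain ⟨g, hg1, hg2⟩ := Set.mem_iInter.1 hψ ⟨n, hDn⟩
  simp only [← hθe] at hg1 hg2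
  have h1 : ‖D n‖ ≤ ‖f‖ + ‖f - D n‖ := by
    have := norm_sub_le f (f - D n)
    rwa [sub_sub_cancel] at this
  have hD0 : 0 ≤ ‖D n‖ := norm_nonneg _
  refine ⟨g, ?_, ?_⟩
  · nlinarith
  · have h2 : ‖f - synth lam g ψ.1‖ ≤ ‖f - D n‖ + ‖D n - synth lam g ψ.1‖ := norm_sub_le_norm_sub_add_norm_sub _ _ _
    have h3 : (1 - 1 / 2 * θ) * ‖D n‖ ≤ (1 - 1 / 2 * θ) * (‖f‖ + 1 / 8 * θ * ‖f‖) :=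
      mul_le_mul_of_nonneg_left (by linarith) (by linarith)
    have h4 : 0 ≤ θ * θ * ‖f‖ := by positivity
    nlinarith

theorem exists_exact {d : ℕ} (hd0 : d ≠ 0) (lam : Fin d → ℝ)
    (hlam : ∀ c : Fin d → ℤ, ∑ p, lam p * (c p : ℝ) = 0 → ∀ p, c p = 0) :
    ∃ ψ : MonoTuple (2 * d + 1), 
      ∀ f : C(Fin d → Set.Icc (0:ℝ) 1, ℝ), ∃ g : ℝ →ᵇ ℝ,
        ∀ x, f x = ∑ q, g (∑ p, lam p * ψ.1 q (x p)) := by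
  obtain ⟨ψ, r, hr0, hr1, h⟩ := exists_generic hd0 lam hlam
  choose G hG1 hG2 using h
  refine ⟨ψ, fun f => ?_⟩
  let F : ℕ → C(Fin d → Set.Icc (0:ℝ) 1, ℝ) := fun n => (fun f => f - synth lam (G f) ψ.1)^[n] f
  have hFs : ∀ n, F (n + 1) = F n - synth lam (G (F n)) ψ.1 := fun n => by
    simp only [F, Function.iterate_succ_apply']
  have hFn : ∀ n, ‖F n‖ ≤ r ^ n * ‖f‖ := by
    intro n
    induction n with
    | zero => simp [F]
    | succ n ih =>
      rw [hFs, pow_succ]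
      calc _ ≤ r * ‖F n‖ := hG2 _
        _ ≤ r * (r ^ n * ‖f‖) := by gcongr
        _ = _ := by ring
  have hgeo : Summable fun n : ℕ => r ^ n := summable_geometric_of_lt_one hr0 hr1
  have hsum : Summable fun n => G (F n) := by
    refine Summable.of_norm_bounded (g := fun n => 2 * (r ^ n * ‖f‖)) ((hgeo.mul_right _).mul_left _) fun n => ?_
    exact (hG1 _).trans (by gcongr; exact hFn n)
  refine ⟨∑' n, G (F n), fun x => ?_⟩
  have h1 : ∀ y, HasSum (fun n => G (F n) y) ((∑' n, G (F n)) y) := fun y =>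
    (BoundedContinuousFunction.evalCLM ℝ y).hasSum hsum.hasSum
  have h2 : HasSum (fun n => ∑ q, G (F n) (∑ p, lam p * ψ.1 q (x p)))
      (∑ q, (∑' n, G (F n)) (∑ p, lam p * ψ.1 q (x p))) :=
    hasSum_sum fun q _ => h1 _
  have h3 : ∀ n, ∑ q, G (F n) (∑ p, lam p * ψ.1 q (x p)) = F n x - F (n + 1) x := by
    intro n
    rw [hFs, ContinuousMap.sub_apply, synth_apply]; ring
  simp only [h3] at h2
  have h4 := h2.tendsto_sum_nat
  simp only [Finset.sum_range_sub'] at h4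
  have h5 : Filter.Tendsto (fun n => F n x) Filter.atTop (nhds 0) := by
    refine squeeze_zero_norm (a := fun n => r ^ n * ‖f‖) (fun n => ((F n).norm_coe_le_norm x).trans (hFn n)) ?_
    simpa using (tendsto_pow_atTop_nhds_zero_of_lt_one hr0 hr1).mul_const ‖f‖
  have h6 := h5.const_sub (F 0 x)
  rw [sub_zero] at h6
  exact tendsto_nhds_unique h6 h4

/-- **Kahane's refinement of Lorentz's version of the Kolmogorov–Arnold Representation
Theorem** (1975): for every `d ≥ 2` there exist constants `λ_p > 0` with
`Σ_p λ_p ≤ 1` and increasing inner functions `ψ_q : [0,1] → [0,1]` (`0 ≤ q ≤ 2d`)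
that are Lipschitz with constant `1`, such that every continuous real function `f` on
`[0,1]^d` is representable as
`f(x₁,…,x_d) = Σ_{q=0}^{2d} g (Σ_{p=1}^{d} λ_p ψ_q(x_p))`
for some continuous real function `g` depending on `f`. -/
theorem kahane_kolmogorov_representation (d : ℕ) (hd : 2 ≤ d) :
    ∃ (lam : Fin d → ℝ), (∀ p, 0 < lam p) ∧ (∑ p, lam p) ≤ 1 ∧
    ∃ (ψ : Fin (2 * d + 1) → ℝ → ℝ),
      (∀ q, MonotoneOn (ψ q) (Set.Icc (0:ℝ) 1)) ∧
      (∀ q, Set.MapsTo (ψ q) (Set.Icc (0:ℝ) 1) (Set.Icc (0:ℝ) 1)) ∧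
      (∀ q, ∀ x ∈ Set.Icc (0:ℝ) 1, ∀ y ∈ Set.Icc (0:ℝ) 1,
        |ψ q x - ψ q y| ≤ |x - y|) ∧
      ∀ f : (Fin d → Set.Icc (0:ℝ) 1) → ℝ, Continuous f →
        ∃ g : ℝ → ℝ, Continuous g ∧
          ∀ x, f x = ∑ q, g (∑ p, lam p * ψ q (x p)) := by
  obtain ⟨lam, hpos, hle, hind⟩ := lam_exists d
  obtain ⟨⟨ψ, hmono⟩, hrep⟩ := exists_exact (by omega : d ≠ 0) lam hind
  refine ⟨lam, hpos, hle, ?_⟩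
  let i0 : Set.Icc (0:ℝ) 1 := ⟨0, by norm_num, by norm_num⟩
  let i1 : Set.Icc (0:ℝ) 1 := ⟨1, by norm_num, by norm_num⟩
  have hi0 : ∀ x, i0 ≤ x := fun x => x.2.1
  have hi1 : ∀ x, x ≤ i1 := fun x => x.2.2
  let σ : Set.Icc (0:ℝ) 1 → ℝ := fun x => x + ∑ q, (ψ q x - ψ q i0)
  have hσc : Continuous σ := by
    refine continuous_subtype_val.add (continuous_finsetSum _ fun q _ => ?_)
    exact (ψ q).continuous.sub continuous_const
  -- increments
  have hσi : ∀ q x y, x ≤ y → ψ q y - ψ q x ≤ σ y - σ x := by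
    intro q x y hxy
    have e : σ y - σ x = (y - x) + ∑ q, (ψ q y - ψ q x) := by
      simp only [σ, Finset.sum_sub_distrib]; ring
    have h1 : ψ q y - ψ q x ≤ ∑ q, (ψ q y - ψ q x) :=
      Finset.single_le_sum (f := fun q => ψ q y - ψ q x)
        (fun q _ => sub_nonneg.2 (hmono q hxy)) (Finset.mem_univ q)
    have h2 : (x:ℝ) ≤ y := hxy
    linarith
  have hσm : Monotone σ := fun x y hxy => by
    have := hσi 0 x y hxy
    have := hmono 0 hxy
    linarith
  have hσ0 : σ i0 = 0 := by simp [σ, i0]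
  have hC1 : 1 ≤ σ i1 := by
    have : 0 ≤ ∑ q, (ψ q i1 - ψ q i0) := Finset.sum_nonneg fun q _ => sub_nonneg.2 (hmono q (hi0 i1))
    simp only [σ]
    show (1:ℝ) ≤ 1 + _
    linarith
  obtain ⟨C, hC⟩ : ∃ C, C = σ i1 := ⟨_, rfl⟩
  rw [← hC] at hC1
  have hC0 : 0 < C := by linarith
  have hσ01 : ∀ x, σ x / C ∈ Set.Icc (0:ℝ) 1 := fun x => by
    refine ⟨div_nonneg (hσ0 ▸ hσm (hi0 x)) hC0.le, ?_⟩
    rw [div_le_one hC0, hC]; exact hσm (hi1 x)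
  let s : Set.Icc (0:ℝ) 1 → Set.Icc (0:ℝ) 1 := fun x => ⟨σ x / C, hσ01 x⟩
  have hsc : Continuous s := (hσc.div_const C).subtype_mk _
  have hsurj : ∀ t : Set.Icc (0:ℝ) 1, ∃ x, s x = t := by
    intro t
    have := mem_range_of_exists_le_of_exists_ge hsc (c := t)
      ⟨i0, by show σ i0 / C ≤ t; rw [hσ0, zero_div]; exact t.2.1⟩
      ⟨i1, by show (t:ℝ) ≤ σ i1 / C; rw [← hC, div_self hC0.ne']; exact t.2.2⟩
    exact this
  choose h hh using hsurj
  have hσh : ∀ t, σ (h t) = C * t := fun t => by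
    have : σ (h t) / C = t := congrArg Subtype.val (hh t)
    rw [← this]; field_simp
  have key : ∀ q (t t' : Set.Icc (0:ℝ) 1), t ≤ t' →
      0 ≤ ψ q (h t') - ψ q (h t) ∧ ψ q (h t') - ψ q (h t) ≤ C * (t' - t) := by
    intro q t t' htt
    have htt' : (t:ℝ) ≤ t' := htt
    rcases le_total (h t) (h t') with hle | hle
    · have := hσi q _ _ hle
      rw [hσh, hσh] at this
      exact ⟨sub_nonneg.2 (hmono q hle), by linarith⟩
    · have h1 := hσm hle
      rw [hσh, hσh] at h1
      have h2 : t = t' := le_antisymm htt (by show (t':ℝ) ≤ t; nlinarith)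
      subst h2
      simp
  let B : ℝ := ∑ q, ‖ψ q‖
  have hB : ∀ q x, |ψ q x| ≤ B := fun q x => ((ψ q).norm_coe_le_norm x).trans
    (Finset.single_le_sum (f := fun q => ‖ψ q‖) (fun q _ => norm_nonneg _) (Finset.mem_univ q))
  have hB0 : 0 ≤ B := Finset.sum_nonneg fun q _ => norm_nonneg _
  obtain ⟨D, hD⟩ : ∃ D, D = C + 2 * B := ⟨_, rfl⟩
  have hD0 : 0 < D := by linarith
  let pr : ℝ → Set.Icc (0:ℝ) 1 := Set.projIcc 0 1 zero_le_one
  have hpr : ∀ t (ht : t ∈ Set.Icc (0:ℝ) 1), pr t = ⟨t, ht⟩ := fun t ht => Set.projIcc_of_mem _ ht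
  have key2 : ∀ q, ∀ x ∈ Set.Icc (0:ℝ) 1, ∀ y ∈ Set.Icc (0:ℝ) 1, x ≤ y →
      0 ≤ (ψ q (h (pr y)) + B) / D - (ψ q (h (pr x)) + B) / D ∧
      (ψ q (h (pr y)) + B) / D - (ψ q (h (pr x)) + B) / D ≤ y - x := by
    intro q x hx y hy hxy
    obtain ⟨k1, k2⟩ := key q ⟨x, hx⟩ ⟨y, hy⟩ hxy
    rw [hpr x hx, hpr y hy, ← sub_div]
    refine ⟨div_nonneg (by linarith) hD0.le, ?_⟩
    rw [div_le_iff₀ hD0]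
    simp only at k2
    nlinarith
  refine ⟨fun q t => (ψ q (h (pr t)) + B) / D, ?_, ?_, ?_, ?_⟩
  · intro q x hx y hy hxy
    have := (key2 q x hx y hy hxy).1
    simp only
    linarith
  · intro q x hx
    have := abs_le.1 (hB q (h (pr x)))
    refine ⟨div_nonneg (by linarith) hD0.le, ?_⟩
    rw [div_le_one hD0]
    linarith
  · intro q x hx y hy
    rcases le_total x y with hxy | hxy
    · obtain ⟨k1, k2⟩ := key2 q x hx y hy hxy
      rw [abs_sub_comm, abs_sub_comm x, abs_of_nonneg k1, abs_of_nonneg (by linarith)]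
      exact k2
    · obtain ⟨k1, k2⟩ := key2 q y hy x hx hxy
      rw [abs_of_nonneg k1, abs_of_nonneg (by linarith)]
      exact k2
  · intro f hf
    obtain ⟨g, hg⟩ := hrep ⟨fun y => f (fun p => s (y p)), by fun_prop⟩
    refine ⟨fun y => g (D * y - B * ∑ p, lam p), by fun_prop, fun x => ?_⟩
    have := hg (fun p => h (x p))
    simp only [ContinuousMap.coe_mk, hh] at this
    rw [this]
    refine Finset.sum_congr rfl fun q _ => ?_
    congr 1
    rw [Finset.mul_sum, Finset.mul_sum, ← Finset.sum_sub_distrib]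
    refine Finset.sum_congr rfl fun p _ => ?_
    have e : pr (x p : ℝ) = x p := Set.projIcc_val _ _
    simp only [e]
    field_simp
    ring
end

section
/- (Sprecher, 1997.) Let d ≥ 2, let m ≥ 2d be an integer, and let γ ≥ m+2 be an integer. Set a = 1/(γ(γ−1)), λ₁ = 1, and λ_p = Σ_{r=1}^{∞} γ^{−(p−1)(d^r−1)/(d−1)} for 2 ≤ p ≤ d. Then there exists a monotonically increasing function ψ : [0,2] → [0,2] which is Hölder continuous with exponent log 2 / log γ, such that every continuous real function f on [0,1]^d is representable as f(x₁,…,x_d) = Σ_{q=0}^{m} g_q(Σ_{p=1}^{d} λ_p ψ(x_p + qa)) for some continuous functions g_q on [0, 2(γ−1)/(γ−2)] (depending on f). -/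
/-- Separation of cubes at scale `L` with gap proportion `σ`. -/
def SprSep (d : ℕ) (lam : Fin d → ℝ) (σ L : ℝ) (ψ : ℝ → ℝ) : Prop :=
  ∃ θ > 0, ∀ y z : Fin d → ℝ, (∀ p, y p ∈ Set.Icc (0:ℝ) 2) → (∀ p, z p ∈ Set.Icc (0:ℝ) 2) →
    (∀ p, Int.fract (y p / L) ≤ 1 - σ) → (∀ p, Int.fract (z p / L) ≤ 1 - σ) →
    (∃ p, ⌊y p / L⌋ ≠ ⌊z p / L⌋) → θ ≤ |∑ p, lam p * ψ (y p) - ∑ p, lam p * ψ (z p)|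

/-- Class of nice approximants. -/
def SprNice (α : ℝ) (φ : ℝ → ℝ) : Prop :=
  Monotone φ ∧ φ 0 = 0 ∧ (∃ Λ, 0 ≤ Λ ∧ ∀ x y, |φ x - φ y| ≤ Λ * |x - y|) ∧
  ∃ c < 1, 0 ≤ c ∧ ∀ x ∈ Set.Icc (0:ℝ) 2, ∀ y ∈ Set.Icc (0:ℝ) 2, |φ x - φ y| ≤ c * |x - y| ^ α

theorem spr_finite_gap {T : Type*} [Finite T] (f : T → ℝ) : ∃ θ > 0, ∀ t, f t ≠ 0 → θ ≤ |f t| := by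
  have hfin : (Set.range f \ {0}).Finite := (Set.finite_range f).subset Set.sdiff_subset
  have hopen : IsOpen (Set.range f \ {0})ᶜ := hfin.isClosed.isOpen_compl
  obtain ⟨θ, hθ, h⟩ := Metric.isOpen_iff.1 hopen 0 (by simp)
  refine ⟨θ, hθ, fun t ht => ?_⟩
  by_contra hlt
  push Not at hlt
  have := h (show f t ∈ Metric.ball 0 θ by simpa using hlt)
  exact this ⟨⟨t, rfl⟩, ht⟩

theorem spr_step (d : ℕ) (lam : Fin d → ℝ)
    (hind : ∀ c : Fin d → ℤ, ∑ p, lam p * (c p : ℝ) = 0 → ∀ p, c p = 0)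
    (σ : ℝ) (hσ0 : 0 < σ) (hσ1 : σ ≤ 1) (Λ : ℝ) (hΛ : 0 ≤ Λ) (φ : ℝ → ℝ)
    (hmono : Monotone φ) (hφ0 : φ 0 = 0) (hlip : ∀ x y, |φ x - φ y| ≤ Λ * |x - y|)
    (L : ℝ) (hL : 0 < L) (hL1 : L ≤ 1) :
    ∃ φ2 : ℝ → ℝ, Monotone φ2 ∧ φ2 0 = 0 ∧ (∀ x y, |φ2 x - φ2 y| ≤ ((Λ + 2) / σ) * |x - y|) ∧
      (∀ x ∈ Set.Icc (0:ℝ) 2, |φ2 x - φ x| ≤ (Λ + 1) * L) ∧ SprSep d lam σ L φ2 := by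
  obtain ⟨N, hN⟩ := exists_nat_ge (2 / L)
  obtain ⟨K, hK⟩ := exists_nat_ge ((N + 1) / L)
  have hKpos : (0:ℝ) < K := lt_of_lt_of_le (by positivity) hK
  have hKL : (N + 1 : ℝ) ≤ K * L := by rwa [div_le_iff₀ hL] at hK
  have hNL : 2 ≤ N * L := by rwa [div_le_iff₀ hL] at hN
  set w : ℕ → ℤ := fun n => ⌊K * φ (n * L)⌋ + n with hw
  set v : ℕ → ℝ := fun n => (w n : ℝ) / K with hv
  set C : ℝ := (Λ + 2) / σ with hC
  have hCσ : C * σ = Λ + 2 := by rw [hC]; field_simp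
  have hC0 : 0 ≤ C := by positivity
  have hCΛ : Λ + 2 ≤ C := by nlinarith
  have hup : ∀ n : ℕ, K * v n ≤ K * φ (n * L) + n := by
    intro n
    have := Int.floor_le (K * φ (n * L))
    simp only [hv, hw]; field_simp; push_cast; linarith
  have hlo : ∀ n : ℕ, K * φ (n * L) + n - 1 ≤ K * v n := by
    intro n
    have := Int.lt_floor_add_one (K * φ (n * L))
    simp only [hv, hw]; field_simp; push_cast; linarith
  have hwmono : StrictMono w := by
    apply strictMono_nat_of_lt_succ
    intro n
    have : ⌊K * φ (n * L)⌋ ≤ ⌊K * φ ((n+1 : ℕ) * L)⌋ := by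
      apply Int.floor_le_floor
      apply mul_le_mul_of_nonneg_left _ hKpos.le
      apply hmono; push_cast; nlinarith
    simp only [hw]; push_cast at *; omega
  have hvmono : Monotone v := fun i j hij => by
    simp only [hv]
    have : w i ≤ w j := hwmono.monotone hij
    have : (w i:ℝ) ≤ w j := by exact_mod_cast this
    gcongr
  have hv0 : v 0 = 0 := by simp [hv, hw, hφ0]
  have hup' : ∀ n ≤ N, v n ≤ φ (n * L) + L := by
    intro n hn
    have h1 := hup n
    have : (n:ℝ) ≤ N := by exact_mod_cast hn
    have : K * v n ≤ K * (φ (n*L) + L) := by linarith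
    exact le_of_mul_le_mul_left this hKpos
  have hlo' : ∀ n : ℕ, φ (n * L) - L ≤ v n := by
    intro n
    have h1 := hlo n
    have : (0:ℝ) ≤ n := by positivity
    have : (0:ℝ) ≤ N := by positivity
    have : K * (φ (n*L) - L) ≤ K * v n := by linarith
    exact le_of_mul_le_mul_left this hKpos
  have hinc : ∀ n k, n < k → v k - v n ≤ (k - n) * ((Λ + 2) * L) := by
    intro n k hnk
    have h1 := hup k
    have h2 := hlo n
    have h3 : φ (k*L) - φ (n*L) ≤ Λ * ((k - n) * L) := by
      have hnk' : (n:ℝ) ≤ k := by exact_mod_cast hnk.le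
      have := (le_abs_self _).trans (hlip (k*L) (n*L))
      rwa [← sub_mul, abs_of_nonneg (by apply mul_nonneg <;> linarith)] at this
    have h4 : (1:ℝ) ≤ k - n := by
      have : (n:ℝ) + 1 ≤ k := by exact_mod_cast hnk
      linarith
    have h5 : (1:ℝ) ≤ K * L := by have : (0:ℝ) ≤ N := by positivity
                                  linarith
    have : K * (v k - v n) ≤ K * ((k - n) * ((Λ + 2) * L)) := by
      have h6 : (K:ℝ) * (φ (k*L) - φ (n*L)) ≤ K * (Λ * ((k - n) * L)) :=
        mul_le_mul_of_nonneg_left h3 hKpos.le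
      have h7 : (k - n : ℝ) * 2 ≤ (k-n) * 2 * (K * L) := by
        apply le_mul_of_one_le_right _ h5; linarith
      nlinarith
    exact le_of_mul_le_mul_left this hKpos
  set V : ℕ → ℝ → ℝ := fun n x => v n - C * max 0 (n * L - x) with hV
  have hne : (Finset.range (N+1)).Nonempty := ⟨0, by simp⟩
  set φ2 : ℝ → ℝ := fun x => (Finset.range (N+1)).sup' hne (fun n => V n x) with hφ2
  have hle2 : ∀ n ≤ N, ∀ x, V n x ≤ φ2 x := fun n hn x =>
    Finset.le_sup' (fun n => V n x) (Finset.mem_range.2 (by omega))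
  have h2le : ∀ x A, (∀ n ≤ N, V n x ≤ A) → φ2 x ≤ A := fun x A h =>
    Finset.sup'_le _ _ fun n hn => h n (by have := Finset.mem_range.1 hn; omega)
  have hmono2 : Monotone φ2 := by
    intro x y hxy
    refine h2le _ _ fun n hn => le_trans ?_ (hle2 n hn y)
    simp only [hV]
    gcongr
  have hlip2 : ∀ x y, φ2 x ≤ φ2 y + C * |x - y| := by
    intro x y
    refine h2le _ _ fun n hn => ?_
    have h1 := hle2 n hn y
    have h2 : max 0 (n * L - y) ≤ max 0 (n * L - x) + |x - y| := by
      apply max_le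
      · positivity
      · have := le_max_right 0 (n * L - x)
        have := le_abs_self (x - y)
        linarith
    have h3 := mul_le_mul_of_nonneg_left h2 hC0
    simp only [hV] at *
    linarith
  have hfl : ∀ x ∈ Set.Icc (0:ℝ) 2, ∃ n : ℕ, (n:ℤ) = ⌊x / L⌋ ∧ n ≤ N ∧ (n:ℝ) * L ≤ x ∧
      x = (n + Int.fract (x/L)) * L := by
    intro x hx
    have h0 : 0 ≤ ⌊x/L⌋ := Int.floor_nonneg.2 (div_nonneg hx.1 hL.le)
    obtain ⟨n, hn⟩ := Int.eq_ofNat_of_zero_le h0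
    have hfe := Int.floor_add_fract (x/L)
    rw [hn] at hfe
    have hxe : x = (n + Int.fract (x/L)) * L := by
      push_cast at hfe; rw [hfe]; field_simp
    have hnx : (n:ℝ) * L ≤ x := by
      have := Int.fract_nonneg (x/L)
      rw [hxe]; nlinarith [mul_nonneg this hL.le]
    refine ⟨n, hn.symm, ?_, hnx, hxe⟩
    have : (n:ℝ) * L ≤ N * L := by linarith [hx.2]
    exact_mod_cast le_of_mul_le_mul_right this hL
  have hflat : ∀ x ∈ Set.Icc (0:ℝ) 2, Int.fract (x/L) ≤ 1 - σ → ∀ n : ℕ, (n:ℤ) = ⌊x/L⌋ →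
      φ2 x = v n := by
    intro x hx hfr n hn
    obtain ⟨n', hn', hN', hnx, hxe⟩ := hfl x hx
    have : n' = n := by omega
    subst this
    apply le_antisymm
    · refine h2le _ _ fun k hk => ?_
      by_cases hkn : k ≤ n'
      · have h1 := hvmono hkn
        have h2 : 0 ≤ C * max 0 (k * L - x) := by positivity
        simp only [hV]; linarith
      · push Not at hkn
        have h1 := hinc n' k hkn
        have h4 : (1:ℝ) ≤ k - n' := by
          have : (n':ℝ) + 1 ≤ k := by exact_mod_cast hkn
          linarith
        have h2 : (k - n') * (σ * L) ≤ max 0 (k * L - x) := by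
          refine le_trans ?_ (le_max_right _ _)
          have h5 : x ≤ (n' + (1 - σ)) * L := by
            rw [hxe]; gcongr
          have : 0 ≤ (k - n' - 1) * (1 - σ) * L := by
            apply mul_nonneg (mul_nonneg _ _) hL.le <;> linarith
          nlinarith
        have h3 := mul_le_mul_of_nonneg_left h2 hC0
        have h6 : C * ((k - n') * (σ * L)) = (k - n') * ((Λ+2) * L) := by rw [← hCσ]; ring
        simp only [hV]; linarith
    · have := hle2 n' hN' x
      simp only [hV] at this
      rw [max_eq_left (by linarith)] at this
      linarith
  refine ⟨φ2, hmono2, ?_, ?_, ?_, ?_⟩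
  · rw [hflat 0 (by simp) (by simpa using hσ1) 0 (by simp), hv0]
  · intro x y
    rw [abs_le]
    have h1 := hlip2 x y
    have h2 := hlip2 y x
    rw [abs_sub_comm] at h2
    constructor <;> linarith
  · intro x hx
    obtain ⟨n, hn, hnN, hnx, hxe⟩ := hfl x hx
    rw [abs_le]
    constructor
    · have h1 := hle2 n hnN x
      simp only [hV] at h1
      rw [max_eq_left (by linarith)] at h1
      have h2 := hlo' n
      have h3 := (le_abs_self _).trans (hlip x (n*L))
      rw [abs_of_nonneg (by linarith)] at h3
      have h4 : x - n * L ≤ L := by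
        have := Int.fract_lt_one (x/L)
        have : Int.fract (x/L) * L ≤ 1 * L := by gcongr
        nlinarith
      have := mul_le_mul_of_nonneg_left h4 hΛ
      linarith
    · have : φ2 x ≤ φ x + L := by
        refine h2le _ _ fun k hk => ?_
        have h1 := hup' k hk
        simp only [hV]
        have h2 : φ (k * L) ≤ φ x + Λ * max 0 (k*L - x) := by
          rcases le_total (k*L) x with h | h
          · have := hmono h
            have : 0 ≤ Λ * max 0 (k*L - x) := by positivity
            linarith
          · have := (le_abs_self _).trans (hlip (k*L) x)
            rw [abs_of_nonneg (by linarith)] at this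
            rw [max_eq_right (by linarith)]; linarith
        have h3 : Λ * max 0 (k*L - x) ≤ C * max 0 (k*L - x) := by gcongr; linarith
        linarith
      nlinarith
  · obtain ⟨θ, hθ, hgap⟩ := spr_finite_gap
      (fun ij : (Fin d → Fin (N+1)) × (Fin d → Fin (N+1)) =>
        ∑ p, lam p * v (ij.1 p) - ∑ p, lam p * v (ij.2 p))
    refine ⟨θ, hθ, ?_⟩
    rintro y z hy hz hfy hfz ⟨p0, hp0⟩
    choose i hi hiN _ _ using fun p => hfl (y p) (hy p)
    choose j hj hjN _ _ using fun p => hfl (z p) (hz p)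
    have e1 : ∀ p, φ2 (y p) = v (i p) := fun p => hflat _ (hy p) (hfy p) _ (hi p)
    have e2 : ∀ p, φ2 (z p) = v (j p) := fun p => hflat _ (hz p) (hfz p) _ (hj p)
    simp only [e1, e2]
    refine hgap (fun p => ⟨i p, by have := hiN p; omega⟩, fun p => ⟨j p, by have := hjN p; omega⟩) ?_
    simp only
    intro h0
    have h1 : ∑ p, lam p * ((w (i p) - w (j p) : ℤ) : ℝ) = 0 := by
      have : ∑ p, lam p * ((w (i p) - w (j p) : ℤ) : ℝ) =
          K * (∑ p, lam p * v (i p) - ∑ p, lam p * v (j p)) := by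
        rw [← Finset.sum_sub_distrib, Finset.mul_sum]
        refine Finset.sum_congr rfl fun p _ => ?_
        simp only [hv]; push_cast; field_simp
      rw [this, h0, mul_zero]
    have h2 := hind _ h1 p0
    have h3 : i p0 = j p0 := hwmono.injective (by omega)
    apply hp0
    rw [← hi, ← hj, h3]

theorem spr_step_nice (d : ℕ) (lam : Fin d → ℝ)
    (hind : ∀ c : Fin d → ℤ, ∑ p, lam p * (c p : ℝ) = 0 → ∀ p, c p = 0)
    (σ : ℝ) (hσ0 : 0 < σ) (hσ1 : σ ≤ 1) (α : ℝ) (hα0 : 0 < α) (hα1 : α < 1) (φ : ℝ → ℝ)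
    (hφ : SprNice α φ) (ε : ℝ) (hε : 0 < ε) :
    ∃ δ > 0, ∀ L, 0 < L → L < δ → ∃ φ2 : ℝ → ℝ, SprNice α φ2 ∧
      (∀ x ∈ Set.Icc (0:ℝ) 2, |φ2 x - φ x| ≤ ε) ∧ SprSep d lam σ L φ2 := by
  obtain ⟨hmono, hφ0, ⟨Λ, hΛ, hlip⟩, c, hc1, hc0, hhol⟩ := hφ
  set C : ℝ := (Λ + 2) / σ with hC
  have hC0 : 0 < C := by positivity
  set c' : ℝ := (c + 1) / 2 with hc'
  have hc'0 : 0 < c' := by rw [hc']; linarith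
  have hcc' : 0 < c' - c := by rw [hc']; linarith
  set η : ℝ := (c' / C) ^ (1 / (1 - α)) with hη
  have hη0 : 0 < η := by positivity
  have hηp : η ^ (1 - α) = c' / C := by
    rw [hη, ← Real.rpow_mul (by positivity), one_div_mul_cancel (by linarith), Real.rpow_one]
  refine ⟨min 1 (min (ε / (Λ + 1)) ((c' - c) * η ^ α / (2 * (Λ + 1)))), by positivity, ?_⟩
  intro L hL hLδ
  rw [lt_min_iff, lt_min_iff, lt_div_iff₀ (by positivity), lt_div_iff₀ (by positivity)] at hLδ
  obtain ⟨hL1, hL2, hL3⟩ := hLδ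
  obtain ⟨φ2, m2, z2, l2, a2, s2⟩ := spr_step d lam hind σ hσ0 hσ1 Λ hΛ φ hmono hφ0 hlip L hL hL1.le
  refine ⟨φ2, ⟨m2, z2, ⟨C, hC0.le, l2⟩, c', by rw [hc']; linarith, hc'0.le, ?_⟩, ?_, s2⟩
  · intro x hx y hy
    rcases le_total (|x - y|) η with h | h
    · refine (l2 x y).trans ?_
      have hsplit : |x - y| = |x - y| ^ (1 - α) * |x - y| ^ α := by
        rcases eq_or_lt_of_le (abs_nonneg (x - y)) with h0 | h0
        · rw [← h0, Real.zero_rpow hα0.ne', mul_zero]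
        · rw [← Real.rpow_add h0]; simp
      have h1 : |x - y| ^ (1 - α) ≤ c' / C := by
        rw [← hηp]; exact Real.rpow_le_rpow (abs_nonneg _) h (by linarith)
      calc C * |x - y| = C * |x - y| ^ (1 - α) * |x - y| ^ α := by
            rw [mul_assoc, ← hsplit]
        _ ≤ C * (c' / C) * |x - y| ^ α := by gcongr
        _ = c' * |x - y| ^ α := by field_simp
    · have h1 := a2 x hx
      have h2 := a2 y hy
      have h3 := hhol x hx y hy
      have h4 : η ^ α ≤ |x - y| ^ α := Real.rpow_le_rpow hη0.le h hα0.le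
      have h5 := mul_le_mul_of_nonneg_left h4 hcc'.le
      have h6 : |φ2 x - φ2 y| ≤ |φ2 x - φ x| + |φ x - φ y| + |φ2 y - φ y| := by
        have := abs_sub_le (φ2 x) (φ x) (φ2 y)
        have := abs_sub_le (φ x) (φ y) (φ2 y)
        rw [abs_sub_comm (φ y) (φ2 y)] at this
        linarith
      nlinarith
  · intro x hx
    refine (a2 x hx).trans ?_
    linarith

theorem spr_sep_congr (d : ℕ) (lam : Fin d → ℝ) (σ L : ℝ) (ψ φ : ℝ → ℝ)
    (h : ∀ x ∈ Set.Icc (0:ℝ) 2, ψ x = φ x) (hs : SprSep d lam σ L ψ) : SprSep d lam σ L φ := by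
  obtain ⟨θ, hθ, H⟩ := hs
  refine ⟨θ, hθ, fun y z hy hz h1 h2 h3 => ?_⟩
  have := H y z hy hz h1 h2 h3
  simpa only [h _ (hy _), h _ (hz _)] using this

theorem spr_sep_open (d : ℕ) (lam : Fin d → ℝ) (σ L : ℝ) (ψ : ℝ → ℝ)
    (hs : SprSep d lam σ L ψ) : ∃ ε > 0, ∀ φ : ℝ → ℝ,
      (∀ x ∈ Set.Icc (0:ℝ) 2, |φ x - ψ x| ≤ ε) → SprSep d lam σ L φ := by
  obtain ⟨θ, hθ, H⟩ := hs
  set A : ℝ := ∑ p, |lam p| with hA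
  have hA0 : 0 ≤ A := Finset.sum_nonneg fun _ _ => abs_nonneg _
  refine ⟨θ / (4 * (A + 1)), by positivity, fun φ hφ => ⟨θ / 2, by positivity, ?_⟩⟩
  intro y z hy hz h1 h2 h3
  have h4 := H y z hy hz h1 h2 h3
  have key : ∀ y : Fin d → ℝ, (∀ p, y p ∈ Set.Icc (0:ℝ) 2) →
      |∑ p, lam p * φ (y p) - ∑ p, lam p * ψ (y p)| ≤ θ / 4 := by
    intro y hy
    rw [← Finset.sum_sub_distrib]
    calc |∑ p, (lam p * φ (y p) - lam p * ψ (y p))| ≤ ∑ p, |lam p| * (θ / (4 * (A + 1))) := by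
          refine (Finset.abs_sum_le_sum_abs _ _).trans (Finset.sum_le_sum fun p _ => ?_)
          rw [← mul_sub, abs_mul]
          exact mul_le_mul_of_nonneg_left (hφ _ (hy p)) (abs_nonneg _)
      _ = A * (θ / (4 * (A + 1))) := by rw [hA, Finset.sum_mul]
      _ ≤ (A + 1) * (θ / (4 * (A + 1))) := by gcongr; linarith
      _ = θ / 4 := by field_simp
  have k1 := abs_le.1 (key y hy)
  have k2 := abs_le.1 (key z hz)
  rcases le_abs'.1 h4 with h | h
  · exact le_abs'.2 (Or.inl (by linarith))
  · exact le_abs'.2 (Or.inr (by linarith))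

theorem spr_baire (d : ℕ) (lam : Fin d → ℝ)
    (hind : ∀ c : Fin d → ℤ, ∑ p, lam p * (c p : ℝ) = 0 → ∀ p, c p = 0)
    (σ : ℝ) (hσ0 : 0 < σ) (hσ1 : σ ≤ 1) (α : ℝ) (hα0 : 0 < α) (hα1 : α < 1)
    (Ls : ℕ → ℝ) (hLs : ∀ k, 0 < Ls k) (hLt : Filter.Tendsto Ls Filter.atTop (nhds 0)) :
    ∃ ψ : ℝ → ℝ, Continuous ψ ∧ MonotoneOn ψ (Set.Icc 0 2) ∧ ψ 0 = 0 ∧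
      (∀ x ∈ Set.Icc (0:ℝ) 2, ∀ y ∈ Set.Icc (0:ℝ) 2, |ψ x - ψ y| ≤ |x - y| ^ α) ∧
      ∀ k, ∃ j ≥ k, SprSep d lam σ (Ls j) ψ := by
  have h02 : (0:ℝ) ≤ 2 := by norm_num
  let I := Set.Icc (0:ℝ) 2
  let ext : C(I, ℝ) → ℝ → ℝ := fun F => Set.IccExtend h02 F
  have hext : ∀ F : C(I, ℝ), ∀ x (hx : x ∈ I), ext F x = F ⟨x, hx⟩ := fun F x hx =>
    Set.IccExtend_of_mem h02 F hx
  let X0 : Set C(I, ℝ) := {F | ∃ φ, SprNice α φ ∧ ∀ x : I, F x = φ x}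
  let Z := closure X0
  have : CompleteSpace Z := isClosed_closure.completeSpace_coe
  have hofφ : ∀ φ, SprNice α φ → ∃ F ∈ X0, ∀ x : I, F x = φ x := by
    intro φ hφ
    obtain ⟨Λ, hΛ, hlip⟩ := hφ.2.2.1
    have hcont : Continuous φ := by
      have : LipschitzWith ⟨Λ, hΛ⟩ φ := LipschitzWith.of_dist_le_mul fun x y => by
        rw [Real.dist_eq, Real.dist_eq]
        exact hlip x y
      exact this.continuous
    exact ⟨⟨fun x => φ x, by fun_prop⟩, ⟨φ, hφ, fun x => rfl⟩, fun x => rfl⟩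
  have hnice0 : SprNice α (fun _ => 0) := by
    refine ⟨monotone_const, rfl, ⟨0, le_rfl, by simp⟩, 0, by norm_num, le_rfl, by simp⟩
  obtain ⟨F00, hF00, _⟩ := hofφ _ hnice0
  have : Nonempty Z := ⟨⟨F00, subset_closure hF00⟩⟩
  let U : ℕ → Set Z := fun k => {F | ∃ j ≥ k, SprSep d lam σ (Ls j) (ext F.1)}
  have hUo : ∀ k, IsOpen (U k) := by
    intro k
    rw [Metric.isOpen_iff]
    rintro F ⟨j, hj, hs⟩
    obtain ⟨ε, hε, H⟩ := spr_sep_open d lam σ _ _ hs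
    refine ⟨ε, hε, fun G hG => ⟨j, hj, H _ fun x hx => ?_⟩⟩
    rw [hext _ x hx, hext _ x hx, ← Real.dist_eq]
    exact (ContinuousMap.dist_apply_le_dist _).trans (Metric.mem_ball.1 hG).le
  have hUd : ∀ k, Dense (U k) := by
    intro k
    rw [Metric.dense_iff]
    rintro ⟨F, hF⟩ ε hε
    obtain ⟨F0, ⟨φ, hφ, hFφ⟩, hd⟩ := Metric.mem_closure_iff.1 hF (ε/2) (by positivity)
    obtain ⟨δ, hδ, H⟩ := spr_step_nice d lam hind σ hσ0 hσ1 α hα0 hα1 φ hφ (ε/4) (by positivity)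
    obtain ⟨j, hjk, hjδ⟩ := ((Filter.eventually_ge_atTop k).and (hLt.eventually_lt_const hδ)).exists
    obtain ⟨φ2, hn2, ha2, hs2⟩ := H (Ls j) (hLs j) hjδ
    obtain ⟨F2, hF2, he2⟩ := hofφ φ2 hn2
    refine ⟨⟨F2, subset_closure hF2⟩, ?_, j, hjk, ?_⟩
    · rw [Metric.mem_ball]
      show dist F2 F < ε
      have h1 : dist F2 F0 ≤ ε/4 := by
        rw [ContinuousMap.dist_le (by positivity)]
        intro x
        rw [he2, hFφ, Real.dist_eq]
        exact ha2 x x.2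
      have := dist_triangle F2 F0 F
      rw [dist_comm F0 F] at this
      linarith
    · refine spr_sep_congr d lam σ _ φ2 _ (fun x hx => ?_) hs2
      rw [hext _ x hx, he2]
  obtain ⟨F, hF⟩ := (dense_iInter_of_isOpen_nat hUo hUd).nonempty
  rw [Set.mem_iInter] at hF
  have hclosed : ∀ P : C(I, ℝ) → Prop, IsClosed {G | P G} → (∀ G ∈ X0, P G) → P F.1 :=
    fun P hP h => closure_minimal h hP F.2
  have hev : ∀ x : I, Continuous (fun G : C(I, ℝ) => G x) := fun x => continuous_eval_const x
  refine ⟨ext F.1, F.1.continuous.Icc_extend', ?_, ?_, ?_, hF⟩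
  · intro x hx y hy hxy
    rw [hext _ x hx, hext _ y hy]
    refine hclosed (fun G => G ⟨x, hx⟩ ≤ G ⟨y, hy⟩) (isClosed_le (hev _) (hev _)) ?_
    rintro G ⟨φ, hφ, hG⟩
    simp only [hG]
    exact hφ.1 hxy
  · rw [hext _ 0 (by simp [I])]
    refine hclosed (fun G => G ⟨0, _⟩ = 0) (isClosed_eq (hev _) continuous_const) ?_
    rintro G ⟨φ, hφ, hG⟩
    simp only [hG]
    exact hφ.2.1
  · intro x hx y hy
    rw [hext _ x hx, hext _ y hy]
    refine hclosed (fun G => |G ⟨x, hx⟩ - G ⟨y, hy⟩| ≤ |x - y| ^ α)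
      (isClosed_le ((hev _).sub (hev _)).abs continuous_const) ?_
    rintro G ⟨φ, hφ, hG⟩
    simp only [hG]
    obtain ⟨c, hc1, hc0, hh⟩ := hφ.2.2.2
    refine (hh x hx y hy).trans ?_
    have : 0 ≤ |x - y| ^ α := by positivity
    nlinarith

theorem spr_tail_bound (γ : ℕ) (hγ : 2 ≤ γ) (b : ℕ → ℕ) (hb : ∀ r, b r + 1 ≤ b (r+1)) (u : ℕ → ℝ)
    (hu0 : ∀ r, 0 ≤ u r) (hu : ∀ r, u r ≤ ((γ:ℝ)⁻¹)^(b r)) (R : ℕ) :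
    Summable (fun r => u (r + R)) ∧ |∑' r, u (r + R)| ≤ 2 * ((γ:ℝ)⁻¹)^(b R) := by
  have hγ' : (2:ℝ) ≤ γ := by exact_mod_cast hγ
  have hi : (γ:ℝ)⁻¹ ≤ 2⁻¹ := inv_anti₀ (by norm_num) hγ'
  have hi0 : 0 ≤ (γ:ℝ)⁻¹ := by positivity
  have hbr : ∀ r, b R + r ≤ b (r + R) := by
    intro r
    induction r with
    | zero => simp
    | succ k ih =>
      have := hb (k + R)
      have e : k + 1 + R = k + R + 1 := by ring
      rw [e]; omega
  have key : ∀ r, u (r + R) ≤ ((γ:ℝ)⁻¹)^(b R) * (1/2)^r := by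
    intro r
    calc u (r + R) ≤ ((γ:ℝ)⁻¹)^(b (r + R)) := hu _
      _ ≤ ((γ:ℝ)⁻¹)^(b R + r) := pow_le_pow_of_le_one hi0 (by linarith) (hbr r)
      _ = ((γ:ℝ)⁻¹)^(b R) * ((γ:ℝ)⁻¹)^r := pow_add _ _ _
      _ ≤ _ := by
        gcongr
        simpa using hi
  have hs : HasSum (fun r : ℕ => ((γ:ℝ)⁻¹)^(b R) * (1/2:ℝ)^r) (((γ:ℝ)⁻¹)^(b R) * 2) :=
    hasSum_geometric_two.mul_left _
  have hsum : Summable (fun r => u (r + R)) :=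
    Summable.of_nonneg_of_le (fun r => hu0 _) key hs.summable
  refine ⟨hsum, ?_⟩
  rw [abs_of_nonneg (tsum_nonneg fun r => hu0 _)]
  have := hsum.tsum_le_tsum key hs.summable
  rw [hs.tsum_eq] at this
  linarith

theorem spr_indep (d γ : ℕ) (hd : 2 ≤ d) (hγ : 2 ≤ γ)
    (lam : Fin d → ℝ)
    (hlam1 : ∀ p : Fin d, p.val = 0 → lam p = 1)
    (hlamp : ∀ p : Fin d, 1 ≤ p.val →
      lam p = ∑' r : ℕ,
        (γ : ℝ) ^ (-(((p.val * ((d ^ (r + 1) - 1) / (d - 1))) : ℕ) : ℤ)))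
    (c : Fin d → ℤ) (hc : ∑ p, lam p * (c p : ℝ) = 0) : ∀ p, c p = 0 := by
  have hγ' : (2:ℝ) ≤ γ := by exact_mod_cast hγ
  set b : ℕ → ℕ := fun r => (d ^ (r + 1) - 1) / (d - 1) with hbdef
  have hbs : ∀ r, b r = ∑ k ∈ Finset.range (r+1), d^k := fun r => (Nat.geomSum_eq hd _).symm
  have hb1 : ∀ r, b (r+1) = d * b r + 1 := by
    intro r
    rw [hbs, hbs, geom_sum_succ]
  have hbi : ∀ r, b r + 1 ≤ b (r+1) := by
    intro r; rw [hb1]; nlinarith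
  have hbr : ∀ r, r ≤ b r := by
    intro r
    induction r with
    | zero => simp
    | succ k ih => have := hbi k; omega
  set t : ℝ := (γ:ℝ)⁻¹ with ht
  have ht0 : 0 < t := by positivity
  have ht1 : t ≤ 2⁻¹ := inv_anti₀ (by norm_num) hγ'
  have hgt : (γ:ℝ) * t = 1 := mul_inv_cancel₀ (by positivity)
  set u : Fin d → ℕ → ℝ := fun p r => if p.val = 0 then 0 else (t^(b r))^p.val with hudef
  set e : Fin d → ℤ := fun p => if p.val = 0 then 1 else 0 with hedef
  have hu0 : ∀ p r, 0 ≤ u p r := by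
    intro p r; simp only [hudef]; split_ifs <;> positivity
  have hu1 : ∀ p r, u p r ≤ t^(b r) := by
    intro p r; simp only [hudef]; split_ifs with h
    · positivity
    · exact pow_le_of_le_one (by positivity) (pow_le_one₀ ht0.le (by linarith)) h
  have hlam : ∀ p, lam p = e p + ∑' r, u p r := by
    intro p
    by_cases h : p.val = 0
    · simp [hlam1 p h, hedef, hudef, h]
    · rw [hlamp p (by omega)]
      simp only [hedef, hudef, h, if_false, Int.cast_zero, zero_add]
      congr 1
      funext r
      rw [zpow_neg, zpow_natCast, ← pow_mul, ht, inv_pow, mul_comm]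
  have htail := fun p R => spr_tail_bound γ hγ b hbi (u p) (hu0 p) (hu1 p) R
  have hsplit : ∀ p R, lam p = e p + ∑ r ∈ Finset.range R, u p r + ∑' r, u p (r + R) := by
    intro p R
    rw [hlam p, add_assoc, (by simpa using (htail p 0).1 : Summable (u p)).sum_add_tsum_nat_add R]
  set T : ℕ → ℝ := fun R => ∑ p, (c p : ℝ) * ∑' r, u p (r + R) with hT
  set C : ℝ := ∑ p, |(c p : ℝ)| with hC
  have hC0 : 0 ≤ C := Finset.sum_nonneg fun _ _ => abs_nonneg _
  have hTb : ∀ R, |T R| ≤ C * (2 * t^(b R)) := by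
    intro R
    simp only [hT, hC, Finset.sum_mul]
    refine (Finset.abs_sum_le_sum_abs _ _).trans (Finset.sum_le_sum fun p _ => ?_)
    rw [abs_mul]
    exact mul_le_mul_of_nonneg_left (htail p R).2 (abs_nonneg _)
  have hTint : ∀ R, ∃ z : ℤ, (γ:ℝ)^((d-1) * b R) * T (R+1) = z := by
    intro R
    refine ⟨-∑ p, c p * (γ^((d-1) * b R) * e p + ∑ r ∈ Finset.range (R+1),
      if p.val = 0 then 0 else (γ:ℤ)^((d-1) * b R - p.val * b r)), ?_⟩
    have h1 : ∑ p, (c p : ℝ) * (e p + ∑ r ∈ Finset.range (R+1), u p r) + T (R+1) = 0 := by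
      rw [← hc, hT, ← Finset.sum_add_distrib]
      refine Finset.sum_congr rfl fun p _ => ?_
      rw [hsplit p (R+1)]; ring
    have h2 : T (R+1) = - ∑ p, (c p : ℝ) * (e p + ∑ r ∈ Finset.range (R+1), u p r) := by linarith
    rw [h2]
    push_cast
    rw [mul_neg, Finset.mul_sum]
    congr 1
    refine Finset.sum_congr rfl fun p _ => ?_
    rw [mul_left_comm, mul_add, Finset.mul_sum]
    congr 2
    refine Finset.sum_congr rfl fun r hr => ?_
    simp only [hudef]
    split_ifs with h
    · simp
    · push_cast
      have hle : p.val * b r ≤ (d-1) * b R := by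
        apply Nat.mul_le_mul
        · have := p.isLt; omega
        · have hmono : Monotone b := monotone_nat_of_le_succ fun n => by have := hbi n; omega
          exact hmono (by have := Finset.mem_range.1 hr; omega)
      obtain ⟨k, hk⟩ := Nat.exists_eq_add_of_le hle
      rw [hk, Nat.add_sub_cancel_left, ← pow_mul, pow_add, mul_comm (b r), mul_right_comm, ← mul_pow, hgt, one_pow, one_mul]
  obtain ⟨R0, hR0⟩ : ∃ R0 : ℕ, ∀ R, R0 ≤ R → C * 2 * t^R < 1 := by
    have : Filter.Tendsto (fun R : ℕ => C * 2 * t^R) Filter.atTop (nhds (C*2*0)) :=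
      (tendsto_pow_atTop_nhds_zero_of_lt_one ht0.le (by linarith)).const_mul _
    rw [mul_zero] at this
    exact Filter.eventually_atTop.1 (this.eventually_lt_const (by norm_num))
  have hT0 : ∀ R, R0 ≤ R → T (R+1) = 0 := by
    intro R hR
    obtain ⟨z, hz⟩ := hTint R
    have h1 : |(z:ℝ)| < 1 := by
      rw [← hz, abs_mul, abs_of_nonneg (by positivity)]
      calc (γ:ℝ)^((d-1) * b R) * |T (R+1)| ≤ (γ:ℝ)^((d-1) * b R) * (C * (2 * t^(b (R+1)))) := by
            gcongr; exact hTb _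
        _ = C * 2 * t^(b R + 1) := by
            have : b (R+1) = (d-1) * b R + (b R + 1) := by
              rw [hb1]; obtain ⟨k, rfl⟩ := Nat.exists_eq_add_of_le hd
              have : 2 + k - 1 = k + 1 := by omega
              rw [this]; ring
            rw [this, pow_add]
            have h3 : (γ:ℝ)^((d-1) * b R) * t^((d-1) * b R) = 1 := by rw [← mul_pow, hgt, one_pow]
            linear_combination (C * 2 * t^(b R + 1)) * h3
        _ ≤ C * 2 * t^R := by
            gcongr C * 2 * ?_
            exact pow_le_pow_of_le_one ht0.le (by linarith) (by have := hbr R; omega)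
        _ < 1 := hR0 R hR
    have h2 : z = 0 := by
      have : |z| < 1 := by exact_mod_cast h1
      exact Int.abs_lt_one_iff.1 this
    rw [h2, Int.cast_zero] at hz
    exact (mul_eq_zero.1 hz).resolve_left (by positivity)
  have hpoly : ∀ R, R0 ≤ R → ∑ p, (c p : ℝ) * u p (R+1) = 0 := by
    intro R hR
    have h1 := hT0 R hR
    have h2 := hT0 (R+1) (by omega)
    have h3 : T (R+1) = ∑ p, (c p : ℝ) * u p (R+1) + T (R+1+1) := by
      rw [hT, ← Finset.sum_add_distrib]
      refine Finset.sum_congr rfl fun p _ => ?_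
      rw [(htail p (R+1)).1.tsum_eq_zero_add, ← mul_add]
      congr 2
      · simp
      · congr 1; funext r; congr 1; ring
    linarith
  -- polynomial
  set P : Polynomial ℝ := ∑ p : Fin d, Polynomial.monomial p.val (if p.val = 0 then 0 else (c p : ℝ)) with hP
  have hP0 : P = 0 := by
    apply Polynomial.eq_zero_of_infinite_isRoot
    have hinj : Function.Injective (fun R : ℕ => t^(b (R0 + R + 1))) := by
      intro i j hij
      have h1 := pow_right_injective₀ ht0 (by linarith : t ≠ 1) hij
      have hmono : StrictMono b := strictMono_nat_of_lt_succ fun n => by have := hbi n; omega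
      have := hmono.injective h1
      omega
    refine (Set.infinite_range_of_injective hinj).mono ?_
    rintro _ ⟨R, rfl⟩
    show P.eval _ = 0
    rw [hP, Polynomial.eval_finsetSum]
    refine Eq.trans ?_ (hpoly (R0 + R) (by omega))
    refine Finset.sum_congr rfl fun p _ => ?_
    simp only [Polynomial.eval_monomial, hudef]
    split_ifs <;> simp
  have hcp : ∀ p : Fin d, p.val ≠ 0 → c p = 0 := by
    intro p hp
    have h1 : P.coeff p.val = 0 := by rw [hP0]; simp
    rw [hP, Polynomial.finsetSum_coeff, Finset.sum_eq_single p] at h1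
    · simpa [Polynomial.coeff_monomial, hp] using h1
    · intro q _ hq
      rw [Polynomial.coeff_monomial, if_neg]
      exact fun h => hq (Fin.ext h)
    · simp
  intro p
  by_cases hp : p.val = 0
  · rw [Finset.sum_eq_single p] at hc
    · rw [hlam1 p hp] at hc; simpa using hc
    · intro q _ hq
      rw [hcp q]; · simp
      intro h; exact hq (Fin.ext (by omega))
    · simp
  · exact hcp p hp

theorem spr_ext {X I : Type*} (S : Set X) (F : X → ℝ) (Ψ : X → ℝ) (ι : X → I) (θ : ℝ) (hθ : 0 < θ)
    (hsep : ∀ x ∈ S, ∀ y ∈ S, ι x ≠ ι y → θ ≤ |Ψ x - Ψ y|) (B : ℝ) (hB0 : 0 ≤ B)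
    (hB : ∀ x, |F x| ≤ B) (ω : ℝ) (hω : ∀ x ∈ S, ∀ y ∈ S, ι x = ι y → |F x - F y| ≤ ω) :
    ∃ g : BoundedContinuousFunction ℝ ℝ, (∀ t, |g t| ≤ B) ∧ ∀ x ∈ S, |g (Ψ x) - F x| ≤ ω := by
  classical
  rcases S.eq_empty_or_nonempty with hS | ⟨x0, hx0⟩
  · exact ⟨0, by simpa using hB0, by simp [hS]⟩
  have hrep : ∀ i : I, ∃ x : X, (∃ y ∈ S, ι y = i) → x ∈ S ∧ ι x = i := by
    intro i
    by_cases h : ∃ y ∈ S, ι y = i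
    · obtain ⟨y, hy⟩ := h
      exact ⟨y, fun _ => hy⟩
    · exact ⟨x0, fun h' => absurd h' h⟩
  choose rep hrep using hrep
  have hpre : ∀ t : ℝ, ∃ x : X, t ∈ Ψ '' S → x ∈ S ∧ Ψ x = t := by
    intro t
    by_cases h : t ∈ Ψ '' S
    · obtain ⟨y, hy⟩ := h
      exact ⟨y, fun _ => hy⟩
    · exact ⟨x0, fun h' => absurd h' h⟩
  choose pre hpre using hpre
  set h : ℝ → ℝ := fun t => F (rep (ι (pre t))) with hh
  have hlip : LipschitzOnWith ⟨2 * B / θ, by positivity⟩ h (Ψ '' S) := by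
    refine LipschitzOnWith.of_dist_le_mul ?_
    intro t ht s hs
    obtain ⟨h1, h2⟩ := hpre t ht
    obtain ⟨h3, h4⟩ := hpre s hs
    rw [Real.dist_eq, Real.dist_eq]
    show _ ≤ 2 * B / θ * |t - s|
    by_cases he : ι (pre t) = ι (pre s)
    · simp only [hh, he, sub_self, abs_zero]; positivity
    · have := hsep _ h1 _ h3 he
      rw [h2, h4] at this
      have h5 := abs_sub (F (rep (ι (pre t)))) (F (rep (ι (pre s))))
      have h6 := hB (rep (ι (pre t)))
      have h7 := hB (rep (ι (pre s)))
      calc |h t - h s| ≤ 2 * B := by simp only [hh]; linarith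
        _ = 2 * B / θ * θ := by field_simp
        _ ≤ _ := by gcongr
  obtain ⟨k, hk, hkh⟩ := hlip.extend_real
  have hbd : ∀ t, |max (-B) (min B (k t))| ≤ B := fun t =>
    abs_le.2 ⟨le_max_left _ _, max_le (by linarith) (min_le_left _ _)⟩
  refine ⟨BoundedContinuousFunction.ofNormedAddCommGroup (fun t => max (-B) (min B (k t)))
    (continuous_const.max (continuous_const.min hk.continuous)) B hbd, hbd, ?_⟩
  intro x hx
  show |max (-B) (min B (k (Ψ x))) - F x| ≤ ω
  have hmem : Ψ x ∈ Ψ '' S := ⟨x, hx, rfl⟩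
  rw [← hkh hmem]
  have h1 := abs_le.1 (hB (rep (ι (pre (Ψ x)))))
  simp only [hh]
  rw [min_eq_right h1.2, max_eq_right h1.1]
  obtain ⟨h2, h3⟩ := hpre _ hmem
  have hι : ι (pre (Ψ x)) = ι x := by
    by_contra hne
    have := hsep _ h2 _ hx hne
    rw [h3, sub_self, abs_zero] at this
    linarith
  rw [hι]
  obtain ⟨h4, h5⟩ := hrep (ι x) ⟨x, hx, rfl⟩
  exact hω _ h4 _ hx h5

/-- at most one shift is bad. -/
theorem spr_one_bad (n M : ℕ) (hn : 0 < n) (u : ℝ) (i j : ℕ) (hi : i < n) (hij : j < i)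
    (h1 : 1 - 1 / (n:ℝ) < Int.fract (u + i * (M + 1 / n)))
    (h2 : 1 - 1 / (n:ℝ) < Int.fract (u + j * (M + 1 / n))) : False := by
  have hn' : (0:ℝ) < n := by exact_mod_cast hn
  have e1 := Int.floor_add_fract (u + i * (M + 1 / (n:ℝ)))
  have e2 := Int.floor_add_fract (u + j * (M + 1 / (n:ℝ)))
  have f1 := Int.fract_lt_one (u + i * (M + 1 / (n:ℝ)))
  have f2 := Int.fract_lt_one (u + j * (M + 1 / (n:ℝ)))
  set A := ⌊u + i * (M + 1 / (n:ℝ))⌋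
  set B := ⌊u + j * (M + 1 / (n:ℝ))⌋
  set a := Int.fract (u + i * (M + 1 / (n:ℝ)))
  set b := Int.fract (u + j * (M + 1 / (n:ℝ)))
  obtain ⟨Z, hZ⟩ : ∃ Z : ℤ, Z = (i - j) * M - A + B := ⟨_, rfl⟩
  have hZ' : (Z:ℝ) = (i - j) * M - A + B := by rw [hZ]; push_cast; ring
  have e3 : (Z:ℝ) * n + (i - j) = (a - b) * n := by
    rw [hZ']
    have : a - b = (i - j) * (M + 1 / (n:ℝ)) - A + B := by linarith
    rw [this]; field_simp; ring
  have hinv : 1 / (n:ℝ) * n = 1 := by field_simp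
  have g1 : (a - b) * n < 1 := by
    have : a - b < 1 / n := by linarith
    calc (a-b) * n < 1 / n * n := by gcongr
      _ = 1 := hinv
  have g2 : -1 < (a - b) * n := by
    have : -(1 / (n:ℝ)) < a - b := by linarith
    calc (-1:ℝ) = -(1/n) * n := by rw [neg_mul, hinv]
      _ < _ := by gcongr
  rw [← e3] at g1 g2
  have g1' : Z * n + ((i:ℤ) - j) < 1 := by exact_mod_cast g1
  have g2' : -1 < Z * n + ((i:ℤ) - j) := by exact_mod_cast g2
  have g3 : Z * n = (j:ℤ) - i := by omega
  rcases lt_trichotomy Z 0 with h | h | h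
  · have : Z * n ≤ -1 * n := by gcongr; omega
    omega
  · rw [h] at g3; omega
  · have : 0 ≤ Z * n := by positivity
    omega

theorem spr_approx (d n : ℕ) (hn : 0 < n) (lam : Fin d → ℝ) (ψ : ℝ → ℝ)
    (a : ℝ) (ha : 0 < a)
    (hrange : ∀ q : Fin n, ∀ x ∈ Set.Icc (0:ℝ) 1, x + (q.val:ℝ) * a ∈ Set.Icc (0:ℝ) 2)
    (hsep : ∀ k : ℕ, ∃ j ≥ k, SprSep d lam (1 / (n : ℝ)) (a / (j + 1 / (n : ℝ))) ψ)
    (Ψ : Fin n → C(Fin d → Set.Icc (0:ℝ) 1, ℝ))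
    (hΨ : ∀ q x, Ψ q x = ∑ p, lam p * ψ ((x p : ℝ) + (q.val : ℝ) * a))
    (f : C(Fin d → Set.Icc (0:ℝ) 1, ℝ)) :
    ∃ g : Fin n → BoundedContinuousFunction ℝ ℝ, (∀ q, ‖g q‖ ≤ ‖f‖) ∧
      ∀ x, |f x - ∑ q, g q (Ψ q x)| ≤ ((2 * d + 1/2) / (n : ℝ)) * ‖f‖ := by
  classical
  have hn0 : (0:ℝ) < n := by exact_mod_cast hn
  have hn1 : (1:ℝ) ≤ n := by exact_mod_cast hn
  rcases eq_or_lt_of_le (norm_nonneg f) with hf0 | hf0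
  · have : f = 0 := norm_eq_zero.1 hf0.symm
    exact ⟨fun _ => 0, by simp, by simp [this]⟩
  have huc : UniformContinuous f := CompactSpace.uniformContinuous_of_continuous f.continuous
  obtain ⟨δ, hδ, huc⟩ := Metric.uniformContinuous_iff.1 huc (‖f‖ / (2 * n)) (by positivity)
  obtain ⟨k, hk⟩ := exists_nat_gt (a / δ)
  obtain ⟨j, hjk, θ, hθ, hs⟩ := hsep k
  set L : ℝ := a / (j + 1 / (n:ℝ)) with hL
  have hL0 : 0 < L := by positivity
  have hLδ : L < δ := by
    have hj : (k:ℝ) ≤ j := by exact_mod_cast hjk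
    rw [div_lt_iff₀ hδ] at hk
    rw [hL, div_lt_iff₀ (by positivity)]
    have : 0 < 1 / (n:ℝ) := by positivity
    nlinarith
  have hdivL : ∀ (x : ℝ) (q : ℕ), (x + q * a) / L = x / L + q * (j + 1 / (n:ℝ)) := by
    intro x q
    rw [hL]; field_simp
  let S : Fin n → Set (Fin d → Set.Icc (0:ℝ) 1) := fun q =>
    {x | ∀ p, Int.fract (((x p : ℝ) + (q.val:ℝ) * a) / L) ≤ 1 - 1 / (n:ℝ)}
  have hfb : ∀ x, |f x| ≤ ‖f‖ := fun x => by simpa using f.norm_coe_le_norm x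
  have hex : ∀ q : Fin n, ∃ g : BoundedContinuousFunction ℝ ℝ, (∀ t, |g t| ≤ ‖f‖ / n) ∧
      ∀ x ∈ S q, |g (Ψ q x) - f x / n| ≤ ‖f‖ / (2 * n) / n := by
    intro q
    refine spr_ext (S q) (fun x => f x / n) (Ψ q)
      (fun x p => ⌊((x p : ℝ) + (q.val:ℝ) * a) / L⌋) θ hθ ?_ (‖f‖ / n) (by positivity) ?_ _ ?_
    · intro x hx y hy hne
      rw [hΨ, hΨ]
      refine hs (fun p => (x p : ℝ) + (q.val:ℝ) * a) (fun p => (y p : ℝ) + (q.val:ℝ) * a)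
        (fun p => hrange q _ (x p).2) (fun p => hrange q _ (y p).2) hx hy ?_
      by_contra hall
      push Not at hall
      exact hne (funext hall)
    · intro x
      rw [abs_div, abs_of_pos hn0]
      gcongr
      exact hfb x
    · intro x hx y hy he
      rw [← sub_div, abs_div, abs_of_pos hn0]
      gcongr
      rw [← Real.dist_eq]
      refine (huc ?_).le
      rw [dist_pi_lt_iff hδ]
      intro p
      refine lt_trans ?_ hLδ
      rw [Subtype.dist_eq, Real.dist_eq]
      have h1 := Int.abs_sub_lt_one_of_floor_eq_floor (congrFun he p)
      rw [← sub_div, abs_div, abs_of_pos hL0, div_lt_one hL0] at h1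
      simpa using h1
  choose g hgB hg using hex
  refine ⟨g, fun q => ?_, fun x => ?_⟩
  · rw [BoundedContinuousFunction.norm_le (norm_nonneg _)]
    intro t
    exact (hgB q t).trans (div_le_self (norm_nonneg _) hn1)
  · let bad : Fin d → Finset (Fin n) := fun p =>
      Finset.univ.filter fun q => 1 - 1 / (n:ℝ) < Int.fract (((x p : ℝ) + (q.val:ℝ) * a) / L)
    have hbad : ∀ p, (bad p).card ≤ 1 := by
      intro p
      rw [Finset.card_le_one]
      intro q hq q' hq'
      simp only [bad, Finset.mem_filter, Finset.mem_univ, true_and, hdivL] at hq hq'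
      by_contra hne
      rcases lt_or_gt_of_ne hne with h | h
      · exact spr_one_bad n j (by omega) _ q'.val q.val q'.isLt h hq' hq
      · exact spr_one_bad n j (by omega) _ q.val q'.val q.isLt h hq hq'
    let Bd : Finset (Fin n) := Finset.univ.biUnion bad
    have hBd : Bd.card ≤ d := by
      refine Finset.card_biUnion_le.trans ?_
      refine (Finset.sum_le_sum fun p _ => hbad p).trans ?_
      simp
    have hBd' : (Bd.card : ℝ) ≤ d := by exact_mod_cast hBd
    have hterm : ∀ q : Fin n, |f x / n - g q (Ψ q x)| ≤
        ‖f‖ / (2 * n) / n + if q ∈ Bd then 2 * ‖f‖ / n else 0 := by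
      intro q
      split_ifs with h
      · have h1 := abs_sub (f x / n) (g q (Ψ q x))
        have h2 := hgB q (Ψ q x)
        have h3 : |f x / n| ≤ ‖f‖ / n := by
          rw [abs_div, abs_of_pos hn0]; gcongr; exact hfb x
        have h4 : 0 ≤ ‖f‖ / (2 * n) / n := by positivity
        have h5 : 2 * ‖f‖ / n = ‖f‖ / n + ‖f‖ / n := by ring
        linarith
      · rw [add_zero, abs_sub_comm]
        apply hg q x
        intro p
        by_contra hlt
        push Not at hlt
        apply h
        simp only [Bd, bad, Finset.mem_biUnion, Finset.mem_filter, Finset.mem_univ, true_and]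
        exact ⟨p, hlt⟩
    have hfx : f x = ∑ q : Fin n, f x / n := by
      rw [Finset.sum_const, Finset.card_univ, Fintype.card_fin, nsmul_eq_mul]; field_simp
    calc |f x - ∑ q, g q (Ψ q x)| = |∑ q : Fin n, (f x / n - g q (Ψ q x))| := by
          rw [Finset.sum_sub_distrib, ← hfx]
      _ ≤ ∑ q : Fin n, (‖f‖ / (2 * n) / n + if q ∈ Bd then 2 * ‖f‖ / n else 0) :=
          (Finset.abs_sum_le_sum_abs _ _).trans (Finset.sum_le_sum fun q _ => hterm q)
      _ = ‖f‖ / (2 * n) + Bd.card * (2 * ‖f‖ / n) := by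
          rw [Finset.sum_add_distrib, Finset.sum_const, Finset.card_univ, Fintype.card_fin,
            nsmul_eq_mul, Finset.sum_ite_mem, Finset.univ_inter, Finset.sum_const, nsmul_eq_mul]
          congr 1
          exact mul_div_cancel₀ _ hn0.ne'
      _ ≤ ‖f‖ / (2 * n) + d * (2 * ‖f‖ / n) := by gcongr
      _ = _ := by field_simp; ring

theorem spr_iterate (d n : ℕ) (ρ : ℝ) (hρ0 : 0 ≤ ρ) (hρ1 : ρ < 1)
    (Ψ : Fin n → C(Fin d → Set.Icc (0:ℝ) 1, ℝ))
    (H : ∀ f : C(Fin d → Set.Icc (0:ℝ) 1, ℝ),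
      ∃ g : Fin n → BoundedContinuousFunction ℝ ℝ, (∀ q, ‖g q‖ ≤ ‖f‖) ∧
      ∀ x, |f x - ∑ q, g q (Ψ q x)| ≤ ρ * ‖f‖)
    (f : C(Fin d → Set.Icc (0:ℝ) 1, ℝ)) :
    ∃ g : Fin n → BoundedContinuousFunction ℝ ℝ, ∀ x, f x = ∑ q, g q (Ψ q x) := by
  choose G hG1 hG2 using H
  let nxt : C(Fin d → Set.Icc (0:ℝ) 1, ℝ) → C(Fin d → Set.Icc (0:ℝ) 1, ℝ) := fun f =>
    f - ∑ q, ((G f q).toContinuousMap.comp (Ψ q))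
  have hnx : ∀ f x, nxt f x = f x - ∑ q, G f q (Ψ q x) := by
    intro f x; simp [nxt, ContinuousMap.sum_apply]
  have hnn : ∀ f, ‖nxt f‖ ≤ ρ * ‖f‖ := by
    intro f
    rw [ContinuousMap.norm_le _ (by positivity)]
    intro x
    rw [hnx]; exact hG2 f x
  let F : ℕ → C(Fin d → Set.Icc (0:ℝ) 1, ℝ) := fun k => nxt^[k] f
  have hF1 : ∀ k, F (k+1) = nxt (F k) := fun k => Function.iterate_succ_apply' _ _ _
  have hFn : ∀ k, ‖F k‖ ≤ ‖f‖ * ρ ^ k := by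
    intro k
    induction k with
    | zero => simp [F]
    | succ k ih =>
      rw [hF1, pow_succ]
      have := hnn (F k)
      have := mul_le_mul_of_nonneg_left ih hρ0
      linarith
  have hgeo : Summable (fun k : ℕ => ‖f‖ * ρ ^ k) := (summable_geometric_of_lt_one hρ0 hρ1).mul_left _
  have hsum : ∀ q, Summable (fun k => G (F k) q) := fun q =>
    Summable.of_norm_bounded hgeo fun k => (hG1 _ q).trans (hFn k)
  refine ⟨fun q => ∑' k, G (F k) q, fun x => ?_⟩
  have hev : ∀ q (t : ℝ), HasSum (fun k => G (F k) q t) ((∑' k, G (F k) q) t) := by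
    intro q t
    exact (hsum q).hasSum.map (BoundedContinuousFunction.evalCLM ℝ t : BoundedContinuousFunction ℝ ℝ →L[ℝ] ℝ)
      (BoundedContinuousFunction.evalCLM ℝ t).continuous
  have h1 : HasSum (fun k => ∑ q, G (F k) q (Ψ q x)) (∑ q, (∑' k, G (F k) q) (Ψ q x)) :=
    hasSum_sum fun q _ => hev q _
  have h2 := h1.tendsto_sum_nat
  have h3 : ∀ N, ∑ k ∈ Finset.range N, ∑ q, G (F k) q (Ψ q x) = f x - F N x := by
    intro N
    induction N with
    | zero => simp [F]
    | succ N ih => rw [Finset.sum_range_succ, ih, hF1, hnx]; ring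
  have h4 : Filter.Tendsto (fun N => F N x) Filter.atTop (nhds 0) := by
    refine squeeze_zero_norm (fun N => ((F N).norm_coe_le_norm x).trans (hFn N)) ?_
    simpa using (tendsto_pow_atTop_nhds_zero_of_lt_one hρ0 hρ1).const_mul ‖f‖
  have h5 : Filter.Tendsto (fun N => f x - F N x) Filter.atTop (nhds (f x - 0)) :=
    tendsto_const_nhds.sub h4
  simp only [h3] at h2
  rw [sub_zero] at h5
  exact tendsto_nhds_unique h5 h2


/-- **Sprecher's variant of the Kolmogorov–Arnold Representation Theorem** (1997):
for integers `d ≥ 2`, `m ≥ 2d`, `γ ≥ m+2`, with `a = 1/(γ(γ-1))`, `λ₁ = 1` and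
`λ_p = Σ_{r=1}^∞ γ^{-(p-1)(dʳ-1)/(d-1)}` for `2 ≤ p ≤ d`, there is a single
monotonically increasing inner function `ψ : [0,2] → [0,2]`, Hölder continuous with
exponent `log 2 / log γ`, such that every continuous real `f` on `[0,1]^d` is
representable as `f(x₁,…,x_d) = Σ_{q=0}^{m} g_q (Σ_{p=1}^{d} λ_p ψ(x_p + qa))` for
some continuous functions `g_q` on `[0, 2(γ-1)/(γ-2)]` depending on `f`.
(Here `p : Fin d` encodes the index `p+1 ∈ {1,…,d}`, so `p-1` becomes `p.val`, and the
summation index `r` runs over `r+1 ∈ {1,2,…}`; the natural-number division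
`(d^(r+1) - 1) / (d - 1)` is exact.) -/
theorem sprecher_kolmogorov_representation
    (d m γ : ℕ) (hd : 2 ≤ d) (hm : 2 * d ≤ m) (hγ : m + 2 ≤ γ)
    (a : ℝ) (ha : a = 1 / ((γ : ℝ) * ((γ : ℝ) - 1)))
    (lam : Fin d → ℝ)
    (hlam1 : ∀ p : Fin d, p.val = 0 → lam p = 1)
    (hlamp : ∀ p : Fin d, 1 ≤ p.val →
      lam p = ∑' r : ℕ,
        (γ : ℝ) ^ (-(((p.val * ((d ^ (r + 1) - 1) / (d - 1))) : ℕ) : ℤ))) :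
    ∃ ψ : ℝ → ℝ,
      MonotoneOn ψ (Set.Icc (0:ℝ) 2) ∧
      Set.MapsTo ψ (Set.Icc (0:ℝ) 2) (Set.Icc (0:ℝ) 2) ∧
      (∃ K : ℝ, 0 < K ∧ ∀ x ∈ Set.Icc (0:ℝ) 2, ∀ y ∈ Set.Icc (0:ℝ) 2,
        |ψ x - ψ y| ≤ K * |x - y| ^ (Real.log 2 / Real.log γ)) ∧
      ∀ f : (Fin d → Set.Icc (0:ℝ) 1) → ℝ, Continuous f →
        ∃ g : Fin (m + 1) → ℝ → ℝ,
          (∀ q, ContinuousOn (g q)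
            (Set.Icc (0:ℝ) (2 * ((γ : ℝ) - 1) / ((γ : ℝ) - 2)))) ∧
          ∀ x, f x = ∑ q, g q (∑ p, lam p * ψ ((x p : ℝ) + (q.val : ℝ) * a)) := by
  have hγ6 : 6 ≤ γ := by omega
  have hγr : (6:ℝ) ≤ γ := by exact_mod_cast hγ6
  have hind := spr_indep d γ hd (by omega) lam hlam1 hlamp
  have ha0 : 0 < a := by rw [ha]; apply one_div_pos.2; apply mul_pos <;> linarith
  have hma : (m:ℝ) * a ≤ 1 := by
    have : (m:ℝ) + 2 ≤ γ := by exact_mod_cast hγ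
    have h0 : (0:ℝ) < γ * (γ - 1) := by apply mul_pos <;> linarith
    rw [ha, mul_one_div, div_le_one h0]
    nlinarith
  have hlog2 : 0 < Real.log 2 := Real.log_pos (by norm_num)
  have hlogγ : Real.log 2 < Real.log γ := Real.log_lt_log (by norm_num) (by linarith)
  have hα0 : 0 < Real.log 2 / Real.log γ := by apply div_pos <;> linarith
  have hα1 : Real.log 2 / Real.log γ < 1 := by rw [div_lt_one (by linarith)]; exact hlogγ
  set α := Real.log 2 / Real.log γ with hα
  have hn0 : (0:ℝ) < ((m+1:ℕ):ℝ) := by positivity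
  obtain ⟨ψ, hcont, hmono, hψ0, hhol, hsep⟩ := spr_baire d lam hind (1 / ((m+1:ℕ):ℝ)) (by positivity)
    (by rw [div_le_one hn0]; push_cast; linarith [(Nat.cast_nonneg m : (0:ℝ) ≤ m)]) α hα0 hα1
    (fun j => a / (j + 1 / ((m+1:ℕ):ℝ))) (fun j => by positivity)
    (by
      refine Filter.Tendsto.const_div_atTop ?_ a
      exact Filter.tendsto_atTop_add_const_right _ _ tendsto_natCast_atTop_atTop)
  have h0mem : (0:ℝ) ∈ Set.Icc (0:ℝ) 2 := by simp
  refine ⟨ψ, hmono, ?_, ⟨1, one_pos, fun x hx y hy => by simpa using hhol x hx y hy⟩, ?_⟩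
  · intro x hx
    constructor
    · rw [← hψ0]; exact hmono h0mem hx hx.1
    · have h1 := (le_abs_self _).trans (hhol x hx 0 h0mem)
      rw [hψ0, sub_zero, sub_zero, abs_of_nonneg hx.1] at h1
      calc ψ x ≤ x ^ α := h1
        _ ≤ 2 ^ α := Real.rpow_le_rpow hx.1 hx.2 hα0.le
        _ ≤ 2 ^ (1:ℝ) := Real.rpow_le_rpow_of_exponent_le (by norm_num) hα1.le
        _ = 2 := by simp
  · intro f hf
    let Ψ : Fin (m+1) → C(Fin d → Set.Icc (0:ℝ) 1, ℝ) := fun q =>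
      ⟨fun x => ∑ p, lam p * ψ ((x p : ℝ) + (q.val : ℝ) * a), by fun_prop⟩
    have hrange : ∀ q : Fin (m+1), ∀ x ∈ Set.Icc (0:ℝ) 1,
        x + (q.val:ℝ) * a ∈ Set.Icc (0:ℝ) 2 := by
      intro q x hx
      have h1 : (q.val:ℝ) ≤ m := by exact_mod_cast Nat.lt_succ_iff.1 q.isLt
      have h2 : (q.val:ℝ) * a ≤ m * a := by gcongr
      have h3 : 0 ≤ (q.val:ℝ) * a := by positivity
      exact ⟨by linarith [hx.1], by linarith [hx.2]⟩
    obtain ⟨g, hg⟩ := spr_iterate d (m+1) ((2 * d + 1/2) / ((m+1 : ℕ) : ℝ)) (by positivity)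
      (by
        rw [div_lt_one hn0]
        have : (2:ℝ) * d ≤ m := by exact_mod_cast hm
        push_cast; linarith) Ψ
      (spr_approx d (m+1) (by omega) lam ψ a ha0 hrange hsep Ψ (fun q x => rfl)) ⟨f, hf⟩
    exact ⟨fun q => g q, fun q => (g q).continuous.continuousOn, fun x => hg x⟩
end
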